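/- Let B_1 be the unit ball in ℝ^N centered at the origin, N ≥ 4 even, and α > 0. If 2 < p < (2N+2α)/(N−2), then there exists a positive classical solution u of the Hénon equation −Δu = |x|^α u^{p−1} in B_1, u = 0 on ∂B_1, which is a K_+ ground state (a mountain-pass critical point of the energy restricted to K_+). -/

import Mathlib

open MeasureTheory Real Set Filter

noncomputable section

abbrev Euc (N : ℕ) := EuclideanSpace ℝ (Fin N)

variable {N : ℕ}

/-- The Euclidean Laplacian. -/
def lap (u : Euc N → ℝ) (x : Euc N) : ℝ :=
  ∑ i : Fin N,
    iteratedFDeriv ℝ 2 u x ![EuclideanSpace.single i 1, EuclideanSpace.single i 1]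

/-- `s = (x₁² + ⋯ + xₙ²)^{1/2}`. -/
def sVar (n : ℕ) (x : Euc N) : ℝ :=
  Real.sqrt (∑ j : Fin N, if (j : ℕ) < n then x j ^ 2 else 0)

/-- `t = (x_{n+1}² + ⋯ + x_N²)^{1/2}`. -/
def tVar (n : ℕ) (x : Euc N) : ℝ :=
  Real.sqrt (∑ j : Fin N, if n ≤ (j : ℕ) then x j ^ 2 else 0)

/-- Pragmatic membership in `H¹₀(Ω)` (continuous representative). -/
def MemH10 (Ω : Set (Euc N)) (u : Euc N → ℝ) : Prop :=
  Continuous u ∧ (∀ x ∈ Ω, DifferentiableAt ℝ u x) ∧ (∀ x ∉ Ω, u x = 0) ∧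
    IntegrableOn (fun x => ‖gradient u x‖ ^ 2) Ω volume ∧
    IntegrableOn (fun x => u x ^ 2) Ω volume

/-- `(s,t)` lies in the cross-section of `Ω`. -/
def inCross (n : ℕ) (Ω : Set (Euc N)) (s t : ℝ) : Prop :=
  ∃ x ∈ Ω, sVar n x = s ∧ tVar n x = t

/-- The convex cone `K₊`: nonnegative `G`-invariant functions in `H¹₀(Ω)`,
even across `θ = π/4` and nondecreasing in `θ` on `Ω̃₀` (i.e. for `0 < θ < π/4`). -/
def Kplus (n : ℕ) (Ω : Set (Euc N)) : Set (Euc N → ℝ) :=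
  { u | MemH10 Ω u ∧ (∀ x, 0 ≤ u x) ∧
      ∃ w : ℝ → ℝ → ℝ,
        (∀ x, u x = w (sVar n x) (tVar n x)) ∧
        (∀ s t, w s t = w t s) ∧
        (∀ r θ₁ θ₂ : ℝ, 0 < θ₁ → θ₁ ≤ θ₂ → θ₂ < π / 4 →
          inCross n Ω (r * Real.cos θ₁) (r * Real.sin θ₁) →
          inCross n Ω (r * Real.cos θ₂) (r * Real.sin θ₂) →
          w (r * Real.cos θ₁) (r * Real.sin θ₁) ≤ w (r * Real.cos θ₂) (r * Real.sin θ₂)) }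

/-- The energy functional `E(u) = (1/2)∫_Ω |∇u|² − (1/p)∫_Ω a|u|^p`. -/
def energy (Ω : Set (Euc N)) (a : Euc N → ℝ) (p : ℝ) (u : Euc N → ℝ) : ℝ :=
  (1 / 2) * (∫ x in Ω, ‖gradient u x‖ ^ 2) - (1 / p) * (∫ x in Ω, a x * |u x| ^ p)

/-- The norm of the space `V = H¹₀(Ω) ∩ L^p_a(Ω)`. -/
def vnorm (Ω : Set (Euc N)) (a : Euc N → ℝ) (p : ℝ) (u : Euc N → ℝ) : ℝ :=
  (∫ x in Ω, (‖gradient u x‖ ^ 2 + u x ^ 2)) ^ (1 / 2 : ℝ) +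
    (∫ x in Ω, a x * |u x| ^ p) ^ (1 / p)

/-- The mountain pass level of the energy restricted to `K`. -/
def mountainPassLevel (Ω : Set (Euc N)) (a : Euc N → ℝ) (p : ℝ)
    (K : Set (Euc N → ℝ)) : ℝ :=
  sInf { c : ℝ | ∃ γ : ℝ → Euc N → ℝ,
    (∀ t ∈ Icc (0 : ℝ) 1, γ t ∈ K) ∧
    (∀ t ∈ Icc (0 : ℝ) 1, ∀ ε > (0 : ℝ), ∃ δ > (0 : ℝ), ∀ s ∈ Icc (0 : ℝ) 1,
      |s - t| < δ → vnorm Ω a p (γ s - γ t) < ε) ∧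
    γ 0 = 0 ∧ γ 1 ≠ 0 ∧ energy Ω a p (γ 1) ≤ 0 ∧
    c = sSup ((fun t => energy Ω a p (γ t)) '' Icc (0 : ℝ) 1) }

/-- `u` is a `K` ground state: a mountain-pass critical point of the energy restricted
to `K`, at the (positive) mountain-pass level. -/
def IsGroundState (Ω : Set (Euc N)) (a : Euc N → ℝ) (p : ℝ)
    (K : Set (Euc N → ℝ)) (u : Euc N → ℝ) : Prop :=
  u ∈ K ∧ 0 < energy Ω a p u ∧ energy Ω a p u = mountainPassLevel Ω a p K

namespace Henon
open Topology Metric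
variable {N : ℕ}
notation "Fn" N:max => Euc N → ℝ

lemma nontriv {N : ℕ} (h : 1 ≤ N) : Nontrivial (Euc N) := by
  have : Nonempty (Fin N) := ⟨⟨0, h⟩⟩
  infer_instance

lemma int_rpow_ball {N : ℕ} (h : 1 ≤ N) {c : ℝ} (hc : c < N) (R : ℝ) :
    IntegrableOn (fun z : Euc N => ‖z‖ ^ (-c)) (ball 0 R) volume := by
  have := nontriv h
  rw [integrableOn_fun_norm_addHaar (E := Euc N) volume (f := fun r => r ^ (-c))]
  simp only [finrank_euclideanSpace, Fintype.card_fin]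
  rcases le_or_gt R 0 with hR | hR
  · simp [Ioo_eq_empty_of_le hR]
  have h1 : IntegrableOn (fun y : ℝ => y ^ ((N : ℝ) - 1 - c)) (Ioo 0 R) := by
    have := (intervalIntegral.intervalIntegrable_rpow' (a := 0) (b := R)
      (r := (N : ℝ) - 1 - c) (by linarith)).1
    exact this.mono_set Ioo_subset_Ioc_self
  refine h1.congr_fun (fun y hy => ?_) measurableSet_Ioo
  have hy0 : 0 < y := hy.1
  simp only [smul_eq_mul]
  rw [← rpow_natCast, ← rpow_add hy0]
  congr 1
  rw [Nat.cast_sub h]; push_cast; ring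

lemma int_rpow_compl {N : ℕ} (h : 1 ≤ N) {c : ℝ} (hc : (N : ℝ) < c) {R : ℝ} (hR : 0 < R) :
    IntegrableOn (fun z : Euc N => ‖z‖ ^ (-c)) (ball 0 R)ᶜ volume := by
  have := nontriv h
  have e : (fun z : Euc N => (ball (0 : Euc N) R)ᶜ.indicator (fun z => ‖z‖ ^ (-c)) z)
      = fun z : Euc N => (Ici R).indicator (fun r => r ^ (-c)) ‖z‖ := by
    ext z; simp [indicator]
  rw [← integrable_indicator_iff measurableSet_ball.compl]
  change Integrable (fun z : Euc N => (ball (0 : Euc N) R)ᶜ.indicator (fun z => ‖z‖ ^ (-c)) z) _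
  rw [e, integrable_fun_norm_addHaar (E := Euc N) volume (f := (Ici R).indicator fun r => r ^ (-c))]
  simp only [finrank_euclideanSpace, Fintype.card_fin]
  have h1 : IntegrableOn (fun y : ℝ => y ^ ((N : ℝ) - 1 - c)) (Ici R) := by
    rw [integrableOn_Ici_iff_integrableOn_Ioi]
    exact integrableOn_Ioi_rpow_of_lt (by linarith) hR
  have h2 := (integrable_indicator_iff measurableSet_Ici).2 h1
  refine h2.integrableOn.congr_fun (fun y hy => ?_) measurableSet_Ioi
  have hy0 : 0 < y := hy
  by_cases hyR : y ∈ Ici R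
  · simp only [indicator_of_mem hyR, smul_eq_mul]
    rw [← rpow_natCast, ← rpow_add hy0]
    congr 1
    rw [Nat.cast_sub h]; push_cast; ring
  · simp [indicator_of_notMem hyR]

/-- unnormalised fundamental solution -/
def rad (m : ℕ) (z : Euc N) : ℝ := ((‖z‖ ^ 2) ^ m)⁻¹
def pos1 (x : Euc N) : ℝ := max 0 (1 - ‖x‖ ^ 2)
def hk (m : ℕ) (x y : Euc N) : ℝ := ((‖x - y‖ ^ 2 + pos1 x * pos1 y) ^ m)⁻¹
def gk (m : ℕ) (x y : Euc N) : ℝ := max 0 (rad m (x - y) - hk m x y)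
def mu (N : ℕ) : Measure (Euc N) := volume.restrict (ball 0 1)
def kap (N m : ℕ) : ℝ := ∫ z : Euc N, (2 * m * N : ℝ) * ((1 + ‖z‖ ^ 2) ^ (m + 2))⁻¹
/-- Green operator of the unit ball. -/
def Gop (m : ℕ) (f : Fn N) (x : Euc N) : ℝ := (kap N m)⁻¹ * ∫ y, gk m x y * f y ∂(mu N)

instance : IsFiniteMeasure (mu N) := by
  unfold mu; exact ⟨by simpa using measure_ball_lt_top⟩

lemma pos1_nonneg (x : Euc N) : 0 ≤ pos1 x := le_max_left _ _
lemma pos1_of_mem {x : Euc N} (hx : ‖x‖ < 1) : pos1 x = 1 - ‖x‖ ^ 2 := by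
  unfold pos1; rw [max_eq_right]; nlinarith [norm_nonneg x]
lemma pos1_pos {x : Euc N} (hx : ‖x‖ < 1) : 0 < pos1 x := by
  rw [pos1_of_mem hx]; nlinarith [norm_nonneg x]
lemma pos1_of_ge {x : Euc N} (hx : 1 ≤ ‖x‖) : pos1 x = 0 := by
  unfold pos1; rw [max_eq_left]; nlinarith [norm_nonneg x]
lemma continuous_pos1 : Continuous (pos1 : Fn N) := by unfold pos1; fun_prop

lemma rad_nonneg (m : ℕ) (z : Euc N) : 0 ≤ rad m z := by unfold rad; positivity
lemma hk_nonneg (m : ℕ) (x y : Euc N) : 0 ≤ hk m x y := by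
  have := pos1_nonneg x; have := pos1_nonneg y
  unfold hk; positivity
lemma gk_nonneg (m : ℕ) (x y : Euc N) : 0 ≤ gk m x y := le_max_left _ _
lemma gk_le_rad (m : ℕ) (x y : Euc N) : gk m x y ≤ rad m (x - y) :=
  max_le (rad_nonneg _ _) (by linarith [hk_nonneg m x y])
lemma hk_le_rad (m : ℕ) {x y : Euc N} (h : x ≠ y) : hk m x y ≤ rad m (x - y) := by
  unfold hk rad
  have h0 : 0 < ‖x - y‖ := norm_pos_iff.2 (sub_ne_zero.2 h)
  have := mul_nonneg (pos1_nonneg x) (pos1_nonneg y)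
  gcongr; linarith
lemma gk_eq (m : ℕ) {x y : Euc N} (h : x ≠ y) : gk m x y = rad m (x - y) - hk m x y :=
  max_eq_right (by linarith [hk_le_rad m h])
lemma gk_pos {m : ℕ} (hm : 1 ≤ m) {x y : Euc N} (h : x ≠ y) (hx : ‖x‖ < 1) (hy : ‖y‖ < 1) :
    0 < gk m x y := by
  rw [gk_eq m h, sub_pos]
  unfold hk rad
  have h0 : 0 < ‖x - y‖ := norm_pos_iff.2 (sub_ne_zero.2 h)
  have := mul_pos (pos1_pos hx) (pos1_pos hy)
  gcongr
  linarith
lemma gk_of_ge (m : ℕ) {x : Euc N} (hx : 1 ≤ ‖x‖) (y : Euc N) : gk m x y = 0 := by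
  unfold gk hk rad; simp [pos1_of_ge hx]
lemma gk_symm (m : ℕ) (x y : Euc N) : gk m x y = gk m y x := by
  unfold gk hk rad; rw [norm_sub_rev, mul_comm (pos1 x)]
lemma gk_isom (m : ℕ) (R : Euc N ≃ₗᵢ[ℝ] Euc N) (x y : Euc N) : gk m (R x) (R y) = gk m x y := by
  unfold gk hk rad pos1; simp only [← map_sub, R.norm_map]

lemma meas_gk (m : ℕ) : Measurable (fun q : Euc N × Euc N => gk m q.1 q.2) := by
  unfold gk rad hk
  have := (continuous_pos1 (N := N)).measurable
  fun_prop

lemma rad_eq (m : ℕ) (z : Euc N) : rad m z = ‖z‖ ^ (-(2 * m : ℝ)) := by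
  unfold rad
  rw [rpow_neg (norm_nonneg _), ← pow_mul]
  congr 1
  rw [← rpow_natCast]; push_cast; rfl

lemma meas_rad (m : ℕ) : Measurable (rad m : Fn N) := by
  unfold rad; fun_prop

lemma int_rad_ball {m : ℕ} (hN : N = 2 * m + 2) (R : ℝ) :
    IntegrableOn (rad m : Fn N) (ball 0 R) volume := by
  have := int_rpow_ball (N := N) (by omega) (c := 2 * m) (by subst hN; push_cast; linarith) R
  exact this.congr_fun (fun z _ => (rad_eq m z).symm) measurableSet_ball

/-- translate/reflect -/
lemma int_comp_sub_ball {f : Fn N} {R : ℝ} {x : Euc N}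
    (hf : IntegrableOn f (ball 0 (‖x‖ + R)) volume) :
    IntegrableOn (fun y => f (x - y)) (ball 0 R) volume := by
  have h1 : Integrable ((ball (0 : Euc N) (‖x‖ + R)).indicator f) volume :=
    (integrable_indicator_iff measurableSet_ball).2 hf
  have h2 := (h1.comp_sub_left x).integrableOn (s := ball 0 R)
  refine h2.congr_fun (fun y hy => ?_) measurableSet_ball
  have : x - y ∈ ball (0 : Euc N) (‖x‖ + R) := by
    simp at hy ⊢; linarith [norm_sub_le x y]
  simp only [indicator_of_mem this]

lemma setint_comp_sub_le {f : Fn N} (h0 : ∀ z, 0 ≤ f z) {R S : ℝ} {x : Euc N}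
    (hx : ‖x‖ + R ≤ S) (hf : IntegrableOn f (ball 0 S) volume) :
    ∫ y in ball (0 : Euc N) R, f (x - y) ≤ ∫ z in ball (0 : Euc N) S, f z := by
  have h1 : Integrable ((ball (0 : Euc N) S).indicator f) volume :=
    (integrable_indicator_iff measurableSet_ball).2 hf
  rw [← integral_indicator measurableSet_ball, ← integral_indicator measurableSet_ball,
    ← integral_sub_left_eq_self ((ball (0 : Euc N) S).indicator f) volume x]
  refine integral_mono_of_nonneg (ae_of_all _ fun y => indicator_nonneg (fun _ _ => h0 _) _)
    (h1.comp_sub_left x) (ae_of_all _ fun y => ?_)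
  by_cases hy : y ∈ ball (0 : Euc N) R
  · have : x - y ∈ ball (0 : Euc N) S := by
      simp at hy ⊢; linarith [norm_sub_le x y]
    simp only [indicator_of_mem this, indicator_of_mem hy]; exact le_rfl
  · simp only [indicator_of_notMem hy]; exact indicator_nonneg (fun _ _ => h0 _) _

lemma int_rad {m : ℕ} (hN : N = 2 * m + 2) (x : Euc N) : Integrable (fun y => rad m (x - y)) (mu N) :=
  int_comp_sub_ball (int_rad_ball hN _)

lemma int_gk {m : ℕ} (hN : N = 2 * m + 2) (x : Euc N) : Integrable (gk m x) (mu N) :=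
  (int_rad hN x).mono' ((meas_gk m).comp measurable_prodMk_left).aestronglyMeasurable
    (ae_of_all _ fun y => by
      rw [norm_of_nonneg (gk_nonneg _ _ _)]; exact gk_le_rad _ _ _)

lemma bdd_of_cont {F : Type*} [NormedAddCommGroup F] {f : Euc N → F} (hf : Continuous f) (R : ℝ) :
    ∃ M, 0 ≤ M ∧ ∀ x ∈ closedBall (0 : Euc N) R, ‖f x‖ ≤ M := by
  obtain ⟨M, hM⟩ := (isCompact_closedBall (0 : Euc N) R).exists_bound_of_continuousOn hf.continuousOn
  exact ⟨max M 0, le_max_right _ _, fun x hx => (hM x hx).trans (le_max_left _ _)⟩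

lemma ae_mu {P : Euc N → Prop} (h : ∀ y, ‖y‖ < 1 → P y) : ∀ᵐ y ∂(mu N), P y := by
  unfold mu
  filter_upwards [ae_restrict_mem measurableSet_ball] with y hy
  exact h y (by simpa using hy)

lemma ae_ne {m : ℕ} (hN : N = 2 * m + 2) (x : Euc N) : ∀ᵐ y ∂(mu N), x ≠ y := by
  have := nontriv (N := N) (by omega)
  have : ∀ᵐ y ∂(volume : Measure (Euc N)), y ≠ x := by
    simp [ae_iff, measure_singleton]
  filter_upwards [ae_restrict_of_ae this] with y hy using hy.symm

lemma int_gk_mul {m : ℕ} (hN : N = 2 * m + 2) (x : Euc N) {f : Fn N} (hf : Continuous f) :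
    Integrable (fun y => gk m x y * f y) (mu N) := by
  obtain ⟨M, -, hM⟩ := bdd_of_cont hf 1
  refine (int_gk hN x).mul_bdd (c := M) hf.aestronglyMeasurable (ae_mu fun y hy => hM y (by simpa using hy.le))

lemma int_cont {f : Fn N} (hf : Continuous f) : Integrable f (mu N) := by
  obtain ⟨M, -, hM⟩ := bdd_of_cont hf 1
  exact Integrable.of_bound hf.aestronglyMeasurable M (ae_mu fun y hy => hM y (by simpa using hy.le))

end Henon

namespace Henon
open Topology Metric
variable {N : ℕ}

lemma kap_int {m : ℕ} (hN : N = 2 * m + 2) :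
    Integrable (fun z : Euc N => (2 * m * N : ℝ) * ((1 + ‖z‖ ^ 2) ^ (m + 2))⁻¹) volume := by
  have h := integrable_rpow_neg_one_add_norm_sq (E := Euc N) (μ := volume) (r := 2 * m + 4)
    (by rw [finrank_euclideanSpace, Fintype.card_fin, hN]; push_cast; linarith)
  refine (h.const_mul (2 * m * N : ℝ)).congr (ae_of_all _ fun z => ?_)
  simp only
  congr 1
  rw [show -(2 * (m : ℝ) + 4) / 2 = -((m + 2 : ℕ) : ℝ) by push_cast; ring, rpow_neg (by positivity),
    rpow_natCast]

lemma kap_pos {m : ℕ} (hN : N = 2 * m + 2) (hm : 1 ≤ m) : 0 < kap N m := by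
  have hN' : (0 : ℝ) < 2 * m * N := by
    have : 0 < m := hm
    have : 0 < N := by omega
    positivity
  unfold kap
  rw [integral_pos_iff_support_of_nonneg (fun z => by positivity) (kap_int hN)]
  have : Function.support (fun z : Euc N => (2 * m * N : ℝ) * ((1 + ‖z‖ ^ 2) ^ (m + 2))⁻¹) = univ := by
    ext z; simp only [Function.mem_support, mem_univ, iff_true]; positivity
  rw [this]; exact isOpen_univ.measure_pos volume univ_nonempty

lemma rad_trunc {m : ℕ} (hN : N = 2 * m + 2) {ε : ℝ} (hε : 0 < ε) (R : ℝ) :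
    ∃ K : ℝ, 0 < K ∧ ∫ z in ball (0 : Euc N) R, max 0 (rad m z - K) < ε := by
  have h : Tendsto (fun k : ℕ => ∫ z in ball (0 : Euc N) R, max 0 (rad m z - ((k : ℝ) + 1))) atTop
      (𝓝 (∫ z in ball (0 : Euc N) R, (0 : ℝ))) := by
    refine tendsto_integral_of_dominated_convergence (rad m)
      (fun k => (measurable_const.max ((meas_rad m).sub_const _)).aestronglyMeasurable)
      (int_rad_ball hN R) (fun k => ae_of_all _ fun z => ?_) (ae_of_all _ fun z => ?_)
    · rw [norm_of_nonneg (le_max_left _ _)]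
      exact max_le (rad_nonneg _ _) (by have : (0 : ℝ) ≤ k := by positivity
                                        linarith)
    · refine tendsto_const_nhds.congr' ?_
      obtain ⟨k0, hk0⟩ := exists_nat_gt (rad m z)
      filter_upwards [eventually_ge_atTop k0] with k hk
      have : (k0 : ℝ) ≤ k := by exact_mod_cast hk
      rw [max_eq_left]; linarith
  rw [integral_zero] at h
  obtain ⟨k, hk⟩ := (h.eventually (gt_mem_nhds hε)).exists
  exact ⟨k + 1, by positivity, hk⟩

lemma cont_gk {m : ℕ} {x y : Euc N} (h : x ≠ y) : ContinuousAt (fun x' => gk m x' y) x := by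
  have h0 : 0 < ‖x - y‖ := norm_pos_iff.2 (sub_ne_zero.2 h)
  unfold gk rad hk
  have hp := (continuous_pos1 (N := N)).continuousAt (x := x)
  have : 0 ≤ pos1 x * pos1 y := mul_nonneg (pos1_nonneg x) (pos1_nonneg y)
  refine continuousAt_const.max (ContinuousAt.sub (ContinuousAt.inv₀ (by fun_prop) (by positivity))
    (ContinuousAt.inv₀ (by fun_prop) (by positivity)))

lemma L1_aux {a b c d K : ℝ} (h1 : a ≤ c) (h2 : b ≤ d) :
    |a - b| ≤ (|min a K - min b K| + max 0 (c - K)) + max 0 (d - K) := by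
  rcases le_total a K with h | h <;> rcases le_total b K with h' | h' <;>
    simp only [min_eq_left, min_eq_right, h, h'] <;>
    rcases le_total 0 (c - K) with e | e <;> rcases le_total 0 (d - K) with e' | e' <;>
    simp only [max_eq_left, max_eq_right, e, e'] <;>
    rw [abs_le] <;> constructor <;>
    linarith [le_abs_self (a - b), neg_abs_le (a - b), le_abs_self (a - K), neg_abs_le (a - K), le_abs_self (K - b), neg_abs_le (K - b), abs_nonneg (K - K)]

lemma meas_gk' (m : ℕ) (x : Euc N) : Measurable (gk m x) := by
  have h := (meas_gk (N := N) m).comp (measurable_prodMk_left (x := x))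
  exact h

lemma trunc_le {m : ℕ} (hN : N = 2 * m + 2) {K : ℝ} (hK : 0 < K) {x : Euc N} {S : ℝ} (hS : ‖x‖ + 1 ≤ S) :
    ∫ y, max 0 (rad m (x - y) - K) ∂(mu N) ≤ ∫ z in ball (0 : Euc N) S, max 0 (rad m z - K) := by
  unfold mu
  refine setint_comp_sub_le (f := fun z => max 0 (rad m z - K)) (fun z => le_max_left _ _) hS ?_
  refine (int_rad_ball hN _).mono' (measurable_const.max ((meas_rad m).sub_const _)).aestronglyMeasurable
    (ae_of_all _ fun z => ?_)
  rw [norm_of_nonneg (le_max_left _ _)]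
  exact max_le (rad_nonneg _ _) (by linarith)

lemma trunc_tendsto {m : ℕ} (hN : N = 2 * m + 2) (x : Euc N) {K : ℝ} (hK : 0 < K) :
    Tendsto (fun x' => ∫ y, |min (gk m x' y) K - min (gk m x y) K| ∂(mu N)) (𝓝 x) (𝓝 0) := by
  have hm1 : ∀ x : Euc N, Measurable (fun y => gk m x y) := fun x => meas_gk' m x
  rw [← integral_zero (Euc N) ℝ (μ := mu N)]
  refine tendsto_integral_filter_of_dominated_convergence (fun _ => K) ?_ ?_ (integrable_const _) ?_
  · refine Eventually.of_forall fun x' => ?_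
    exact (((hm1 x').min measurable_const).sub ((hm1 x).min measurable_const)).norm.aestronglyMeasurable
  · refine Eventually.of_forall fun x' => ae_of_all _ fun y => ?_
    rw [norm_eq_abs, abs_abs, abs_le]
    have a1 : 0 ≤ min (gk m x' y) K := le_min (gk_nonneg _ _ _) hK.le
    have a2 : 0 ≤ min (gk m x y) K := le_min (gk_nonneg _ _ _) hK.le
    have a3 := min_le_right (gk m x' y) K
    have a4 := min_le_right (gk m x y) K
    constructor <;> linarith
  · filter_upwards [ae_ne hN x] with y hy
    have hc : ContinuousAt (fun x' => |min (gk m x' y) K - min (gk m x y) K|) x :=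
      (((cont_gk hy).min continuousAt_const).sub continuousAt_const).abs
    have := hc.tendsto
    simpa using this

lemma gk_L1 {m : ℕ} (hN : N = 2 * m + 2) (x : Euc N) {ε : ℝ} (hε : 0 < ε) :
    ∀ᶠ x' in 𝓝 x, ∫ y, |gk m x' y - gk m x y| ∂(mu N) < ε := by
  obtain ⟨K, hK, hKi⟩ := rad_trunc hN (show 0 < ε / 3 by linarith) (‖x‖ + 2)
  have hm1 : ∀ x : Euc N, Measurable (fun y => gk m x y) := fun x => meas_gk' m x
  have h1 := trunc_tendsto hN x hK
  have h2 : ∀ᶠ x' in 𝓝 x, ‖x'‖ < ‖x‖ + 1 :=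
    continuous_norm.continuousAt.eventually (gt_mem_nhds (by linarith))
  have key : ∀ x' : Euc N, ‖x'‖ < ‖x‖ + 1 → ∫ y, max 0 (rad m (x' - y) - K) ∂(mu N) < ε / 3 :=
    fun x' hx' => (trunc_le hN hK (by linarith)).trans_lt hKi
  have hin : ∀ x' : Euc N, Integrable (fun y => max 0 (rad m (x' - y) - K)) (mu N) := by
    intro x'
    refine (int_rad hN x').mono' (measurable_const.max (((meas_rad m).comp
      (measurable_const.sub measurable_id)).sub_const _)).aestronglyMeasurable
      (ae_of_all _ fun z => ?_)
    rw [norm_of_nonneg (le_max_left _ _)]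
    exact max_le (rad_nonneg _ _) (by linarith)
  have hin2 : ∀ x' : Euc N, Integrable (fun y => min (gk m x' y) K) (mu N) := fun x' =>
    (int_gk hN x').mono' ((hm1 x').min measurable_const).aestronglyMeasurable (ae_of_all _ fun y => by
      rw [norm_of_nonneg (le_min (gk_nonneg _ _ _) hK.le)]; exact min_le_left _ _)
  filter_upwards [h1.eventually (gt_mem_nhds (show 0 < ε / 3 by linarith)), h2] with x' h1' h2'
  have hd : Integrable (fun y => |min (gk m x' y) K - min (gk m x y) K|) (mu N) :=
    ((hin2 x').sub (hin2 x)).abs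
  calc ∫ y, |gk m x' y - gk m x y| ∂(mu N)
      ≤ ∫ y, ((|min (gk m x' y) K - min (gk m x y) K| + max 0 (rad m (x' - y) - K))
          + max 0 (rad m (x - y) - K)) ∂(mu N) := by
        refine integral_mono ((int_gk hN x').sub (int_gk hN x)).abs ((hd.add (hin x')).add (hin x)) ?_
        intro y
        exact L1_aux (gk_le_rad m x' y) (gk_le_rad m x y)
    _ = (∫ y, |min (gk m x' y) K - min (gk m x y) K| ∂(mu N)) + (∫ y, max 0 (rad m (x' - y) - K) ∂(mu N))
          + ∫ y, max 0 (rad m (x - y) - K) ∂(mu N) := by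
        rw [← integral_add hd (hin x')]; exact integral_add (hd.add (hin x')) (hin x)
    _ < ε := by linarith [key x' h2', key x (by linarith)]

lemma Gop_diff_le {m : ℕ} (hN : N = 2 * m + 2) (hm : 1 ≤ m) {f : Fn N} (hf : Continuous f) {M : ℝ}
    (hM : ∀ y, ‖y‖ < 1 → |f y| ≤ M) (x x' : Euc N) :
    |Gop m f x' - Gop m f x| ≤ (kap N m)⁻¹ * (M * ∫ y, |gk m x' y - gk m x y| ∂(mu N)) := by
  have hk := kap_pos hN hm
  unfold Gop
  rw [← mul_sub, abs_mul, abs_of_pos (inv_pos.2 hk), ← integral_sub (int_gk_mul hN _ hf) (int_gk_mul hN _ hf),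
    ← integral_const_mul]
  gcongr
  refine (abs_integral_le_integral_abs).trans (integral_mono_ae
    ((int_gk_mul hN _ hf).sub (int_gk_mul hN _ hf)).abs (((int_gk hN x').sub (int_gk hN x)).abs.const_mul M)
    (ae_mu fun y hy => ?_))
  simp only [← sub_mul, abs_mul]
  rw [mul_comm]
  exact mul_le_mul_of_nonneg_right (hM y hy) (abs_nonneg _)

lemma Gop_cont {m : ℕ} (hN : N = 2 * m + 2) (hm : 1 ≤ m) {f : Fn N} (hf : Continuous f) :
    Continuous (Gop m f) := by
  rw [continuous_iff_continuousAt]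
  intro x
  obtain ⟨M, hM0, hM⟩ := bdd_of_cont hf 1
  have hk := kap_pos hN hm
  rw [ContinuousAt, Metric.tendsto_nhds]
  intro ε hε
  filter_upwards [gk_L1 hN x (ε := ε * kap N m / (M + 1)) (by positivity)] with x' hx'
  rw [dist_eq]
  refine (Gop_diff_le hN hm hf (M := M + 1) (fun y hy => (hM y (by simpa using hy.le)).trans (by linarith)) x x').trans_lt ?_
  calc _ < (kap N m)⁻¹ * ((M + 1) * (ε * kap N m / (M + 1))) := by gcongr
    _ = ε := by field_simp

lemma Gop_zero {m : ℕ} (f : Fn N) {x : Euc N} (hx : 1 ≤ ‖x‖) : Gop m f x = 0 := by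
  unfold Gop; simp [gk_of_ge m hx]

lemma Gop_mono {m : ℕ} (hN : N = 2 * m + 2) (hm : 1 ≤ m) {f g : Fn N} (hf : Continuous f) (hg : Continuous g)
    (h : ∀ y, ‖y‖ < 1 → f y ≤ g y) (x : Euc N) : Gop m f x ≤ Gop m g x := by
  have hk := kap_pos hN hm
  unfold Gop
  refine mul_le_mul_of_nonneg_left ?_ (inv_pos.2 hk).le
  refine integral_mono_ae (int_gk_mul hN _ hf) (int_gk_mul hN _ hg) (ae_mu fun y hy => ?_)
  exact mul_le_mul_of_nonneg_left (h y hy) (gk_nonneg _ _ _)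

lemma Gop_nonneg {m : ℕ} (hN : N = 2 * m + 2) (hm : 1 ≤ m) {f : Fn N}
    (h : ∀ y, ‖y‖ < 1 → 0 ≤ f y) (x : Euc N) : 0 ≤ Gop m f x := by
  have hk := kap_pos hN hm
  unfold Gop
  exact mul_nonneg (inv_pos.2 hk).le (integral_nonneg_of_ae (ae_mu fun y hy =>
    mul_nonneg (gk_nonneg _ _ _) (h y hy)))

lemma Gop_pos {m : ℕ} (hN : N = 2 * m + 2) (hm : 1 ≤ m) {f : Fn N} (hf : Continuous f)
    (h : ∀ y, ‖y‖ < 1 → 0 ≤ f y) {y0 : Euc N} (hy0 : ‖y0‖ < 1) (h0 : 0 < f y0) {x : Euc N} (hx : ‖x‖ < 1) :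
    0 < Gop m f x := by
  have hk := kap_pos hN hm
  unfold Gop
  refine mul_pos (inv_pos.2 hk) ?_
  rw [integral_pos_iff_support_of_nonneg_ae (ae_mu fun y hy => mul_nonneg (gk_nonneg _ _ _) (h y hy))
    (int_gk_mul hN x hf)]
  have hne := nontriv (N := N) (by omega)
  have hop : IsOpen ({y : Euc N | 0 < f y} ∩ ball 0 1) := (isOpen_lt continuous_const hf).inter isOpen_ball
  have hpos : 0 < (volume : Measure (Euc N)) (({y : Euc N | 0 < f y} ∩ ball 0 1) \ {x}) := by
    rw [measure_sdiff_null (measure_singleton x)]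
    exact hop.measure_pos _ ⟨y0, h0, by simpa using hy0⟩
  refine hpos.trans_le ?_
  unfold mu
  rw [Measure.restrict_apply' measurableSet_ball]
  refine measure_mono fun y hy => ⟨?_, hy.1.2⟩
  have hy1 : ‖y‖ < 1 := by simpa using hy.1.2
  have : x ≠ y := fun h => hy.2 (by simp [h])
  exact (mul_pos (gk_pos hm this hx hy1) hy.1.1).ne'

lemma Gop_add {m : ℕ} (hN : N = 2 * m + 2) {f g : Fn N} (hf : Continuous f) (hg : Continuous g) (x : Euc N) :
    Gop m (fun y => f y + g y) x = Gop m f x + Gop m g x := by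
  unfold Gop
  rw [← mul_add, ← integral_add (int_gk_mul hN _ hf) (int_gk_mul hN _ hg)]
  simp only [mul_add]

lemma Gop_smul {m : ℕ} (c : ℝ) (f : Fn N) (x : Euc N) :
    Gop m (fun y => c * f y) x = c * Gop m f x := by
  unfold Gop
  simp only [mul_left_comm _ c, integral_const_mul]

lemma mp_isom (R : Euc N ≃ₗᵢ[ℝ] Euc N) : MeasurePreserving R (mu N) (mu N) := by
  have := R.measurePreserving.restrict_preimage (s := ball (0 : Euc N) 1) measurableSet_ball
  have e : R ⁻¹' ball (0 : Euc N) 1 = ball 0 1 := by ext; simp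
  rw [e] at this
  exact this

lemma Gop_isom {m : ℕ} (R : Euc N ≃ₗᵢ[ℝ] Euc N) (f : Fn N) (x : Euc N) :
    Gop m f (R x) = Gop m (fun y => f (R y)) x := by
  unfold Gop
  rw [← (mp_isom R).integral_comp R.toHomeomorph.measurableEmbedding]
  simp only [gk_isom]

lemma Gop_symm {m : ℕ} (hN : N = 2 * m + 2) {f g : Fn N} (hf : Continuous f) (hg : Continuous g) :
    ∫ x, g x * Gop m f x ∂(mu N) = ∫ x, f x * Gop m g x ∂(mu N) := by
  obtain ⟨M, hM0, hM⟩ := bdd_of_cont hf 1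
  obtain ⟨M', hM0', hM'⟩ := bdd_of_cont hg 1
  have hI : Integrable (Function.uncurry fun x y => gk m x y * (f y * g x)) ((mu N).prod (mu N)) := by
    have hgk : Integrable (fun q : Euc N × Euc N => gk m q.1 q.2) ((mu N).prod (mu N)) := by
      rw [integrable_prod_iff (meas_gk m).aestronglyMeasurable]
      refine ⟨ae_of_all _ fun x => int_gk hN x, ?_⟩
      refine Integrable.of_bound (C := ∫ z in ball (0 : Euc N) 2, rad m z) ?_ (ae_mu fun x hx => ?_)
      · exact (meas_gk m).norm.stronglyMeasurable.integral_prod_right.aestronglyMeasurable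
      · rw [norm_of_nonneg (integral_nonneg fun y => norm_nonneg _)]
        calc _ ≤ ∫ y, rad m (x - y) ∂(mu N) := by
              refine integral_mono (int_gk hN x).norm (int_rad hN x) fun y => ?_
              simp only [norm_of_nonneg (gk_nonneg _ _ _)]
              exact gk_le_rad _ _ _
          _ ≤ _ := setint_comp_sub_le (rad_nonneg m) (by linarith) (int_rad_ball hN _)
    refine hgk.mul_bdd (c := M * M') ?_ ?_
    · exact ((hf.comp continuous_snd).mul (hg.comp continuous_fst)).aestronglyMeasurable
    · have h1 : ∀ᵐ q ∂((mu N).prod (mu N)), ‖q.1‖ < 1 :=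
        Measure.quasiMeasurePreserving_fst.ae (ae_mu fun x hx => hx)
      have h2 : ∀ᵐ q ∂((mu N).prod (mu N)), ‖q.2‖ < 1 :=
        Measure.quasiMeasurePreserving_snd.ae (ae_mu fun x hx => hx)
      filter_upwards [h1, h2] with q q1 q2
      rw [norm_mul]
      exact mul_le_mul (hM _ (by simpa using q2.le)) (hM' _ (by simpa using q1.le)) (norm_nonneg _) hM0
  unfold Gop
  simp only [mul_left_comm _ (kap N m)⁻¹, integral_const_mul]
  congr 1
  have := integral_integral_swap hI
  calc _ = ∫ x, ∫ y, gk m x y * (f y * g x) ∂(mu N) ∂(mu N) := by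
        simp only [← integral_const_mul]; congr; ext x; congr; ext y; ring
    _ = _ := this
    _ = _ := by
        simp only [← integral_const_mul]; congr; ext x; congr; ext y; rw [gk_symm]; ring

end Henon

namespace Henon
open Topology Metric
variable {N : ℕ}

def Gm (m : ℕ) (e : ℝ) (z : Euc N) : ℝ := ((‖z‖ ^ 2 + e) ^ m)⁻¹
def DGm (m : ℕ) (e : ℝ) (z : Euc N) : Euc N →L[ℝ] ℝ :=
  (-(2 * m : ℝ) * ((‖z‖ ^ 2 + e) ^ (m + 1))⁻¹) • innerSL ℝ z

lemma Gm_zero (m : ℕ) (z : Euc N) : Gm m 0 z = rad m z := by simp [Gm, rad]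

lemma hasFDerivAt_Gm (m : ℕ) {e : ℝ} {z : Euc N} (h : 0 < ‖z‖ ^ 2 + e) :
    HasFDerivAt (Gm m e) (DGm m e z) z := by
  have h1 : HasFDerivAt (fun z : Euc N => ‖z‖ ^ 2) (2 • innerSL ℝ z) z :=
    (hasStrictFDerivAt_norm_sq z).hasFDerivAt
  have h2 : HasDerivAt (fun t : ℝ => ((t + e) ^ m)⁻¹) (-(m * (‖z‖ ^ 2 + e) ^ (m - 1) * 1) / ((‖z‖ ^ 2 + e) ^ m) ^ 2)
      (‖z‖ ^ 2) := (((hasDerivAt_id _).add_const e).fun_pow m).fun_inv (by simp; intro h'; linarith)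
  have h3 := h2.comp_hasFDerivAt z h1
  refine h3.congr_fderiv ?_
  ext v
  simp only [DGm, smul_apply, smul_eq_mul, nsmul_eq_mul, Nat.cast_ofNat]
  rcases m with _ | k
  · simp
  · have := h.ne'
    field_simp
    simp only [Nat.add_sub_cancel]
    ring

lemma norm_DGm_le (m : ℕ) {e : ℝ} (he : 0 ≤ e) (z : Euc N) :
    ‖DGm m e z‖ ≤ 2 * m * ‖z‖ ^ (-(2 * m + 1 : ℝ)) := by
  rcases eq_or_ne z 0 with rfl | hz
  · simp [DGm]; positivity
  have h0 : 0 < ‖z‖ := norm_pos_iff.2 hz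
  rw [DGm, norm_smul, innerSL_apply_norm, norm_mul, norm_neg, norm_of_nonneg (by positivity),
    norm_of_nonneg (by positivity), mul_assoc]
  gcongr
  have : ‖z‖ ^ (-(2 * m + 1 : ℝ)) = ((‖z‖ ^ 2) ^ (m + 1))⁻¹ * ‖z‖ := by
    rw [rpow_neg h0.le, ← pow_mul, show (2 * m + 1 : ℝ) = ((2 * m + 1 : ℕ) : ℝ) by push_cast; ring, rpow_natCast]
    field_simp
    ring
  rw [this]
  gcongr
  linarith

lemma norm_DGm_le' (m : ℕ) {e : ℝ} (he : 0 < e) (z : Euc N) :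
    ‖DGm m e z‖ ≤ 2 * m * (e ^ (m + 1))⁻¹ * ‖z‖ := by
  rw [DGm, norm_smul, innerSL_apply_norm, norm_mul, norm_neg, norm_of_nonneg (by positivity),
    norm_of_nonneg (by positivity)]
  gcongr
  nlinarith [sq_nonneg ‖z‖]

lemma cont_Gm (m : ℕ) {e : ℝ} (he : 0 < e) : Continuous (Gm m e : Fn N) := by
  unfold Gm
  exact Continuous.inv₀ (by fun_prop) (fun z => by positivity)

lemma cont_DGm (m : ℕ) {e : ℝ} (he : 0 < e) : Continuous (DGm m e : Euc N → _) := by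
  unfold DGm
  have h : Continuous (fun z : Euc N => ((‖z‖ ^ 2 + e) ^ (m + 1))⁻¹) :=
    Continuous.inv₀ (by fun_prop) (fun z => by positivity)
  exact (continuous_const.mul h).smul (innerSL ℝ).continuous

lemma Gm_le_rad (m : ℕ) {e : ℝ} (he : 0 ≤ e) {z : Euc N} (hz : z ≠ 0) : Gm m e z ≤ rad m z := by
  have h0 : 0 < ‖z‖ := norm_pos_iff.2 hz
  unfold Gm rad
  gcongr; linarith

lemma Gm_nonneg (m : ℕ) {e : ℝ} (he : 0 ≤ e) (z : Euc N) : 0 ≤ Gm m e z := by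
  unfold Gm; positivity

lemma meas_DGm (m : ℕ) (e : ℝ) : Measurable (DGm m e : Euc N → _) := by
  unfold DGm
  have : Measurable (fun z : Euc N => innerSL ℝ z) := (innerSL ℝ).continuous.measurable
  have h2 : Measurable (fun z : Euc N => (-(2 * m : ℝ) * ((‖z‖ ^ 2 + e) ^ (m + 1))⁻¹)) := by fun_prop
  exact h2.smul this

/-- sequence `e_k → 0`. -/
def ek (k : ℕ) : ℝ := 1 / ((k : ℝ) + 1)
lemma ek_pos (k : ℕ) : 0 < ek k := by unfold ek; positivity
lemma ek_tendsto : Tendsto ek atTop (𝓝 0) := tendsto_one_div_add_atTop_nhds_zero_nat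

lemma Gm_tendsto (m : ℕ) {z : Euc N} (hz : z ≠ 0) : Tendsto (fun k => Gm m (ek k) z) atTop (𝓝 (rad m z)) := by
  have h0 : 0 < ‖z‖ := norm_pos_iff.2 hz
  have : Tendsto (fun e : ℝ => Gm m e z) (𝓝 0) (𝓝 (Gm m 0 z)) := by
    unfold Gm
    exact ContinuousAt.inv₀ (by fun_prop) (by simp; exact fun h => absurd h hz)
  rw [Gm_zero] at this
  exact this.comp ek_tendsto

lemma DGm_tendsto (m : ℕ) {z : Euc N} (hz : z ≠ 0) :
    Tendsto (fun k => DGm m (ek k) z) atTop (𝓝 (DGm m 0 z)) := by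
  have h0 : 0 < ‖z‖ := norm_pos_iff.2 hz
  have : Tendsto (fun e : ℝ => DGm m e z) (𝓝 0) (𝓝 (DGm m 0 z)) := by
    unfold DGm
    have h : ContinuousAt (fun e : ℝ => ((‖z‖ ^ 2 + e) ^ (m + 1))⁻¹) 0 :=
      ContinuousAt.inv₀ (by fun_prop) (by simp; exact fun h => absurd h hz)
    exact ContinuousAt.smul (continuousAt_const.mul h) continuousAt_const
  exact this.comp ek_tendsto

lemma int_pow1_ball {m : ℕ} (hN : N = 2 * m + 2) (R : ℝ) :
    IntegrableOn (fun z : Euc N => 2 * m * ‖z‖ ^ (-(2 * m + 1 : ℝ))) (ball 0 R) volume :=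
  (int_rpow_ball (N := N) (by omega) (by subst hN; push_cast; linarith) R).const_mul _

lemma ae_ne_vol {m : ℕ} (hN : N = 2 * m + 2) (x : Euc N) : ∀ᵐ y ∂(volume : Measure (Euc N)), y ≠ x := by
  have := nontriv (N := N) (by omega)
  simp [ae_iff, measure_singleton]

lemma DGm_L1 {m : ℕ} (hN : N = 2 * m + 2) (R : ℝ) :
    Tendsto (fun k => ∫ z in ball (0 : Euc N) R, ‖DGm m (ek k) z - DGm m 0 z‖) atTop (𝓝 0) := by
  have h0 : (∫ _ in ball (0 : Euc N) R, (0 : ℝ)) = 0 := integral_zero _ _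
  conv => arg 3; rw [← h0]
  refine tendsto_integral_of_dominated_convergence (fun z => 2 * m * ‖z‖ ^ (-(2 * m + 1 : ℝ)) + 2 * m * ‖z‖ ^ (-(2 * m + 1 : ℝ)))
    (fun k => ((meas_DGm m _).sub (meas_DGm m _)).norm.aestronglyMeasurable)
    ((int_pow1_ball hN R).add (int_pow1_ball hN R)) (fun k => ae_of_all _ fun z => ?_) ?_
  · rw [norm_norm]
    exact (norm_sub_le _ _).trans (add_le_add (norm_DGm_le m (ek_pos k).le z) (norm_DGm_le m le_rfl z))
  · filter_upwards [ae_restrict_of_ae (ae_ne_vol hN 0)] with z hz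
    simpa using ((DGm_tendsto m hz).sub_const (DGm m 0 z)).norm

/-- Newtonian potential of `f` on the ball. -/
def Np (m : ℕ) (f : Fn N) (x : Euc N) : ℝ := ∫ y, rad m (x - y) * f y ∂(mu N)
def DNp (m : ℕ) (e : ℝ) (f : Fn N) (x : Euc N) : Euc N →L[ℝ] ℝ := ∫ y, f y • DGm m e (x - y) ∂(mu N)

lemma int_DGm {m : ℕ} (hN : N = 2 * m + 2) {e : ℝ} (he : 0 ≤ e) (x : Euc N) :
    Integrable (fun y => DGm m e (x - y)) (mu N) := by
  refine Integrable.mono' (int_comp_sub_ball (int_pow1_ball hN (‖x‖ + 1))) ?_ (ae_of_all _ fun y => norm_DGm_le m he _)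
  exact ((meas_DGm m e).comp (measurable_const.sub measurable_id)).aestronglyMeasurable

lemma int_smul_bdd {W : Type*} [NormedAddCommGroup W] [NormedSpace ℝ W] {g : Euc N → W} (hg : Integrable g (mu N))
    {f : Fn N} (hf : Continuous f) : Integrable (fun y => f y • g y) (mu N) := by
  obtain ⟨M, -, hM⟩ := bdd_of_cont hf 1
  exact hg.bdd_smul M hf.aestronglyMeasurable (ae_mu fun y hy => hM y (by simpa using hy.le))

lemma hasFDerivAt_Gmconv {m : ℕ} {e : ℝ} (he : 0 < e) {f : Fn N} (hf : Continuous f) (x : Euc N) :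
    HasFDerivAt (fun x => ∫ y, Gm m e (x - y) * f y ∂(mu N)) (DNp m e f x) x := by
  obtain ⟨M, hM0, hM⟩ := bdd_of_cont hf 1
  have hc := (cont_Gm (N := N) m he)
  have hc' := (cont_DGm (N := N) m he)
  refine hasFDerivAt_integral_of_dominated_of_fderiv_le (s := ball x 1) (ball_mem_nhds x one_pos)
    (bound := fun _ => M * (2 * m * (e ^ (m + 1))⁻¹ * (‖x‖ + 2)))
    (F' := fun x y => f y • DGm m e (x - y)) (μ := mu N)
    (Eventually.of_forall fun x' => ?_) ?_ ?_ ?_ (integrable_const _) ?_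
  · exact Continuous.aestronglyMeasurable (by fun_prop)
  · exact int_cont (f := fun y => Gm m e (x - y) * f y) (by fun_prop)
  · exact Continuous.aestronglyMeasurable (by fun_prop)
  · refine ae_mu fun y hy x' hx' => ?_
    rw [norm_smul]
    refine mul_le_mul (hM y (by simpa using hy.le)) ((norm_DGm_le' m he _).trans ?_) (norm_nonneg _) hM0
    gcongr
    have h1 : ‖x' - x‖ < 1 := by simpa [dist_eq_norm] using hx'
    have h2 : x' - y = (x' - x) + x - y := by abel
    rw [h2]
    linarith [norm_sub_le ((x' - x) + x) y, norm_add_le (x' - x) x]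
  · refine ae_of_all _ fun y x' _ => ?_
    have h := (hasFDerivAt_Gm m (e := e) (z := x' - y) (by positivity)).comp x' ((hasFDerivAt_id x').sub_const y)
    exact (h.mul_const (f y)).congr_fderiv (by ext v; simp)

lemma DNp_tendsto {m : ℕ} (hN : N = 2 * m + 2) {f : Fn N} (hf : Continuous f) (R : ℝ) :
    TendstoUniformlyOn (fun k => DNp m (ek k) f) (DNp m 0 f) atTop (ball (0 : Euc N) R) := by
  obtain ⟨M, hM0, hM⟩ := bdd_of_cont hf 1
  rw [Metric.tendstoUniformlyOn_iff]
  intro ε hε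
  filter_upwards [(DGm_L1 hN (R + 1)).eventually (gt_mem_nhds (show 0 < ε / (M + 1) by positivity))] with k hk x hx
  have hx' : ‖x‖ + 1 ≤ R + 1 := by simp at hx; linarith
  rw [dist_comm, dist_eq_norm]
  have i1 := int_smul_bdd (int_DGm hN (ek_pos k).le x) hf
  have i2 := int_smul_bdd (int_DGm hN le_rfl x) hf
  have i3 : Integrable (fun y => ‖DGm m (ek k) (x - y) - DGm m 0 (x - y)‖) (mu N) :=
    ((int_DGm hN (ek_pos k).le x).sub (int_DGm hN le_rfl x)).norm
  unfold DNp
  rw [← integral_sub i1 i2]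
  calc _ ≤ ∫ y, ‖f y • DGm m (ek k) (x - y) - f y • DGm m 0 (x - y)‖ ∂(mu N) := norm_integral_le_integral_norm _
    _ ≤ ∫ y, (M + 1) * ‖DGm m (ek k) (x - y) - DGm m 0 (x - y)‖ ∂(mu N) := by
        refine integral_mono_ae (i1.sub i2).norm (i3.const_mul _) (ae_mu fun y hy => ?_)
        simp only
        rw [show f y • DGm m (ek k) (x - y) - f y • DGm m 0 (x - y) = f y • (DGm m (ek k) (x - y) - DGm m 0 (x - y)) from
          (smul_sub (f y) _ _).symm, norm_smul]
        gcongr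
        linarith [hM y (by simpa using hy.le)]
    _ = (M + 1) * ∫ y, ‖DGm m (ek k) (x - y) - DGm m 0 (x - y)‖ ∂(mu N) := integral_const_mul _ _
    _ ≤ (M + 1) * ∫ z in ball (0 : Euc N) (R + 1), ‖DGm m (ek k) z - DGm m 0 z‖ := by
        refine mul_le_mul_of_nonneg_left ?_ (by positivity)
        refine setint_comp_sub_le (f := fun z => ‖DGm m (ek k) z - DGm m 0 z‖) (fun z => norm_nonneg _) hx' ?_
        refine Integrable.mono' ((int_pow1_ball hN _).add (int_pow1_ball hN _))
          ((meas_DGm m _).sub (meas_DGm m _)).norm.aestronglyMeasurable (ae_of_all _ fun z => ?_)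
        rw [norm_norm]
        exact (norm_sub_le _ _).trans (add_le_add (norm_DGm_le m (ek_pos k).le z) (norm_DGm_le m le_rfl z))
    _ < (M + 1) * (ε / (M + 1)) := by gcongr
    _ = ε := by field_simp

lemma hasFDerivAt_Np {m : ℕ} (hN : N = 2 * m + 2) {f : Fn N} (hf : Continuous f) (x : Euc N) :
    HasFDerivAt (Np m f) (DNp m 0 f x) x := by
  refine hasFDerivAt_of_tendstoUniformlyOn (isOpen_ball (x := (0 : Euc N)) (ε := ‖x‖ + 1)) (DNp_tendsto hN hf _)
    (fun k x' _ => hasFDerivAt_Gmconv (ek_pos k) hf x') (fun x' _ => ?_) (by simp)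
  have hb := int_smul_bdd (int_rad hN x') hf
  refine tendsto_integral_of_dominated_convergence (fun y => ‖f y • rad m (x' - y)‖) (fun k => ?_) hb.norm
    (fun k => ?_) ?_
  · have := (cont_Gm (N := N) m (ek_pos k)); exact Continuous.aestronglyMeasurable (by fun_prop)
  · filter_upwards [ae_ne hN x'] with y hy
    rw [norm_smul, norm_mul, mul_comm, norm_of_nonneg (Gm_nonneg m (ek_pos k).le _), norm_of_nonneg (rad_nonneg _ _)]
    gcongr
    exact Gm_le_rad m (ek_pos k).le (sub_ne_zero.2 hy)
  · filter_upwards [ae_ne hN x'] with y hy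
    exact (Gm_tendsto m (sub_ne_zero.2 hy)).mul_const _

lemma cont_DNp {m : ℕ} (hN : N = 2 * m + 2) {f : Fn N} (hf : Continuous f) : Continuous (DNp m 0 f) := by
  rw [continuous_iff_continuousAt]
  intro x
  refine ((DNp_tendsto hN hf (‖x‖ + 1)).continuousOn (Frequently.of_forall fun k => ?_)).continuousAt
    (isOpen_ball.mem_nhds (by simp))
  obtain ⟨M, hM0, hM⟩ := bdd_of_cont hf 1
  have hc' := (cont_DGm (N := N) m (ek_pos k))
  refine continuousOn_of_dominated (bound := fun _ => M * (2 * m * ((ek k) ^ (m + 1))⁻¹ * (‖x‖ + 2)))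
    (fun x' _ => Continuous.aestronglyMeasurable (by fun_prop)) (fun x' hx' => ae_mu fun y hy => ?_) (integrable_const _)
    (ae_of_all _ fun y => Continuous.continuousOn (by fun_prop))
  rw [norm_smul]
  have := ek_pos k
  refine mul_le_mul (hM y (by simpa using hy.le)) ((norm_DGm_le' m this _).trans ?_) (norm_nonneg _) hM0
  gcongr
  have h1 : ‖x'‖ < ‖x‖ + 1 := by simpa using hx'
  linarith [norm_sub_le x' y]

lemma contDiff_Np {m : ℕ} (hN : N = 2 * m + 2) {f : Fn N} (hf : Continuous f) : ContDiff ℝ 1 (Np m f) := by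
  rw [contDiff_one_iff_fderiv]
  refine ⟨fun x => (hasFDerivAt_Np hN hf x).differentiableAt, ?_⟩
  have : fderiv ℝ (Np m f) = DNp m 0 f := by ext1 x; exact (hasFDerivAt_Np hN hf x).fderiv
  rw [this]; exact cont_DNp hN hf

end Henon

namespace Henon
open Topology Metric
variable {N : ℕ}

abbrev ei (i : Fin N) : Euc N := EuclideanSpace.single i 1
def pd (i : Fin N) (u : Fn N) (x : Euc N) : ℝ := fderiv ℝ u x (ei i)

lemma pd_pd {u : Fn N} {x : Euc N} (h : ContDiffAt ℝ 2 u x) (i j : Fin N) :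
    pd i (pd j u) x = iteratedFDeriv ℝ 2 u x ![ei i, ei j] := by
  have h1 : DifferentiableAt ℝ (fderiv ℝ u) x :=
    (h.fderiv_right (m := 1) (by norm_num)).differentiableAt (by norm_num)
  rw [iteratedFDeriv_two_apply]
  unfold pd
  have := (h1.hasFDerivAt.clm_apply (hasFDerivAt_const (ei j) x)).fderiv
  rw [this]; simp

lemma lap_eq {u : Fn N} {x : Euc N} (h : ContDiffAt ℝ 2 u x) : lap u x = ∑ i, pd i (pd i u) x := by
  unfold lap
  exact Finset.sum_congr rfl fun i _ => (pd_pd h i i).symm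

lemma contDiffAt_pd {u : Fn N} {x : Euc N} {n k : WithTop ℕ∞} (h : ContDiffAt ℝ n u x) (hk : k + 1 ≤ n) (i : Fin N) :
    ContDiffAt ℝ k (pd i u) x :=
  (h.fderiv_right hk).clm_apply contDiffAt_const

lemma lap_congr {u v : Fn N} {x : Euc N} (h : u =ᶠ[𝓝 x] v) : lap u x = lap v x := by
  unfold lap; rw [(h.iteratedFDeriv ℝ 2).eq_of_nhds]

lemma cont_lap {u : Fn N} {x : Euc N} (h : ContDiffAt ℝ 2 u x) : ContinuousAt (lap u) x := by
  unfold lap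
  have h1 := (h.continuousAt_iteratedFDeriv (k := 2) le_rfl)
  refine tendsto_finsetSum _ fun i _ => ?_
  exact ((ContinuousMultilinearMap.apply ℝ (fun _ : Fin 2 => Euc N) ℝ ![ei i, ei i]).continuous.continuousAt).comp h1

lemma cont_lap' {u : Fn N} (h : ContDiff ℝ 2 u) : Continuous (lap u) :=
  continuous_iff_continuousAt.2 fun _ => cont_lap h.contDiffAt

lemma tsupport_pd (i : Fin N) (u : Fn N) : tsupport (pd i u) ⊆ tsupport u := by
  refine closure_minimal ?_ (isClosed_tsupport u)
  intro x hx
  by_contra h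
  apply hx
  have : fderiv ℝ u x = 0 := by
    have := notMem_tsupport_iff_eventuallyEq.1 h
    rw [this.fderiv_eq]; simp
  simp [pd, this]

lemma hcs_pd {u : Fn N} (h : HasCompactSupport u) (i : Fin N) : HasCompactSupport (pd i u) :=
  h.of_isClosed_subset (isClosed_tsupport _) (tsupport_pd i u)

lemma lap_zero_of {u : Fn N} {x : Euc N} (h : x ∉ tsupport u) : lap u x = 0 := by
  have := notMem_tsupport_iff_eventuallyEq.1 h
  rw [lap_congr this, lap_eq (u := 0) (contDiffAt_const (c := (0 : ℝ)))]
  have h0 : ∀ i, pd i (0 : Fn N) = 0 := fun i => by ext y; simp [pd]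
  simp [h0]

lemma tsupport_lap (u : Fn N) : tsupport (lap u) ⊆ tsupport u :=
  closure_minimal (fun _ hx => by_contra fun h => hx (lap_zero_of h)) (isClosed_tsupport u)

lemma hcs_lap {u : Fn N} (h : HasCompactSupport u) : HasCompactSupport (lap u) :=
  h.of_isClosed_subset (isClosed_tsupport _) (tsupport_lap u)

lemma cont_prod {u g : Fn N} (hu : ∀ x ∈ tsupport g, ContinuousAt u x) (hg : ∀ x ∈ tsupport g, ContinuousAt g x) :
    Continuous (fun x => u x * g x) := by
  refine continuous_of_tsupport fun x hx => ?_
  have : x ∈ tsupport g := (tsupport_mul_subset_right (f := u) (g := g)) hx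
  exact (hu x this).mul (hg x this)

lemma int_prod {u g : Fn N} (hc : HasCompactSupport g) (hu : ∀ x ∈ tsupport g, ContinuousAt u x)
    (hg : ∀ x ∈ tsupport g, ContinuousAt g x) : Integrable (fun x => u x * g x) volume :=
  (cont_prod hu hg).integrable_of_hasCompactSupport (hc.mul_left (f := u))

lemma ibp {u g : Fn N} (i : Fin N) (hc : HasCompactSupport g) (hg : ContDiff ℝ 1 g)
    (hu : ∀ x ∈ tsupport g, ContDiffAt ℝ 1 u x) :
    ∫ x, u x * pd i g x = - ∫ x, pd i u x * g x := by
  refine integral_mul_fderiv_eq_neg_fderiv_mul_of_integrable ?_ ?_ ?_ (fun x hx => (hu x hx).differentiableAt (by norm_num))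
    (fun x _ => hg.differentiable (by norm_num) x)
  · exact int_prod (u := pd i u) hc (fun x hx => (contDiffAt_pd (k := 0) (hu x hx) (by norm_num) i).continuousAt) (fun x _ => hg.continuous.continuousAt)
  · exact int_prod (g := pd i g) (hcs_pd hc i) (fun x hx => (hu x (tsupport_pd i g hx)).continuousAt)
      (fun x _ => (contDiffAt_pd (k := 0) hg.contDiffAt (by norm_num) i).continuousAt)
  · exact int_prod hc (fun x hx => (hu x hx).continuousAt) (fun x _ => hg.continuous.continuousAt)

lemma green {w φ : Fn N} (hc : HasCompactSupport φ) (hφ : ContDiff ℝ 2 φ)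
    (hw : ∀ x ∈ tsupport φ, ContDiffAt ℝ 2 w x) :
    ∫ x, w x * lap φ x = ∫ x, lap w x * φ x := by
  have hpd : ∀ i, ContDiff ℝ 1 (pd i φ) := fun i => contDiff_iff_contDiffAt.2 fun x =>
    contDiffAt_pd hφ.contDiffAt (by norm_num) i
  have hpw : ∀ i, ∀ x ∈ tsupport φ, ContDiffAt ℝ 1 (pd i w) x := fun i x hx => contDiffAt_pd (hw x hx) (by norm_num) i
  have e1 : ∀ i, ∫ x, w x * pd i (pd i φ) x = ∫ x, pd i (pd i w) x * φ x := by
    intro i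
    rw [ibp i (hcs_pd hc i) (hpd i) (fun x hx => (hw x (tsupport_pd i _ hx)).of_le (by norm_num)),
      ibp i hc (hφ.of_le (by norm_num)) (hpw i), neg_neg]
  calc ∫ x, w x * lap φ x = ∫ x, ∑ i, w x * pd i (pd i φ) x := by
        congr; ext x; rw [lap_eq hφ.contDiffAt, Finset.mul_sum]
    _ = ∑ i, ∫ x, w x * pd i (pd i φ) x := by
        refine integral_finsetSum _ fun i _ => ?_
        exact int_prod (g := pd i (pd i φ)) (hcs_pd (hcs_pd hc i) i)
          (fun x hx => (hw x (tsupport_pd i _ (tsupport_pd i _ hx))).continuousAt)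
          (fun x _ => (contDiffAt_pd (k := 0) (hpd i).contDiffAt (by norm_num) i).continuousAt)
    _ = ∑ i, ∫ x, pd i (pd i w) x * φ x := Finset.sum_congr rfl fun i _ => e1 i
    _ = ∫ x, ∑ i, pd i (pd i w) x * φ x := by
        refine (integral_finsetSum _ fun i _ => ?_).symm
        exact int_prod (u := pd i (pd i w)) hc
          (fun x hx => (contDiffAt_pd (k := 0) (hpw i x hx) (by norm_num) i).continuousAt)
          (fun x _ => hφ.continuous.continuousAt)
    _ = _ := by
        congr; ext x
        by_cases hx : x ∈ tsupport φ
        · rw [lap_eq (hw x hx), Finset.sum_mul]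
        · simp [image_eq_zero_of_notMem_tsupport hx]

lemma contDiff_Gm (m : ℕ) {e : ℝ} (he : 0 < e) {n : WithTop ℕ∞} : ContDiff ℝ n (Gm m e : Fn N) := by
  unfold Gm
  refine ContDiff.inv (((contDiff_norm_sq ℝ).add contDiff_const).pow m) (fun z => by positivity)

lemma contDiffAt_rad (m : ℕ) {z : Euc N} (hz : z ≠ 0) {n : WithTop ℕ∞} : ContDiffAt ℝ n (rad m) z := by
  unfold rad
  exact ContDiffAt.inv ((contDiff_norm_sq ℝ).contDiffAt.pow m) (by simp [hz])

lemma fderiv_Gm_sub (m : ℕ) {e : ℝ} (he : 0 < e) (x y : Euc N) :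
    HasFDerivAt (fun y => Gm m e (x - y)) (-(DGm m e (x - y))) y := by
  have h := (hasFDerivAt_Gm m (e := e) (z := x - y) (by positivity)).comp y ((hasFDerivAt_id y).const_sub x)
  exact h.congr_fderiv (by ext v; simp)

lemma DGm_ei (m : ℕ) (e : ℝ) (z : Euc N) (i : Fin N) : DGm m e z (ei i) = -(2 * m) * Gm (m + 1) e z * z i := by
  have : inner ℝ z (ei i) = z i := by simp [ei, EuclideanSpace.inner_single_right]
  simp only [DGm, Gm, smul_apply, innerSL_apply_apply, this, smul_eq_mul]

lemma lap_Gm {m : ℕ} (hN : N = 2 * m + 2) {e : ℝ} (he : 0 < e) (x y : Euc N) :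
    lap (fun y => Gm m e (x - y)) y = -(2 * m * N * e * Gm (m + 2) e (x - y)) := by
  rw [lap_eq (u := fun y => Gm m e (x - y)) ((contDiff_Gm m he).comp (contDiff_const.sub contDiff_id)).contDiffAt]
  have h1 : ∀ i, pd i (fun y => Gm m e (x - y)) = fun y => 2 * m * (Gm (m + 1) e (x - y) * (x i - y i)) := by
    intro i; ext y
    rw [pd, (fderiv_Gm_sub m he x y).fderiv]
    simp only [neg_apply, DGm_ei, PiLp.sub_apply]; ring
  have h2 : ∀ i, pd i (pd i (fun y => Gm m e (x - y))) y = 2 * m * (2 * (m + 1) * Gm (m + 2) e (x - y) * (x i - y i) ^ 2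
      - Gm (m + 1) e (x - y)) := by
    intro i
    rw [h1, pd]
    have hp : HasFDerivAt (fun y : Euc N => x i - y i) (-(EuclideanSpace.proj i : Euc N →L[ℝ] ℝ)) y :=
      ((EuclideanSpace.proj i : Euc N →L[ℝ] ℝ).hasFDerivAt).const_sub (x i)
    rw [(((fderiv_Gm_sub (m + 1) he x y).fun_mul hp).const_mul (2 * m : ℝ)).fderiv]
    simp [DGm_ei]
    ring
  simp only [h2]
  rw [← Finset.mul_sum, Finset.sum_sub_distrib, ← Finset.mul_sum]
  have h3 : ∑ i, (x i - y i) ^ 2 = ‖x - y‖ ^ 2 := by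
    rw [EuclideanSpace.real_norm_sq_eq]; simp
  rw [h3]
  have h4 : Gm (m + 1) e (x - y) = (‖x - y‖ ^ 2 + e) * Gm (m + 2) e (x - y) := by
    unfold Gm
    have : ‖x - y‖ ^ 2 + e ≠ 0 := by positivity
    field_simp
    ring
  simp only [Finset.sum_const, Finset.card_univ, Fintype.card_fin, nsmul_eq_mul]
  rw [h4]
  have hNr : (N : ℝ) = 2 * m + 2 := by rw [hN]; push_cast; ring
  rw [hNr]; ring

end Henon

namespace Henon
open Topology Metric
variable {N : ℕ}

lemma hcs_ball {u : Fn N} (h : HasCompactSupport u) : ∃ R : ℝ, 0 < R ∧ ∀ x, x ∉ ball (0 : Euc N) R → u x = 0 := by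
  obtain ⟨R, hR⟩ := h.isCompact.isBounded.subset_ball (0 : Euc N)
  refine ⟨max R 1, by positivity, fun x hx => ?_⟩
  refine image_eq_zero_of_notMem_tsupport fun h' => hx ?_
  exact ball_subset_ball (le_max_left _ _) (hR h')

lemma int_rad_mul {m : ℕ} (hN : N = 2 * m + 2) {g : Fn N} (hg : Continuous g) (hc : HasCompactSupport g) (x : Euc N) :
    Integrable (fun y => rad m (x - y) * g y) volume := by
  obtain ⟨R, hR, h0⟩ := hcs_ball hc
  obtain ⟨M, -, hM⟩ := bdd_of_cont hg R
  have h1 : IntegrableOn (fun y => rad m (x - y)) (ball 0 R) volume := int_comp_sub_ball (int_rad_ball hN _)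
  have h2 : IntegrableOn (fun y => rad m (x - y) * g y) (ball 0 R) volume := by
    refine h1.mul_bdd (c := M) hg.aestronglyMeasurable ?_
    filter_upwards [ae_restrict_mem measurableSet_ball] with y hy
    exact hM y (ball_subset_closedBall hy)
  refine (integrableOn_iff_integrable_of_support_subset ?_).1 h2
  intro y hy
  by_contra h
  exact hy (by simp [h0 y h])

lemma newton_eps {m : ℕ} (hN : N = 2 * m + 2) {φ : Fn N} (hφ : ContDiff ℝ 2 φ) (hc : HasCompactSupport φ)
    {e : ℝ} (he : 0 < e) (x : Euc N) :
    ∫ y, Gm m e (x - y) * lap φ y =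
      -∫ w : Euc N, (2 * m * N : ℝ) * ((1 + ‖w‖ ^ 2) ^ (m + 2))⁻¹ * φ (x - sqrt e • w) := by
  rw [green (w := fun y => Gm m e (x - y)) hc hφ (fun y _ => ((contDiff_Gm m he).comp (contDiff_const.sub contDiff_id)).contDiffAt)]
  simp only [lap_Gm hN he]
  rw [← integral_neg]
  have hs : 0 < sqrt e := sqrt_pos.2 he
  rw [← integral_sub_left_eq_self _ volume x]
  have := Measure.integral_comp_smul_of_nonneg (volume : Measure (Euc N))
    (fun z : Euc N => -(2 * m * N * e * Gm (m + 2) e (x - (x - z))) * φ (x - z)) (sqrt e) (hR := hs.le)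
  rw [finrank_euclideanSpace, Fintype.card_fin, smul_eq_mul, eq_inv_mul_iff_mul_eq₀ (by positivity)] at this
  rw [← this, ← integral_const_mul]
  congr; ext w
  simp only [sub_sub_cancel, Gm, norm_smul, norm_of_nonneg hs.le, mul_pow, sq_sqrt he.le]
  have e1 : sqrt e ^ N = e ^ (m + 1) := by
    rw [hN, show 2 * m + 2 = 2 * (m + 1) by ring, pow_mul, sq_sqrt he.le]
  rw [e1, show e * ‖w‖ ^ 2 + e = e * (1 + ‖w‖ ^ 2) by ring, mul_pow]
  have : 1 + ‖w‖ ^ 2 ≠ 0 := by positivity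
  field_simp
  try ring

lemma newton {m : ℕ} (hN : N = 2 * m + 2) {φ : Fn N} (hφ : ContDiff ℝ 2 φ) (hc : HasCompactSupport φ) (x : Euc N) :
    ∫ y, rad m (x - y) * lap φ y = -(kap N m * φ x) := by
  have hl := cont_lap' hφ
  have h1 : Tendsto (fun k => ∫ y, Gm m (ek k) (x - y) * lap φ y) atTop (𝓝 (∫ y, rad m (x - y) * lap φ y)) := by
    refine tendsto_integral_of_dominated_convergence (fun y => ‖rad m (x - y) * lap φ y‖) (fun k => ?_)
      (int_rad_mul hN hl (hcs_lap hc) x).norm (fun k => ?_) ?_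
    · have := cont_Gm (N := N) m (ek_pos k); exact Continuous.aestronglyMeasurable (by fun_prop)
    · filter_upwards [ae_ne_vol hN x] with y hy
      rw [norm_mul, norm_mul, norm_of_nonneg (Gm_nonneg m (ek_pos k).le _), norm_of_nonneg (rad_nonneg _ _)]
      gcongr
      exact Gm_le_rad m (ek_pos k).le (sub_ne_zero.2 hy.symm)
    · filter_upwards [ae_ne_vol hN x] with y hy
      exact (Gm_tendsto m (sub_ne_zero.2 hy.symm)).mul_const _
  simp only [newton_eps hN hφ hc (ek_pos _)] at h1
  obtain ⟨M, hM⟩ := hφ.continuous.bounded_above_of_compact_support hc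
  have h2 : Tendsto (fun k => ∫ w : Euc N, (2 * m * N : ℝ) * ((1 + ‖w‖ ^ 2) ^ (m + 2))⁻¹ * φ (x - sqrt (ek k) • w)) atTop
      (𝓝 (∫ w : Euc N, (2 * m * N : ℝ) * ((1 + ‖w‖ ^ 2) ^ (m + 2))⁻¹ * φ x)) := by
    refine tendsto_integral_of_dominated_convergence
      (fun w => (2 * m * N : ℝ) * ((1 + ‖w‖ ^ 2) ^ (m + 2))⁻¹ * M) (fun k => ?_)
      ((kap_int hN).mul_const M) (fun k => ae_of_all _ fun w => ?_) (ae_of_all _ fun w => ?_)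
    · have hφc := hφ.continuous
      exact Measurable.aestronglyMeasurable (by fun_prop)
    · rw [norm_mul, norm_of_nonneg (by positivity)]
      gcongr
      exact hM _
    · refine tendsto_const_nhds.mul ?_
      have : Tendsto (fun k => x - sqrt (ek k) • w) atTop (𝓝 (x - sqrt 0 • w)) :=
        tendsto_const_nhds.sub (((continuous_sqrt.tendsto 0).comp ek_tendsto).smul_const w)
      rw [sqrt_zero, zero_smul, sub_zero] at this
      exact (hφ.continuous.tendsto x).comp this
  rw [integral_mul_const] at h2
  exact tendsto_nhds_unique h1 h2.neg

end Henon

namespace Henon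
open Topology Metric
variable {N : ℕ}

lemma int_mu_eq (g : Fn N) : ∫ y, g y ∂(mu N) = ∫ y in ball (0 : Euc N) 1, g y := rfl

lemma int_mu_full {g : Fn N} (h : ∀ y, 1 ≤ ‖y‖ → g y = 0) : ∫ y, g y ∂(mu N) = ∫ y, g y := by
  rw [int_mu_eq]
  refine setIntegral_eq_integral_of_forall_compl_eq_zero fun y hy => h y ?_
  simpa using hy

/-- smooth parametric integral -/
lemma contDiffOn_param {n : ℕ∞} {S : Set (Euc N)} (hS : IsOpen S) {R : ℝ} (hR : 1 < R) {k : Euc N → Fn N}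
    (hk : ContDiffOn ℝ n (fun q : Euc N × Euc N => k q.1 q.2) (S ×ˢ ball (0 : Euc N) R)) {f : Fn N} (hf : Continuous f) :
    ContDiffOn ℝ n (fun x => ∫ y, k x y * f y ∂(mu N)) S := by
  let b : ContDiffBump (0 : Euc N) := ⟨1, (1 + R) / 2, one_pos, by linarith⟩
  let F : Fn N := (ball (0 : Euc N) 1).indicator f
  let g : Euc N → Fn N := fun x y => b (-y) * k x (-y)
  have hF : Integrable F volume := (integrable_indicator_iff measurableSet_ball).2 (int_cont hf)
  have hg0 : ∀ p, ∀ y, p ∈ S → y ∉ closedBall (0 : Euc N) ((1 + R) / 2) → g p y = 0 := by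
    intro p y _ hy
    have : b (-y) = 0 := b.zero_of_le_dist (by simp at hy ⊢; exact hy.le)
    simp [g, this]
  have hg : ContDiffOn ℝ n ↿g (S ×ˢ univ) := by
    rintro ⟨x, y⟩ ⟨hx, -⟩
    apply ContDiffAt.contDiffWithinAt
    by_cases hy : y ∈ ball (0 : Euc N) R
    · have h1 : ContDiffAt ℝ n (fun q : Euc N × Euc N => b (-q.2)) (x, y) := b.contDiffAt.comp (x, y) contDiffAt_snd.neg
      have hy' : -y ∈ ball (0 : Euc N) R := by simpa using hy
      have h2 : ContDiffAt ℝ n (fun q : Euc N × Euc N => k q.1 q.2) (x, -y) :=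
        hk.contDiffAt ((hS.prod isOpen_ball).mem_nhds ⟨hx, hy'⟩)
      have h3 : ContDiffAt ℝ n (fun q : Euc N × Euc N => k q.1 (-q.2)) (x, y) :=
        h2.comp (f := fun q : Euc N × Euc N => (q.1, -q.2)) (x, y) (contDiffAt_fst.prodMk contDiffAt_snd.neg)
      exact h1.mul h3
    · have : ↿g =ᶠ[𝓝 (x, y)] fun _ => 0 := by
        have : ∀ᶠ q : Euc N × Euc N in 𝓝 (x, y), (1 + R) / 2 < ‖q.2‖ :=
          (continuous_snd.norm).continuousAt.eventually (lt_mem_nhds (by simp at hy ⊢; linarith))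
        filter_upwards [this] with q hq
        have : b (-q.2) = 0 := b.zero_of_le_dist (by simp; exact hq.le)
        simp [Function.HasUncurry.uncurry, g, this]
      exact contDiffAt_const.congr_of_eventuallyEq this
  have hmain := contDiffOn_convolution_right_with_param (𝕜 := ℝ) (μ := (volume : Measure (Euc N))) (n := n)
    (ContinuousLinearMap.mul ℝ ℝ) hS (isCompact_closedBall _ _) hg0 hF.locallyIntegrable hg
  have h2 : ContDiffOn ℝ n (fun x : Euc N => (x, (0 : Euc N))) S := (contDiff_id.prodMk contDiff_const).contDiffOn
  refine (hmain.comp h2 (fun x hx => ⟨hx, mem_univ _⟩)).congr fun x hx => ?_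
  simp only [Function.comp, convolution_def, ContinuousLinearMap.mul_apply', zero_sub]
  rw [int_mu_eq, ← integral_indicator measurableSet_ball]
  congr; ext t
  simp only [F, g, neg_neg]
  by_cases ht : t ∈ ball (0 : Euc N) 1
  · have : b t = 1 := b.one_of_mem_closedBall (ball_subset_closedBall ht)
    simp only [indicator_of_mem ht, this]; ring
  · simp only [indicator_of_notMem ht]; ring

def Hp (m : ℕ) (f : Fn N) (x : Euc N) : ℝ := ∫ y, hk m x y * f y ∂(mu N)

lemma hk_eq (m : ℕ) {x y : Euc N} (hx : ‖x‖ < 1) (hy : ‖y‖ < 1) :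
    hk m x y = ((‖x‖ ^ 2 * ‖y‖ ^ 2 - 2 * inner ℝ x y + 1) ^ m)⁻¹ := by
  unfold hk
  rw [pos1_of_mem hx, pos1_of_mem hy, norm_sub_sq_real]; congr 2; ring

lemma Q_pos {x y : Euc N} (h : ‖x‖ * ‖y‖ < 1) : 0 < ‖x‖ ^ 2 * ‖y‖ ^ 2 - 2 * inner ℝ x y + 1 := by
  nlinarith [real_inner_le_norm x y]

lemma contDiffOn_Hp {m : ℕ} {n : ℕ∞} {f : Fn N} (hf : Continuous f) : ContDiffOn ℝ n (Hp m f) (ball 0 1) := by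
  intro x0 hx0
  have hx0' : ‖x0‖ < 1 := by simpa using hx0
  obtain ⟨ρ, h1, h2⟩ := exists_between hx0'
  have hρ : 0 < ρ := (norm_nonneg _).trans_lt h1
  have := contDiffOn_param (n := n) (S := ball (0 : Euc N) ρ) isOpen_ball (R := ρ⁻¹) ((one_lt_inv₀ hρ).2 h2)
    (k := fun x y => ((‖x‖ ^ 2 * ‖y‖ ^ 2 - 2 * inner ℝ x y + 1) ^ m)⁻¹) ?_ hf
  · apply ContDiffAt.contDiffWithinAt
    refine (this.contDiffAt (isOpen_ball.mem_nhds (by simpa using h1))).congr_of_eventuallyEq ?_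
    filter_upwards [isOpen_ball.mem_nhds hx0] with x hx
    refine integral_congr_ae (ae_mu fun y hy => ?_)
    simp only
    rw [hk_eq m (by simpa using hx) hy]
  · rintro ⟨x, y⟩ ⟨hx, hy⟩
    apply ContDiffAt.contDiffWithinAt
    have hxy : ‖x‖ * ‖y‖ < 1 := by
      simp at hx hy
      calc ‖x‖ * ‖y‖ ≤ ρ * ‖y‖ := by gcongr
        _ < ρ * ρ⁻¹ := by gcongr
        _ = 1 := by field_simp
    refine ContDiffAt.inv (ContDiffAt.pow ?_ m) (pow_pos (Q_pos hxy) m).ne'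
    have a1 : ContDiff ℝ n (fun q : Euc N × Euc N => ‖q.1‖ ^ 2) := contDiff_fst.norm_sq ℝ
    have a2 : ContDiff ℝ n (fun q : Euc N × Euc N => ‖q.2‖ ^ 2) := contDiff_snd.norm_sq ℝ
    have a3 : ContDiff ℝ n (fun q : Euc N × Euc N => inner ℝ q.1 q.2) := contDiff_fst.inner ℝ contDiff_snd
    exact (((a1.mul a2).sub (contDiff_const.mul a3)).add contDiff_const).contDiffAt

lemma int_hk_mul {m : ℕ} (hN : N = 2 * m + 2) (x : Euc N) {f : Fn N} (hf : Continuous f) :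
    Integrable (fun y => hk m x y * f y) (mu N) := by
  have h1 := int_smul_bdd (int_rad hN x) hf
  refine (h1.sub (int_gk_mul (m := m) hN x hf)).congr ?_
  filter_upwards [ae_ne hN x] with y hy
  simp only [Pi.sub_apply, gk_eq m hy, smul_eq_mul]; ring

lemma Gop_eq {m : ℕ} (hN : N = 2 * m + 2) (x : Euc N) {f : Fn N} (hf : Continuous f) :
    Gop m f x = (kap N m)⁻¹ * (Np m f x - Hp m f x) := by
  unfold Gop Np Hp
  have h1 : Integrable (fun y => rad m (x - y) * f y) (mu N) :=
    (int_smul_bdd (int_rad hN x) hf).congr (ae_of_all _ fun y => mul_comm _ _)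
  rw [← integral_sub h1 (int_hk_mul hN x hf)]
  congr 1
  refine integral_congr_ae ?_
  filter_upwards [ae_ne hN x] with y hy
  rw [gk_eq m hy]; ring

/-- C² (resp. C¹) regularity of `Gop f` from that of `Np f`. -/
lemma contDiffAt_Gop {m : ℕ} (hN : N = 2 * m + 2) {f : Fn N} (hf : Continuous f) {n : ℕ∞} {x : Euc N} (hx : ‖x‖ < 1)
    (h : ContDiffAt ℝ n (Np m f) x) : ContDiffAt ℝ n (Gop m f) x := by
  have h2 : ContDiffAt ℝ n (Hp m f) x := (contDiffOn_Hp hf).contDiffAt (isOpen_ball.mem_nhds (by simpa using hx))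
  have : Gop m f = fun x => (kap N m)⁻¹ * (Np m f x - Hp m f x) := by ext x; exact Gop_eq hN x hf
  rw [this]
  exact contDiffAt_const.mul (h.sub h2)

lemma contDiffAt_Gop_one {m : ℕ} (hN : N = 2 * m + 2) {f : Fn N} (hf : Continuous f) {x : Euc N} (hx : ‖x‖ < 1) :
    ContDiffAt ℝ 1 (Gop m f) x := contDiffAt_Gop (n := 1) hN hf hx (contDiff_Np hN hf).contDiffAt

lemma Gop_lap {m : ℕ} (hN : N = 2 * m + 2) (hm : 1 ≤ m) {φ : Fn N} (hφ : ContDiff ℝ 2 φ) (hc : HasCompactSupport φ)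
    (hs : tsupport φ ⊆ ball 0 1) {y : Euc N} (hy : ‖y‖ < 1) (hy0 : y ≠ 0) : Gop m (lap φ) y = - φ y := by
  have hz : ∀ x : Euc N, 1 ≤ ‖x‖ → lap φ x = 0 := fun x hx => lap_zero_of fun h => by
    have := hs h; simp at this; linarith
  rw [Gop_eq hN y (cont_lap' hφ)]
  have h1 : Np m (lap φ) y = -(kap N m * φ y) := by
    rw [← newton hN hφ hc y]
    exact int_mu_full fun x hx => by rw [hz x hx, mul_zero]
  have hn : 0 < ‖y‖ := norm_pos_iff.2 hy0
  have h2 : Hp m (lap φ) y = 0 := by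
    have e : Hp m (lap φ) y = ∫ x, ((‖y‖ ^ 2) ^ m)⁻¹ * (rad m ((‖y‖ ^ 2)⁻¹ • y - x) * lap φ x) := by
      rw [← int_mu_full (fun x hx => by rw [hz x hx]; ring)]
      refine integral_congr_ae (ae_mu fun x hx => ?_)
      simp only
      rw [hk_eq m hy hx, ← mul_assoc]
      congr 1
      unfold rad
      have q : ‖y‖ ^ 2 * ‖(‖y‖ ^ 2)⁻¹ • y - x‖ ^ 2 = 1 - 2 * inner ℝ y x + ‖y‖ ^ 2 * ‖x‖ ^ 2 := by
        rw [norm_sub_sq_real, norm_smul, real_inner_smul_left, norm_inv, norm_pow, norm_norm]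
        field_simp
      rw [← mul_inv, ← mul_pow (‖y‖ ^ 2) (‖(‖y‖ ^ 2)⁻¹ • y - x‖ ^ 2), q]; congr 2; ring
    rw [e, integral_const_mul, newton hN hφ hc]
    have : φ ((‖y‖ ^ 2)⁻¹ • y) = 0 := by
      refine image_eq_zero_of_notMem_tsupport fun h => ?_
      have h' := hs h
      rw [mem_ball_zero_iff, norm_smul, norm_inv, norm_pow, norm_norm] at h'
      have : (‖y‖ ^ 2)⁻¹ * ‖y‖ = ‖y‖⁻¹ := by field_simp
      rw [this] at h'
      exact absurd h' (not_lt.2 ((one_le_inv₀ hn).2 hy.le))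
    rw [this]; ring
  rw [h1, h2]
  have := (kap_pos hN hm).ne'
  field_simp
  ring

lemma weak_form {m : ℕ} (hN : N = 2 * m + 2) (hm : 1 ≤ m) {φ : Fn N} (hφ : ContDiff ℝ 2 φ) (hc : HasCompactSupport φ)
    (hs : tsupport φ ⊆ ball 0 1) {f : Fn N} (hf : Continuous f) :
    ∫ x, Gop m f x * lap φ x = - ∫ x, f x * φ x := by
  have hz : ∀ x : Euc N, 1 ≤ ‖x‖ → lap φ x = 0 := fun x hx => lap_zero_of fun h => by
    have := hs h; simp at this; linarith
  have hz' : ∀ x : Euc N, 1 ≤ ‖x‖ → φ x = 0 := fun x hx => image_eq_zero_of_notMem_tsupport fun h => by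
    have := hs h; simp at this; linarith
  rw [← int_mu_full (fun x hx => by rw [hz x hx, mul_zero]), ← int_mu_full (fun x hx => by rw [hz' x hx, mul_zero]),
    ← integral_neg]
  simp only [mul_comm _ (lap φ _)]
  rw [Gop_symm hN hf (cont_lap' hφ)]
  refine integral_congr_ae ?_
  filter_upwards [ae_ne hN 0, ae_mu (N := N) (P := fun y => ‖y‖ < 1) fun y hy => hy] with y h0 hy
  rw [Gop_lap hN hm hφ hc hs hy h0.symm]; ring

/-- the equation holds wherever the potential is `C²`. -/
lemma neg_lap_Gop {m : ℕ} (hN : N = 2 * m + 2) (hm : 1 ≤ m) {f : Fn N} (hf : Continuous f) {x : Euc N} (hx : ‖x‖ < 1)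
    (h : ContDiffAt ℝ 2 (Gop m f) x) : - lap (Gop m f) x = f x := by
  obtain ⟨U, hU, hxU, hU2⟩ : ∃ U : Set (Euc N), IsOpen U ∧ x ∈ U ∧ ∀ y ∈ U, ‖y‖ < 1 ∧ ContDiffAt ℝ 2 (Gop m f) y := by
    have h1 : ∀ᶠ y in 𝓝 x, ‖y‖ < 1 ∧ ContDiffAt ℝ 2 (Gop m f) y :=
      (continuous_norm.continuousAt.eventually (gt_mem_nhds hx)).and (h.eventually (by simp))
    obtain ⟨U, hU, h2, h3⟩ := _root_.mem_nhds_iff.1 h1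
    exact ⟨U, h2, h3, hU⟩
  have hcont : ContinuousOn (fun y => lap (Gop m f) y + f y) U := fun y hy =>
    ((cont_lap (hU2 y hy).2).add hf.continuousAt).continuousWithinAt
  have hae := hU.ae_eq_zero_of_integral_contDiff_smul_eq_zero (μ := (volume : Measure (Euc N)))
    (hcont.locallyIntegrableOn hU.measurableSet) (fun φ hφ hc hs => by
      have hφ2 : ContDiff ℝ 2 φ := contDiff_infty.1 hφ 2
      have g1 := green (w := Gop m f) hc hφ2 (fun y hy => (hU2 y (hs hy)).2)
      have g2 := weak_form hN hm hφ2 hc (fun y hy => by simpa using (hU2 y (hs hy)).1) hf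
      have i1 := int_prod (u := lap (Gop m f)) hc (fun y hy => cont_lap (hU2 y (hs hy)).2) (fun y _ => hφ.continuous.continuousAt)
      have i2 := int_prod (u := f) hc (fun y hy => hf.continuousAt) (fun y _ => hφ.continuous.continuousAt)
      calc ∫ y, φ y • (lap (Gop m f) y + f y) = ∫ y, (lap (Gop m f) y * φ y + f y * φ y) := by
            congr; ext y; simp only [smul_eq_mul]; ring
        _ = 0 := by rw [integral_add i1 i2, ← g1, g2]; ring)
  have h0 : EqOn (fun y => lap (Gop m f) y + f y) (fun _ => 0) U := by
    refine Measure.eqOn_open_of_ae_eq (μ := (volume : Measure (Euc N))) ?_ hU hcont continuousOn_const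
    rw [EventuallyEq, ae_restrict_iff' hU.measurableSet]
    exact hae
  have := h0 hxU
  simp only at this
  linarith

end Henon

namespace Henon
open Topology Metric
variable {N : ℕ}

lemma locInt_rad {m : ℕ} (hN : N = 2 * m + 2) : LocallyIntegrable (rad m : Fn N) volume := fun x =>
  ⟨ball 0 (‖x‖ + 1), isOpen_ball.mem_nhds (by simp), int_rad_ball hN _⟩

lemma contDiff_Np_two {m : ℕ} (hN : N = 2 * m + 2) {g : Fn N} (hg : ContDiff ℝ 1 g) (hc : HasCompactSupport g)
    (hs : tsupport g ⊆ ball 0 1) : ContDiff ℝ 2 (Np m g) := by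
  have hz : ∀ y : Euc N, 1 ≤ ‖y‖ → y ∉ tsupport g := fun y hy h => by
    have := hs h; simp at this; linarith
  have hd : ∀ x, HasFDerivAt (Np m g) (∫ y, rad m (x - y) • fderiv ℝ g y) x := by
    intro x
    have h := hc.hasFDerivAt_convolution_left (ContinuousLinearMap.mul ℝ ℝ) (μ := volume) hg (locInt_rad hN) x
    have e1 : Np m g = convolution g (rad m) (ContinuousLinearMap.mul ℝ ℝ) volume := funext fun x => by
      rw [convolution_def, Np, int_mu_full fun y hy => by rw [image_eq_zero_of_notMem_tsupport (hz y hy), mul_zero]]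
      simp [mul_comm]
    have e2 : (∫ y, rad m (x - y) • fderiv ℝ g y) = convolution (fderiv ℝ g) (rad m)
        (ContinuousLinearMap.precompL (Euc N) (ContinuousLinearMap.mul ℝ ℝ)) volume x := by
      rw [convolution_def]
      refine integral_congr_ae (ae_of_all _ fun y => ContinuousLinearMap.ext fun v => ?_)
      simp [ContinuousLinearMap.precompL, mul_comm]
    rw [e1, e2]; exact h
  have hI : ∀ x, Integrable (fun y => rad m (x - y) • fderiv ℝ g y) volume := by
    intro x
    refine (int_rad_mul hN (g := fun y => ‖fderiv ℝ g y‖) (hg.continuous_fderiv one_ne_zero).norm (hc.fderiv ℝ).norm x).mono'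
      (((meas_rad m).comp (by fun_prop : Measurable fun y : Euc N => x - y)).aestronglyMeasurable.smul
        (hg.continuous_fderiv one_ne_zero).aestronglyMeasurable) (ae_of_all _ fun y => ?_)
    rw [norm_smul, norm_of_nonneg (rad_nonneg m _)]
  have : ((2 : ℕ) : WithTop ℕ∞) = 1 + 1 := by norm_num
  rw [show (2 : WithTop ℕ∞) = 1 + 1 by norm_num, contDiff_succ_iff_fderiv_apply]
  refine ⟨fun x => (hd x).differentiableAt, by simp, fun v => ?_⟩
  have h2 : (fun x => fderiv ℝ (Np m g) x v) = Np m (fun y => fderiv ℝ g y v) := by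
    ext x
    rw [(hd x).fderiv, ContinuousLinearMap.integral_apply (hI x), Np, int_mu_full]
    · simp
    · intro y hy
      have : fderiv ℝ g y = 0 := image_eq_zero_of_notMem_tsupport fun h => hz y hy (tsupport_fderiv_subset ℝ h)
      rw [this]; simp
  rw [h2]
  exact contDiff_Np hN ((hg.continuous_fderiv one_ne_zero).clm_apply continuous_const)

lemma contDiffAt_Np_far {m : ℕ} {f : Fn N} (hf : Continuous f) {x₀ : Euc N} {δ : ℝ} (hδ : 0 < δ)
    (h0 : ∀ y ∈ ball x₀ (2 * δ), f y = 0) {n : ℕ∞} : ContDiffAt ℝ n (Np m f) x₀ := by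
  let η : ContDiffBump (0 : Euc N) := ⟨δ / 2, δ, by linarith, by linarith⟩
  have hk : ContDiff ℝ n (fun z : Euc N => (1 - η z) * rad m z) := by
    rw [contDiff_iff_contDiffAt]
    intro z
    by_cases hz : z = 0
    · refine (contDiffAt_const (c := (0:ℝ))).congr_of_eventuallyEq ?_
      filter_upwards [η.eventuallyEq_one_of_mem_ball (x := z) (by simp [hz, η]; linarith)] with y hy
      rw [hy]; simp
    · exact (contDiffAt_const.sub η.contDiffAt).mul (contDiffAt_rad m hz)
  have h1 := contDiffOn_param (n := n) (S := ball x₀ δ) isOpen_ball one_lt_two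
    (k := fun x y => (1 - η (x - y)) * rad m (x - y)) (hk.comp (contDiff_fst.sub contDiff_snd)).contDiffOn hf
  refine (h1.contDiffAt (isOpen_ball.mem_nhds (mem_ball_self hδ))).congr_of_eventuallyEq ?_
  filter_upwards [isOpen_ball.mem_nhds (mem_ball_self hδ)] with x hx
  unfold Np
  congr; ext y
  by_cases hy : y ∈ ball x₀ (2 * δ)
  · rw [h0 y hy]; simp
  · have : η (x - y) = 0 := by
      refine η.zero_of_le_dist ?_
      rw [dist_zero_right, ← dist_eq_norm]
      change δ ≤ _
      rw [mem_ball, not_lt] at hy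
      rw [mem_ball] at hx
      have := dist_triangle y x x₀
      rw [dist_comm y x] at this
      linarith
    rw [this]; ring

lemma Np_add {m : ℕ} (hN : N = 2 * m + 2) {f g : Fn N} (hf : Continuous f) (hg : Continuous g) (x : Euc N) :
    Np m (fun y => f y + g y) x = Np m f x + Np m g x := by
  unfold Np
  have h : ∀ {f : Fn N}, Continuous f → Integrable (fun y => rad m (x - y) * f y) (mu N) := fun {f} hf => by
    obtain ⟨M, -, hM⟩ := bdd_of_cont hf 1
    refine Integrable.mul_bdd (c := M) (int_rad hN x) hf.aestronglyMeasurable (ae_mu fun y hy => hM y ?_)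
    simpa using hy.le
  rw [← integral_add (h hf) (h hg)]
  congr; ext y; ring

/-- T2 -/
lemma contDiffAt_Np {m : ℕ} (hN : N = 2 * m + 2) {f : Fn N} (hf : Continuous f) {x₀ : Euc N} (hx : ‖x₀‖ < 1)
    (h : ContDiffAt ℝ 1 f x₀) : ContDiffAt ℝ 2 (Np m f) x₀ := by
  have h1 : ∀ᶠ y in 𝓝 x₀, ‖y‖ < 1 ∧ ContDiffAt ℝ 1 f y :=
      (continuous_norm.continuousAt.eventually (gt_mem_nhds hx)).and (h.eventually (by simp))
  obtain ⟨d, hd, h2⟩ := Metric.eventually_nhds_iff_ball.1 h1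
  let χ : ContDiffBump x₀ := ⟨d / 4, d / 2, by linarith, by linarith⟩
  have hsub : closedBall x₀ (d / 2) ⊆ ball x₀ d := closedBall_subset_ball (by linarith)
  have hts : tsupport (fun y => χ y * f y) ⊆ closedBall x₀ (d / 2) := by
    refine (tsupport_mul_subset_left (f := χ) (g := f)).trans ?_
    rw [χ.tsupport_eq]
  have hg : ContDiff ℝ 1 (fun y => χ y * f y) := by
    rw [contDiff_iff_contDiffAt]
    intro y
    by_cases hy : y ∈ closedBall x₀ (d / 2)
    · exact χ.contDiffAt.mul (h2 y (hsub hy)).2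
    · refine (contDiffAt_const (c := (0:ℝ))).congr_of_eventuallyEq ?_
      exact notMem_tsupport_iff_eventuallyEq.1 fun h => hy (hts h)
  have hc : HasCompactSupport (fun y => χ y * f y) := χ.hasCompactSupport.mul_right
  have e : Np m f = fun x => Np m (fun y => χ y * f y) x + Np m (fun y => (1 - χ y) * f y) x := by
    ext x
    rw [← Np_add (f := fun y => χ y * f y) (g := fun y => (1 - χ y) * f y) hN (χ.continuous.mul hf)
      ((continuous_const.sub χ.continuous).mul hf)]
    congr; ext y; ring
  rw [e]
  refine (contDiff_Np_two hN hg hc fun y hy => ?_).contDiffAt.add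
    (contDiffAt_Np_far (n := 2) (f := fun y => (1 - χ y) * f y) (δ := d / 8) ((continuous_const.sub χ.continuous).mul hf) (by linarith) fun y hy => ?_)
  · simpa using (h2 y (hsub (hts hy))).1
  · rw [χ.one_of_mem_closedBall (mem_closedBall.2 ?_)]
    · ring
    · rw [mem_ball] at hy; change _ ≤ d / 4; linarith

lemma contDiffAt_Gop_two {m : ℕ} (hN : N = 2 * m + 2) {f : Fn N} (hf : Continuous f) {x₀ : Euc N} (hx : ‖x₀‖ < 1)
    (h : ContDiffAt ℝ 1 f x₀) : ContDiffAt ℝ 2 (Gop m f) x₀ :=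
  contDiffAt_Gop (n := 2) hN hf hx (contDiffAt_Np hN hf hx h)

lemma cont_nrpow {α : ℝ} (hα : 0 ≤ α) : Continuous fun x : Euc N => ‖x‖ ^ α :=
  continuous_norm.rpow_const fun _ => Or.inr hα

def DF (α : ℝ) (h : Fn N) (h' : Euc N → Euc N →L[ℝ] ℝ) (x : Euc N) : Euc N →L[ℝ] ℝ :=
  ‖x‖ ^ α • h' x + ((h x - h 0) * (α * (‖x‖ ^ 2) ^ (α / 2 - 1))) • innerSL ℝ x

lemma npow_eq (α : ℝ) (x : Euc N) : (‖x‖ ^ 2) ^ (α / 2) = ‖x‖ ^ α := by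
  rw [← rpow_natCast, ← rpow_mul (norm_nonneg _)]; congr 1; push_cast; ring

lemma hasFDerivAt_DF {α : ℝ} (hα : 0 < α) {h : Fn N} {h' : Euc N → Euc N →L[ℝ] ℝ} {x : Euc N} (hd : HasFDerivAt h (h' x) x) :
    HasFDerivAt (fun x => ‖x‖ ^ α * (h x - h 0)) (DF α h h' x) x := by
  by_cases hx : x = 0
  · subst hx
    have e : DF α h h' 0 = 0 := by simp [DF, zero_rpow hα.ne']
    rw [e, hasFDerivAt_iff_isLittleO_nhds_zero]
    simp only [zero_add, norm_zero, zero_rpow hα.ne', zero_mul, sub_zero, zero_apply]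
    have h1 : (fun v : Euc N => h v - h 0) =O[𝓝 0] fun v => v := by simpa using hd.isBigO_sub
    have h2 : (fun v : Euc N => ‖v‖ ^ α) =o[𝓝 0] fun _ => (1:ℝ) := by
      rw [Asymptotics.isLittleO_one_iff]
      have := (cont_nrpow (N := N) hα.le).tendsto 0
      simpa [zero_rpow hα.ne'] using this
    have h3 := h2.mul_isBigO h1.norm_right
    refine (h3.congr_right fun v => by simp).of_norm_right
  · have hn : ‖x‖ ^ 2 ≠ 0 := by simpa using hx
    have h1 := ((hasStrictFDerivAt_norm_sq x).hasFDerivAt.rpow_const (p := α / 2) (Or.inl hn))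
    simp only [npow_eq] at h1
    have h2 := h1.mul (hd.sub_const (h 0))
    refine h2.congr_fderiv (ContinuousLinearMap.ext fun v => ?_)
    simp [DF]
    ring

lemma contDiffAt_DF {α : ℝ} (hα : 0 < α) {h : Fn N} {x₀ : Euc N} (hh : ContDiffAt ℝ 1 h x₀) (hx0 : x₀ = 0) :
    ContDiffAt ℝ 1 (fun x => ‖x‖ ^ α * (h x - h 0)) x₀ := by
  subst hx0
  obtain ⟨h', u, hu, hc, hd⟩ := contDiffAt_one_iff.1 hh
  obtain ⟨U, hUu, hU, h0U⟩ := _root_.mem_nhds_iff.1 hu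
  refine contDiffAt_one_iff.2 ⟨DF α h h', U, hU.mem_nhds h0U, fun x hx => ContinuousAt.continuousWithinAt ?_,
    fun x hx => hasFDerivAt_DF hα (hd x (hUu hx))⟩
  have hcx : ContinuousAt h' x := hc.continuousAt (mem_of_superset (hU.mem_nhds hx) hUu)
  have hhx : ContinuousAt h x := (hd x (hUu hx)).continuousAt
  by_cases h0 : x = 0
  · subst h0
    have e : DF α h h' 0 = 0 := by simp [DF, zero_rpow hα.ne']
    have h1 : ContinuousAt (fun x : Euc N => ‖x‖ ^ α • h' x) 0 := (cont_nrpow hα.le).continuousAt.smul hcx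
    have h2 : Tendsto (fun x : Euc N => ((h x - h 0) * (α * (‖x‖ ^ 2) ^ (α / 2 - 1))) • innerSL ℝ x) (𝓝 0) (𝓝 0) := by
      have hb : (fun v : Euc N => h v - h 0) =O[𝓝 0] fun v => v := by simpa using (hd 0 (hUu hx)).isBigO_sub
      obtain ⟨C, hC⟩ := hb.bound
      refine squeeze_zero_norm' (a := fun x : Euc N => C * α * ‖x‖ ^ α) ?_ ?_
      · filter_upwards [hC] with v hv
        rw [norm_smul, norm_mul, norm_mul, norm_of_nonneg hα.le, norm_of_nonneg (by positivity : 0 ≤ (‖v‖ ^ 2) ^ (α / 2 - 1)),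
          innerSL_apply_norm]
        by_cases hv0 : v = 0
        · subst hv0; simp [zero_rpow hα.ne']
        · have hp : 0 < ‖v‖ ^ 2 := by positivity
          rw [rpow_sub hp, npow_eq, rpow_one]
          have hvn : 0 < ‖v‖ := norm_pos_iff.2 hv0
          calc ‖h v - h 0‖ * (α * (‖v‖ ^ α / ‖v‖ ^ 2)) * ‖v‖ ≤ (C * ‖v‖) * (α * (‖v‖ ^ α / ‖v‖ ^ 2)) * ‖v‖ := by gcongr
            _ = _ := by field_simp
      · have := ((cont_nrpow (N := N) hα.le).const_mul (C * α)).tendsto 0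
        simpa [zero_rpow hα.ne'] using this
    have h3 := h1.tendsto.add h2
    unfold ContinuousAt
    rw [e]
    change Tendsto (fun x => ‖x‖ ^ α • h' x + ((h x - h 0) * (α * (‖x‖ ^ 2) ^ (α / 2 - 1))) • innerSL ℝ x) _ _
    simpa [zero_rpow hα.ne'] using h3
  · refine ((cont_nrpow hα.le).continuousAt.smul hcx).add (((hhx.sub continuousAt_const).mul (continuousAt_const.mul
      (ContinuousAt.rpow_const (by fun_prop) (Or.inl (by simpa using h0))))).smul (by fun_prop))

end Henon

namespace Henon
open Topology Metric
variable {N : ℕ}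

lemma fderiv_nrpow {α : ℝ} (hα : 0 < α) (x v : Euc N) :
    fderiv ℝ (fun x : Euc N => ‖x‖ ^ (α + 2)) x v = (α + 2) * (‖x‖ ^ α * (inner ℝ v x - inner ℝ v 0)) := by
  rw [fderiv_norm_rpow x (by linarith), show α + 2 - 2 = α by ring]
  simp [real_inner_comm]; ring

lemma contDiffAt_nrpow (α : ℝ) {x : Euc N} (hx : x ≠ 0) {n : WithTop ℕ∞} : ContDiffAt ℝ n (fun x : Euc N => ‖x‖ ^ α) x :=
  (contDiffAt_norm ℝ hx).rpow_const_of_ne (norm_ne_zero_iff.2 hx)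

lemma contDiff_nrpow_two {α : ℝ} (hα : 0 < α) : ContDiff ℝ 2 (fun x : Euc N => ‖x‖ ^ (α + 2)) := by
  rw [show (2 : WithTop ℕ∞) = 1 + 1 by norm_num, contDiff_succ_iff_fderiv_apply]
  refine ⟨(contDiff_norm_rpow (by linarith)).differentiable one_ne_zero, by simp, fun v => ?_⟩
  simp only [fderiv_nrpow hα]
  refine contDiff_const.mul (contDiff_iff_contDiffAt.2 fun x => ?_)
  by_cases hx : x = 0
  · exact contDiffAt_DF hα (h := fun x => inner ℝ v x) (contDiffAt_const.inner ℝ contDiffAt_id) hx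
  · exact (contDiffAt_nrpow α hx).mul ((contDiffAt_const.inner ℝ contDiffAt_id).sub contDiffAt_const)

lemma lap_nrpow {α : ℝ} (hα : 0 < α) (x : Euc N) :
    lap (fun x : Euc N => ‖x‖ ^ (α + 2)) x = (α + 2) * (N + α) * ‖x‖ ^ α := by
  rw [lap_eq (contDiff_nrpow_two hα).contDiffAt]
  have h1 : ∀ i : Fin N, pd i (pd i (fun x : Euc N => ‖x‖ ^ (α + 2))) x
      = (α + 2) * (‖x‖ ^ α + α * (‖x‖ ^ 2) ^ (α / 2 - 1) * x i ^ 2) := by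
    intro i
    have e : pd i (fun x : Euc N => ‖x‖ ^ (α + 2)) = fun x => (α + 2) * (‖x‖ ^ α * (inner ℝ (ei i) x - inner ℝ (ei i) 0)) :=
      funext fun x => fderiv_nrpow hα x (ei i)
    have hd : HasFDerivAt (fun x : Euc N => inner ℝ (ei i) x) (innerSL ℝ (ei i)) x := (innerSL ℝ (ei i)).hasFDerivAt
    have h2 := (hasFDerivAt_DF hα (h := fun x => inner ℝ (ei i) x) (h' := fun _ => innerSL ℝ (ei i)) hd).const_mul (α + 2)
    rw [e, pd, h2.fderiv]
    simp [DF, EuclideanSpace.inner_single_left, EuclideanSpace.inner_single_right]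
    ring
  simp only [h1]
  rw [← Finset.mul_sum, Finset.sum_add_distrib, ← Finset.mul_sum, ← EuclideanSpace.real_norm_sq_eq]
  simp only [Finset.sum_const, Finset.card_univ, Fintype.card_fin, nsmul_eq_mul]
  by_cases hx : x = 0
  · subst hx; simp [zero_rpow hα.ne']
  · have hp : 0 < ‖x‖ ^ 2 := by positivity
    rw [rpow_sub hp, npow_eq, rpow_one]
    field_simp

/-- T3 -/
lemma contDiffAt_Gop_zero {m : ℕ} (hN : N = 2 * m + 2) {α : ℝ} (hα : 0 < α) {f g : Fn N} (hf : Continuous f)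
    (hfg : ∀ x, f x = ‖x‖ ^ α * g x) (hg : ContDiffAt ℝ 1 g 0) : ContDiffAt ℝ 2 (Gop m f) 0 := by
  refine contDiffAt_Gop (n := 2) hN hf (by simp) ?_
  let χ : ContDiffBump (0 : Euc N) := ⟨1 / 4, 1 / 2, by norm_num, by norm_num⟩
  let c : ℝ := ((α + 2) * (N + α))⁻¹
  let φ : Fn N := fun x => χ x * (c * ‖x‖ ^ (α + 2))
  have hφ : ContDiff ℝ 2 φ := χ.contDiff.mul (contDiff_const.mul (contDiff_nrpow_two hα))
  have hc : HasCompactSupport φ := χ.hasCompactSupport.mul_right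
  have hts : tsupport φ ⊆ closedBall 0 (1 / 2) := by
    refine (tsupport_mul_subset_left (f := χ) (g := fun x => c * ‖x‖ ^ (α + 2))).trans ?_
    rw [χ.tsupport_eq]
  have hl : lap φ =ᶠ[𝓝 0] fun x => ‖x‖ ^ α := by
    filter_upwards [isOpen_ball.mem_nhds (mem_ball_self (x := (0 : Euc N)) (by norm_num : (0:ℝ) < 1 / 4))] with x hx
    have e : φ =ᶠ[𝓝 x] fun x => c * ‖x‖ ^ (α + 2) := by
      filter_upwards [χ.eventuallyEq_one_of_mem_ball hx] with y hy
      simp only [φ]; rw [hy]; simp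
    rw [lap_congr e]
    have e2 : lap (fun x : Euc N => c * ‖x‖ ^ (α + 2)) x = c * lap (fun x : Euc N => ‖x‖ ^ (α + 2)) x := by
      unfold lap
      rw [Finset.mul_sum]
      refine Finset.sum_congr rfl fun i _ => ?_
      have := iteratedFDeriv_const_smul_apply (i := 2) (a := c) (x := x) ((contDiff_nrpow_two (N := N) hα).contDiffAt)
      rw [show (fun x : Euc N => c * ‖x‖ ^ (α + 2)) = c • (fun x : Euc N => ‖x‖ ^ (α + 2)) from rfl, this]
      simp
    rw [e2, lap_nrpow hα, ← mul_assoc, inv_mul_cancel₀ (by positivity), one_mul]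
  have hlc := cont_lap' hφ
  have hz : ∀ y : Euc N, 1 ≤ ‖y‖ → lap φ y = 0 := fun y hy => lap_zero_of fun h => by
    have := hts h; simp at this; linarith
  have hN2 : ∀ x, Np m (fun y => g 0 * lap φ y) x = - (g 0 * kap N m * φ x) := by
    intro x
    rw [Np, int_mu_full (fun y hy => by rw [hz y hy]; ring)]
    simp_rw [mul_left_comm _ (g 0)]
    rw [integral_const_mul, newton hN hφ hc]; ring
  have e : Np m f = fun x => Np m (fun y => f y - g 0 * lap φ y) x - g 0 * kap N m * φ x := by
    ext x
    rw [sub_eq_add_neg, ← hN2, ← Np_add (f := fun y => f y - g 0 * lap φ y) (g := fun y => g 0 * lap φ y) hN (hf.sub (continuous_const.mul hlc))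
      (continuous_const.mul hlc)]
    congr; ext y; ring
  rw [e]
  refine (contDiffAt_Np hN (hf.sub (continuous_const.mul hlc)) (by simp) ?_).sub (contDiff_const.mul hφ).contDiffAt
  refine (contDiffAt_DF hα hg rfl).congr_of_eventuallyEq ?_
  filter_upwards [hl] with x hx
  change f x - g 0 * lap φ x = _
  rw [hx, hfg]; ring

end Henon

namespace Henon
open Topology Metric
variable {N : ℕ}

def edk (k : ℕ) (t : ℝ) : ℝ := max 0 (min 1 ((k + 1) * t - 1))
def etk (k : ℕ) (t : ℝ) : ℝ := ∫ s in (0:ℝ)..t, edk k s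

lemma cont_edk (k : ℕ) : Continuous (edk k) := by unfold edk; fun_prop
lemma edk_nonneg (k : ℕ) (t : ℝ) : 0 ≤ edk k t := le_max_left _ _
lemma edk_le (k : ℕ) (t : ℝ) : edk k t ≤ 1 := max_le zero_le_one (min_le_left _ _)
lemma edk_zero {k : ℕ} {t : ℝ} (h : t ≤ ek k) : edk k t = 0 := by
  refine max_eq_left ((min_le_right _ _).trans ?_)
  unfold ek at h
  rw [le_div_iff₀ (by positivity)] at h; linarith
lemma edk_tendsto {t : ℝ} (ht : 0 < t) : Tendsto (fun k => edk k t) atTop (𝓝 1) := by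
  refine tendsto_const_nhds.congr' ?_
  obtain ⟨K, hK⟩ := exists_nat_ge (2 / t)
  filter_upwards [eventually_ge_atTop K] with k hk
  have : (K : ℝ) ≤ k := by exact_mod_cast hk
  rw [div_le_iff₀ ht] at hK
  have : 1 ≤ ((k : ℝ) + 1) * t - 1 := by nlinarith
  rw [edk, min_eq_left this]; simp
lemma hasDerivAt_etk (k : ℕ) (t : ℝ) : HasDerivAt (etk k) (edk k t) t :=
  ((cont_edk k).integral_hasStrictDerivAt 0 t).hasDerivAt
lemma cont_etk (k : ℕ) : Continuous (etk k) := continuous_iff_continuousAt.2 fun t => (hasDerivAt_etk k t).continuousAt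
lemma etk_nonneg (k : ℕ) {t : ℝ} (ht : 0 ≤ t) : 0 ≤ etk k t :=
  intervalIntegral.integral_nonneg ht fun s _ => edk_nonneg k s
lemma etk_le (k : ℕ) {t : ℝ} (ht : 0 ≤ t) : etk k t ≤ t := by
  have := intervalIntegral.integral_mono_on (μ := volume) ht ((cont_edk k).intervalIntegrable 0 t) (intervalIntegrable_const (c := (1:ℝ)))
    fun s _ => edk_le k s
  simpa [etk] using this
lemma etk_zero {k : ℕ} {t : ℝ} (ht : 0 ≤ t) (h : t ≤ ek k) : etk k t = 0 := by
  unfold etk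
  rw [intervalIntegral.integral_congr (g := fun _ => (0:ℝ))]
  · simp
  · intro s hs
    rw [uIcc_of_le ht] at hs
    exact edk_zero (hs.2.trans h)
lemma etk_tendsto {t : ℝ} (ht : 0 ≤ t) : Tendsto (fun k => etk k t) atTop (𝓝 t) := by
  have := intervalIntegral.tendsto_integral_filter_of_dominated_convergence (a := 0) (b := t) (μ := volume) (l := atTop) (F := fun k s => edk k s)
    (f := fun _ => 1) (fun _ => (1:ℝ)) (Eventually.of_forall fun k => (cont_edk k).aestronglyMeasurable)
    (Eventually.of_forall fun k => ae_of_all _ fun s _ => by rw [norm_of_nonneg (edk_nonneg k s)]; exact edk_le k s)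
    intervalIntegrable_const (ae_of_all _ fun s hs => by rw [uIoc_of_le ht] at hs; exact edk_tendsto hs.1)
  simpa [etk] using this

/-- the inner product of gradients -/
def gp (u v : Fn N) (x : Euc N) : ℝ := ∑ i, pd i u x * pd i v x

lemma norm_grad (u : Fn N) (x : Euc N) : ‖gradient u x‖ ^ 2 = gp u u x := by
  rw [EuclideanSpace.real_norm_sq_eq, gp]
  refine Finset.sum_congr rfl fun i _ => ?_
  have : gradient u x i = pd i u x := by
    have := inner_gradient_left (𝕜 := ℝ) (f := u) (x := x) (y := ei i)
    rw [EuclideanSpace.inner_single_right] at this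
    simpa [pd] using this
  rw [this]; ring

lemma meas_pd (i : Fin N) (u : Fn N) : Measurable (pd i u) := measurable_fderiv_apply_const ℝ u (ei i)

lemma gp_self_nonneg (u : Fn N) (x : Euc N) : 0 ≤ gp u u x := Finset.sum_nonneg fun i _ => mul_self_nonneg _

structure H10' (φ : Fn N) : Prop where
  cont : Continuous φ
  diff : ∀ x : Euc N, ‖x‖ < 1 → DifferentiableAt ℝ φ x
  zero : ∀ x : Euc N, 1 ≤ ‖x‖ → φ x = 0
  nonneg : ∀ x : Euc N, 0 ≤ φ x
  loc : ∀ K : Set (Euc N), IsCompact K → K ⊆ ball 0 1 → ∀ i, IntegrableOn (pd i φ) K volume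

lemma energy_ibp {φ V : Fn N} (hφ : H10' φ) (hV : ∀ x : Euc N, ‖x‖ < 1 → ContDiffAt ℝ 2 V x) (k : ℕ) :
    Integrable (fun x => edk k (φ x) * gp φ V x) (mu N) ∧
    ∫ x, (- lap V x) * etk k (φ x) ∂(mu N) = ∫ x, edk k (φ x) * gp φ V x ∂(mu N) := by
  let K : Set (Euc N) := closedBall 0 1 ∩ φ ⁻¹' Ici (ek k)
  have hK : IsCompact K := (isCompact_closedBall _ _).inter_right (isClosed_Ici.preimage hφ.cont)
  have hKb : K ⊆ ball 0 1 := fun x hx => by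
    rw [mem_ball_zero_iff]
    by_contra h
    have := hx.2
    simp only [mem_preimage, mem_Ici, hφ.zero x (not_lt.1 h)] at this
    exact absurd this (not_le.2 (ek_pos k))
  have hKb' : ∀ x ∈ K, ‖x‖ < 1 := fun x hx => by simpa using hKb hx
  let ψ : Fn N := fun x => etk k (φ x)
  have hψ0 : ∀ x, x ∉ K → φ x < ek k := fun x hx => by
    by_contra h
    by_cases h1 : ‖x‖ < 1
    · exact hx ⟨by simpa using h1.le, not_lt.1 h⟩
    · rw [hφ.zero x (not_lt.1 h1)] at h; exact h (ek_pos k)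
  have hψK : tsupport ψ ⊆ K := by
    refine closure_minimal (fun x hx => ?_) hK.isClosed
    by_contra h
    exact hx (etk_zero (hφ.nonneg x) (hψ0 x h).le)
  have hcs : HasCompactSupport ψ := hK.of_isClosed_subset (isClosed_tsupport _) hψK
  have hψc : Continuous ψ := (cont_etk k).comp hφ.cont
  have hd : ∀ x, ‖x‖ < 1 → HasFDerivAt ψ (edk k (φ x) • fderiv ℝ φ x) x := fun x hx =>
    (hasDerivAt_etk k (φ x)).comp_hasFDerivAt x (hφ.diff x hx).hasFDerivAt
  have hd0 : ∀ x, x ∉ K → HasFDerivAt ψ (0 : Euc N →L[ℝ] ℝ) x := fun x hx =>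
    (hasFDerivAt_const (0:ℝ) x).congr_of_eventuallyEq (notMem_tsupport_iff_eventuallyEq.1 fun h => hx (hψK h))
  have hpd : ∀ i x, pd i ψ x = edk k (φ x) * pd i φ x := fun i x => by
    by_cases hx : x ∈ K
    · rw [pd, (hd x (hKb' x hx)).fderiv]; rfl
    · rw [pd, (hd0 x hx).fderiv, edk_zero (hψ0 x hx).le]; simp
  have hdiff : ∀ x, DifferentiableAt ℝ ψ x := fun x => by
    by_cases hx : x ∈ K
    · exact (hd x (hKb' x hx)).differentiableAt
    · exact (hd0 x hx).differentiableAt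
  have hV1 : ∀ i, ∀ x ∈ K, ContDiffAt ℝ 1 (pd i V) x := fun i x hx => contDiffAt_pd (hV x (hKb' x hx)) (by norm_num) i
  have h1 : ∀ i, Integrable (fun x => pd i ψ x * pd i V x) volume := by
    intro i
    have hc : ContinuousOn (fun x => edk k (φ x) * pd i V x) K := fun x hx =>
      (((cont_edk k).comp hφ.cont).continuousAt.mul (hV1 i x hx).continuousAt).continuousWithinAt
    have := (hφ.loc K hK hKb i).mul_continuousOn hc hK
    rw [integrableOn_iff_integrable_of_support_subset] at this
    · refine this.congr (ae_of_all _ fun x => ?_)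
      simp only [hpd]; ring
    · intro x hx
      by_contra h
      exact hx (by simp only; rw [edk_zero (hψ0 x h).le]; ring)
  have h2 : ∀ i, Integrable (fun x => ψ x * pd i (pd i V) x) volume := fun i =>
    (int_prod (u := pd i (pd i V)) hcs (fun x hx => (contDiffAt_pd (k := 0) (hV1 i x (hψK hx)) (by norm_num) i).continuousAt)
      fun x _ => hψc.continuousAt).congr (ae_of_all _ fun x => mul_comm _ _)
  have h3 : ∀ i, Integrable (fun x => ψ x * pd i V x) volume := fun i =>
    (int_prod (u := pd i V) hcs (fun x hx => (hV1 i x (hψK hx)).continuousAt)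
      fun x _ => hψc.continuousAt).congr (ae_of_all _ fun x => mul_comm _ _)
  have h4 : ∀ i, ∫ x, ψ x * pd i (pd i V) x = - ∫ x, pd i ψ x * pd i V x := fun i =>
    integral_mul_fderiv_eq_neg_fderiv_mul_of_integrable (h1 i) (h2 i) (h3 i) (fun x _ => hdiff x)
      (fun x hx => (hV1 i x (hψK hx)).differentiableAt (by norm_num))
  have e1 : (fun x => edk k (φ x) * gp φ V x) = fun x => ∑ i, pd i ψ x * pd i V x := by
    ext x; rw [gp, Finset.mul_sum]; exact Finset.sum_congr rfl fun i _ => by rw [hpd]; ring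
  have hz : ∀ x, 1 ≤ ‖x‖ → x ∉ K := fun x hx h => absurd (hKb' x h) (not_lt.2 hx)
  constructor
  · rw [e1]
    exact (integrable_finsetSum _ fun i _ => h1 i).mono_measure Measure.restrict_le_self
  · rw [int_mu_full fun x hx => by
      rw [etk_zero (hφ.nonneg x) (hψ0 x (hz x hx)).le, mul_zero], int_mu_full fun x hx => by
      rw [edk_zero (hψ0 x (hz x hx)).le, zero_mul], e1, integral_finsetSum _ fun i _ => h1 i]
    calc ∫ x, (- lap V x) * etk k (φ x) = ∫ x, - ∑ i, ψ x * pd i (pd i V) x := by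
          congr; ext x
          by_cases hx : x ∈ K
          · rw [lap_eq (hV x (hKb' x hx)), ← Finset.mul_sum]; simp only [ψ]; ring
          · rw [← Finset.mul_sum]; simp only [ψ]; rw [etk_zero (hφ.nonneg x) (hψ0 x hx).le]; ring
      _ = _ := by
          rw [integral_neg, integral_finsetSum _ fun i _ => h2 i, ← Finset.sum_neg_distrib]
          exact Finset.sum_congr rfl fun i _ => by rw [h4 i, neg_neg]

end Henon

namespace Henon
open Topology Metric
variable {N : ℕ}

lemma quad_le {A B I : ℝ} (hA : 0 ≤ A) (hB : 0 ≤ B) (h : ∀ t : ℝ, 0 < t → 2 * I * t ≤ A * t ^ 2 + B) : I ≤ √A * √B := by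
  rcases le_or_gt I 0 with hI | hI
  · exact hI.trans (by positivity)
  · have : ∀ t : ℝ, 0 ≤ A * (t * t) + (-(2 * I)) * t + B := fun t => by
      rcases lt_or_ge 0 t with ht | ht
      · nlinarith [h t ht]
      · nlinarith [mul_nonneg hA (sq_nonneg t), mul_nonneg hI.le (neg_nonneg.2 ht)]
    have hd := discrim_le_zero this
    unfold discrim at hd
    rw [← sqrt_mul hA]
    exact le_sqrt_of_sq_le (by nlinarith)

lemma fatou {μ : Measure (Euc N)} {F : ℕ → Fn N} {f : Fn N} {C : ℝ} (hF : ∀ k, Integrable (F k) μ) (h0 : ∀ k x, 0 ≤ F k x)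
    (hf : AEStronglyMeasurable f μ) (hlim : ∀ᵐ x ∂μ, Tendsto (fun k => F k x) atTop (𝓝 (f x))) (hC : ∀ k, ∫ x, F k x ∂μ ≤ C) :
    Integrable f μ ∧ ∫ x, f x ∂μ ≤ C := by
  have hf0 : 0 ≤ᵐ[μ] f := by
    filter_upwards [hlim] with x hx using ge_of_tendsto' hx fun k => h0 k x
  have hC0 : 0 ≤ C := (integral_nonneg (h0 0)).trans (hC 0)
  have key : ∫⁻ x, ENNReal.ofReal (f x) ∂μ ≤ ENNReal.ofReal C := by
    calc ∫⁻ x, ENNReal.ofReal (f x) ∂μ = ∫⁻ x, liminf (fun k => ENNReal.ofReal (F k x)) atTop ∂μ := by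
          refine lintegral_congr_ae ?_
          filter_upwards [hlim] with x hx
          exact ((ENNReal.tendsto_ofReal hx).liminf_eq).symm
      _ ≤ liminf (fun k => ∫⁻ x, ENNReal.ofReal (F k x) ∂μ) atTop :=
          lintegral_liminf_le' fun k => (hF k).1.aemeasurable.ennreal_ofReal
      _ ≤ ENNReal.ofReal C := by
          refine liminf_le_of_frequently_le' (Eventually.of_forall fun k => ?_).frequently
          rw [← ofReal_integral_eq_lintegral_ofReal (hF k) (ae_of_all _ (h0 k))]
          exact ENNReal.ofReal_le_ofReal (hC k)
  have hi : Integrable f μ := by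
    refine ⟨hf, ?_⟩
    rw [hasFiniteIntegral_iff_ofReal hf0]
    exact key.trans_lt ENNReal.ofReal_lt_top
  refine ⟨hi, ?_⟩
  rw [← ofReal_integral_eq_lintegral_ofReal hi hf0] at key
  exact (ENNReal.ofReal_le_ofReal_iff hC0).1 key

def An (u : Fn N) : ℝ := ∫ x, gp u u x ∂(mu N)

lemma An_nonneg (u : Fn N) : 0 ≤ An u := integral_nonneg (gp_self_nonneg u)

lemma meas_gp (u v : Fn N) : Measurable (gp u v) :=
  Finset.measurable_fun_sum _ fun i _ => (meas_pd i u).mul (meas_pd i v)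

lemma gp_young (u v : Fn N) (x : Euc N) (t : ℝ) : 2 * |gp u v x| * t ≤ gp u u x * t ^ 2 + gp v v x := by
  have h : ∀ s : ℝ, 2 * gp u v x * s ≤ gp u u x * s ^ 2 + gp v v x := fun s => by
    unfold gp
    simp only [Finset.mul_sum, Finset.sum_mul, ← Finset.sum_add_distrib]
    exact Finset.sum_le_sum fun i _ => by nlinarith [sq_nonneg (pd i u x * s - pd i v x)]
  rcases abs_cases (gp u v x) with ⟨e, -⟩ | ⟨e, -⟩ <;> rw [e]
  · exact h t
  · have := h (-t); nlinarith

lemma int_gp {u v : Fn N} (hu : Integrable (gp u u) (mu N)) (hv : Integrable (gp v v) (mu N)) :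
    Integrable (gp u v) (mu N) := by
  refine (hu.add hv).mono' (meas_gp u v).aestronglyMeasurable (ae_of_all _ fun x => ?_)
  have := gp_young u v x 1
  simp only [Pi.add_apply, norm_eq_abs]
  nlinarith [abs_nonneg (gp u v x)]

lemma gp_cs {u v c : Fn N} (hu : Integrable (gp u u) (mu N)) (hv : Integrable (gp v v) (mu N)) 
    (hc : ∀ x, |c x| ≤ 1) : ∫ x, c x * gp u v x ∂(mu N) ≤ √(An u) * √(An v) := by
  refine quad_le (An_nonneg u) (An_nonneg v) fun t ht => ?_
  have h1 : ∫ x, c x * gp u v x ∂(mu N) ≤ ∫ x, |gp u v x| ∂(mu N) := by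
    refine (le_abs_self _).trans ((abs_integral_le_integral_abs).trans ?_)
    refine integral_mono_of_nonneg (ae_of_all _ fun x => abs_nonneg _) (int_gp hu hv).abs (ae_of_all _ fun x => ?_)
    simp only [abs_mul]
    exact mul_le_of_le_one_left (abs_nonneg _) (hc x)
  have h2 : ∫ x, 2 * t * |gp u v x| ∂(mu N) ≤ ∫ x, (t ^ 2 * gp u u x + gp v v x) ∂(mu N) :=
    integral_mono ((int_gp hu hv).abs.const_mul _) ((hu.const_mul _).add hv) fun x => by
      have := gp_young u v x t; simp only; linarith
  rw [integral_const_mul, integral_add (hu.const_mul _) hv, integral_const_mul] at h2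
  unfold An
  nlinarith

lemma gp_zero_of_min {φ : Fn N} (h : ∀ x, 0 ≤ φ x) {x : Euc N} (hx : φ x = 0) (v : Fn N) : gp φ v x = 0 := by
  have : fderiv ℝ φ x = 0 := IsLocalMin.fderiv_eq_zero (Eventually.of_forall fun y => by rw [hx]; exact h y)
  simp [gp, pd, this]

lemma grad_energy {V f : Fn N} (hV : H10' V) (hV2 : ∀ x : Euc N, ‖x‖ < 1 → ContDiffAt ℝ 2 V x) (hf : Continuous f)
    (hf0 : ∀ x : Euc N, ‖x‖ < 1 → 0 ≤ f x) (hE : ∀ x : Euc N, ‖x‖ < 1 → - lap V x = f x) :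
    Integrable (gp V V) (mu N) ∧ An V ≤ ∫ x, f x * V x ∂(mu N) := by
  refine fatou (F := fun k x => edk k (V x) * gp V V x) (fun k => (energy_ibp hV hV2 k).1)
    (fun k x => mul_nonneg (edk_nonneg _ _) (gp_self_nonneg V x)) (meas_gp V V).aestronglyMeasurable
    (ae_of_all _ fun x => ?_) fun k => ?_
  · rcases (hV.nonneg x).eq_or_lt with h | h
    · simp [gp_zero_of_min hV.nonneg h.symm]
    · simpa using (edk_tendsto h).mul_const (gp V V x)
  · rw [← (energy_ibp hV hV2 k).2]
    refine integral_mono_ae ?_ (int_cont (hf.mul hV.cont)) (ae_mu fun x hx => ?_)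
    · refine (int_cont (hf.mul ((cont_etk k).comp hV.cont))).congr (ae_mu fun x hx => ?_)
      simp [hE x hx]
    · simp only [hE x hx]
      exact mul_le_mul_of_nonneg_left (etk_le k (hV.nonneg x)) (hf0 x hx)

lemma weak_le {V f φ : Fn N} (hφ : H10' φ) (hφi : Integrable (gp φ φ) (mu N)) 
    (hV2 : ∀ x : Euc N, ‖x‖ < 1 → ContDiffAt ℝ 2 V x) (hVi : Integrable (gp V V) (mu N)) (hf : Continuous f)
    (hE : ∀ x : Euc N, ‖x‖ < 1 → - lap V x = f x) :
    ∫ x, f x * φ x ∂(mu N) ≤ √(An φ) * √(An V) := by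
  have h1 : Tendsto (fun k => ∫ x, f x * etk k (φ x) ∂(mu N)) atTop (𝓝 (∫ x, f x * φ x ∂(mu N))) := by
    refine tendsto_integral_of_dominated_convergence (fun x => |f x * φ x|)
      (fun k => (hf.mul ((cont_etk k).comp hφ.cont)).aestronglyMeasurable) (int_cont (hf.mul hφ.cont)).abs (fun k => ae_of_all _ fun x => ?_)
      (ae_of_all _ fun x => (etk_tendsto (hφ.nonneg x)).const_mul _)
    rw [norm_eq_abs, abs_mul, abs_mul, abs_of_nonneg (etk_nonneg k (hφ.nonneg x)), abs_of_nonneg (hφ.nonneg x)]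
    exact mul_le_mul_of_nonneg_left (etk_le k (hφ.nonneg x)) (abs_nonneg _)
  refine le_of_tendsto' h1 fun k => ?_
  have : ∫ x, f x * etk k (φ x) ∂(mu N) = ∫ x, (- lap V x) * etk k (φ x) ∂(mu N) :=
    integral_congr_ae (ae_mu fun x hx => by simp only [hE x hx])
  rw [this, (energy_ibp hφ hV2 k).2]
  exact gp_cs hφi hVi fun x => by rw [abs_of_nonneg (edk_nonneg _ _)]; exact edk_le _ _

/-- bounded pointwise convergence -/
structure BC (F : ℕ → Fn N) (f : Fn N) (M : ℝ) : Prop where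
  cont : ∀ k, Continuous (F k)
  contf : Continuous f
  bdd : ∀ k (y : Euc N), ‖y‖ < 1 → |F k y| ≤ M
  lim : ∀ y : Euc N, y ≠ 0 → ‖y‖ < 1 → Tendsto (fun k => F k y) atTop (𝓝 (f y))

lemma BC.const {f : Fn N} (hf : Continuous f) : ∃ M, BC (fun _ => f) f M := by
  obtain ⟨M, -, hM⟩ := bdd_of_cont hf 1
  exact ⟨M, fun _ => hf, hf, fun _ y hy => hM y (by simpa using hy.le), fun _ _ _ => tendsto_const_nhds⟩

lemma BC.Gop {m : ℕ} (hN : N = 2 * m + 2) {F : ℕ → Fn N} {f : Fn N} {M : ℝ} (h : BC F f M) (x : Euc N) :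
    Tendsto (fun k => Gop m (F k) x) atTop (𝓝 (Gop m f x)) := by
  refine Tendsto.const_mul _ (tendsto_integral_of_dominated_convergence (fun y => gk m x y * M)
    (fun k => (int_gk_mul hN x (h.cont k)).1) ((int_gk hN x).mul_const M) (fun k => ae_mu fun y hy => ?_) ?_)
  · rw [norm_mul, norm_of_nonneg (gk_nonneg m x y)]
    exact mul_le_mul_of_nonneg_left (h.bdd k y hy) (gk_nonneg m x y)
  · filter_upwards [ae_ne hN 0, ae_mu (N := N) (P := fun y => ‖y‖ < 1) fun y hy => hy] with y h0 hy
    exact (h.lim y h0.symm hy).const_mul _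

lemma Gop_abs_le {m : ℕ} (hN : N = 2 * m + 2) (hm : 1 ≤ m) {f : Fn N} (hf : Continuous f) {M : ℝ}
    (hM : ∀ y : Euc N, ‖y‖ < 1 → |f y| ≤ M) (x : Euc N) : |Gop m f x| ≤ M * Gop m (fun _ => 1) x := by
  rw [← Gop_smul, abs_le]
  constructor
  · have := Gop_mono hN hm (f := fun y => (-1) * (M * 1)) (g := f) (by fun_prop) hf (fun y hy => by linarith [abs_le.1 (hM y hy)]) x
    rw [Gop_smul] at this; linarith
  · exact Gop_mono hN hm hf (by fun_prop) (fun y hy => by linarith [abs_le.1 (hM y hy)]) x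

lemma BC.Gop' {m : ℕ} (hN : N = 2 * m + 2) (hm : 1 ≤ m) {F : ℕ → Fn N} {f : Fn N} {M : ℝ} (h : BC F f M) :
    ∃ M', BC (fun k => Henon.Gop m (F k)) (Henon.Gop m f) M' := by
  obtain ⟨C, hC0, hC⟩ := bdd_of_cont (Gop_cont hN hm (f := fun _ : Euc N => (1:ℝ)) (by fun_prop)) 1
  refine ⟨M * C, fun k => Gop_cont hN hm (h.cont k), Gop_cont hN hm h.contf, fun k y hy => ?_, fun y _ hy => h.Gop hN y⟩
  have hM : 0 ≤ M := (abs_nonneg _).trans (h.bdd 0 0 (by simp))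
  exact (Gop_abs_le hN hm (h.cont k) (h.bdd k) y).trans
    (mul_le_mul_of_nonneg_left ((le_abs_self _).trans (hC y (by simpa using hy.le))) hM)

lemma BC.int_mul {m : ℕ} (hN : N = 2 * m + 2) {F H : ℕ → Fn N} {f h : Fn N} {M M' : ℝ} (hF : BC F f M) (hH : BC H h M') :
    Tendsto (fun k => ∫ x, F k x * H k x ∂(mu N)) atTop (𝓝 (∫ x, f x * h x ∂(mu N))) := by
  refine tendsto_integral_of_dominated_convergence (fun y => M * M')
    (fun k => ((hF.cont k).mul (hH.cont k)).aestronglyMeasurable) (integrable_const _) (fun k => ae_mu fun y hy => ?_) ?_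
  · rw [norm_mul]
    exact mul_le_mul (hF.bdd k y hy) (hH.bdd k y hy) (norm_nonneg _) ((abs_nonneg _).trans (hF.bdd k y hy))
  · filter_upwards [ae_ne hN 0, ae_mu (N := N) (P := fun y => ‖y‖ < 1) fun y hy => hy] with y h0 hy
    exact (hF.lim y h0.symm hy).mul (hH.lim y h0.symm hy)

lemma smooth_approx {f : Fn N} (hf : Continuous f) (hf0 : ∀ x, 0 ≤ f x) :
    ∃ F : ℕ → Fn N, (∀ k, ContDiff ℝ 1 (F k)) ∧ (∀ k x, 0 ≤ F k x) ∧ ∃ M, BC F f M := by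
  let χ : ContDiffBump (0 : Euc N) := ⟨1, 2, by norm_num, by norm_num⟩
  have hu : UniformContinuous (fun x => χ x * f x) :=
    HasCompactSupport.uniformContinuous_of_continuous χ.hasCompactSupport.mul_right (χ.continuous.mul hf)
  choose g hg hgd using fun k => hu.exists_contDiff_dist_le (ek_pos k)
  obtain ⟨M, -, hM⟩ := bdd_of_cont hf 1
  have hd : ∀ k (x : Euc N), ‖x‖ < 1 → |g k x - f x| ≤ ek k := fun k x hx => by
    have := hgd k x
    rw [χ.one_of_mem_closedBall (by simpa using hx.le), one_mul, dist_eq] at this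
    exact this.le
  have hek : ∀ k, ek k ≤ 1 := fun k => by
    unfold ek; rw [div_le_one (by positivity)]; linarith [(Nat.cast_nonneg k : (0:ℝ) ≤ k)]
  refine ⟨fun k x => g k x + ek k, fun k => ((contDiff_infty.1 (hg k) 1).add contDiff_const), fun k x => ?_, M + 2, fun k => ?_, hf, fun k x hx => ?_,
    fun x _ hx => ?_⟩
  · have := hgd k x
    rw [dist_eq] at this
    linarith [(abs_le.1 this.le).1, mul_nonneg (χ.nonneg (x := x)) (hf0 x)]
  · exact (hg k).continuous.add continuous_const
  · have h1 := abs_le.1 (hd k x hx)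
    have h2 := abs_le.1 (hM x (by simpa using hx.le))
    rw [abs_le]; constructor <;> linarith [hek k, ek_pos k]
  · have h1 : Tendsto (fun k => g k x - f x) atTop (𝓝 0) := squeeze_zero_norm (fun k => hd k x hx) ek_tendsto
    have := (h1.add ek_tendsto).add_const (f x)
    simp only [zero_add] at this
    exact this.congr fun k => by ring

end Henon

namespace Henon
open Topology Metric
variable {N : ℕ}

def Jf (m : ℕ) (f : Fn N) : ℝ := ∫ x, f x * Gop m f x ∂(mu N)

lemma H10'_Gop {m : ℕ} (hN : N = 2 * m + 2) (hm : 1 ≤ m) {f : Fn N} (hf : Continuous f) (hf0 : ∀ x, 0 ≤ f x) : H10' (Gop m f) where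
  cont := Gop_cont hN hm hf
  diff := fun x hx => (contDiffAt_Gop_one hN hf hx).differentiableAt (by norm_num)
  zero := fun x hx => Gop_zero f hx
  nonneg := Gop_nonneg hN hm fun y _ => hf0 y
  loc := fun K hK hKb i => ContinuousOn.integrableOn_compact hK fun x hx =>
    (contDiffAt_pd (k := 0) (contDiffAt_Gop_one hN hf (by simpa using hKb hx)) (by norm_num) i).continuousAt.continuousWithinAt


lemma Jf_nonneg {m : ℕ} (hN : N = 2 * m + 2) (hm : 1 ≤ m) {f : Fn N} (hf0 : ∀ x, 0 ≤ f x) : 0 ≤ Jf m f :=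
  integral_nonneg fun x => mul_nonneg (hf0 x) (Gop_nonneg hN hm (fun y _ => hf0 y) x)

lemma An_Gop_le {m : ℕ} (hN : N = 2 * m + 2) (hm : 1 ≤ m) {f : Fn N} (hf : Continuous f) (hf0 : ∀ x, 0 ≤ f x) 
    (h2 : ∀ x : Euc N, ‖x‖ < 1 → ContDiffAt ℝ 2 (Gop m f) x) : Integrable (gp (Gop m f) (Gop m f)) (mu N) ∧ An (Gop m f) ≤ Jf m f :=
  grad_energy (H10'_Gop hN hm hf hf0) h2 hf (fun x _ => hf0 x) (fun x hx => neg_lap_Gop hN hm hf hx (h2 x hx))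

/-- (i) -/
lemma dual_le {m : ℕ} (hN : N = 2 * m + 2) (hm : 1 ≤ m) {f : Fn N} (hf : Continuous f) (hf0 : ∀ x, 0 ≤ f x) 
    {φ : Fn N} (hφ : H10' φ) (hφi : Integrable (gp φ φ) (mu N)) :
    ∫ x, f x * φ x ∂(mu N) ≤ √(An φ) * √(Jf m f) := by
  obtain ⟨F, hF, hF0, M, hB⟩ := smooth_approx hf hf0
  obtain ⟨M1, hB1⟩ := hB.Gop' hN hm
  obtain ⟨M2, hB2⟩ := BC.const hφ.cont
  have h1 := hB.int_mul hN hB2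
  have h2 : Tendsto (fun k => √(An φ) * √(Jf m (F k))) atTop (𝓝 (√(An φ) * √(Jf m f))) :=
    ((continuous_sqrt.tendsto _).comp (hB.int_mul hN hB1)).const_mul _
  refine le_of_tendsto_of_tendsto' h1 h2 fun k => ?_
  have h3 : ∀ x : Euc N, ‖x‖ < 1 → ContDiffAt ℝ 2 (Gop m (F k)) x := fun x hx =>
    contDiffAt_Gop_two hN (hF k).continuous hx (hF k).contDiffAt
  have h4 := An_Gop_le hN hm (hF k).continuous (hF0 k) h3
  refine (weak_le hφ hφi h3 h4.1 (hF k).continuous fun x hx => neg_lap_Gop hN hm (hF k).continuous hx (h3 x hx)).trans ?_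
  exact mul_le_mul_of_nonneg_left (sqrt_le_sqrt h4.2) (sqrt_nonneg _)

/-- (iii) -/
lemma Jf_cs {m : ℕ} (hN : N = 2 * m + 2) (hm : 1 ≤ m) {f : Fn N} (hf : Continuous f) (hf0 : ∀ x, 0 ≤ f x) 
    {h : Fn N} (hh : Continuous h) (hh0 : ∀ x, 0 ≤ h x) :
    ∫ x, h x * Gop m f x ∂(mu N) ≤ √(Jf m f) * √(Jf m h) := by
  obtain ⟨F, hF, hF0, M, hB⟩ := smooth_approx hf hf0
  obtain ⟨M1, hB1⟩ := hB.Gop' hN hm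
  obtain ⟨M2, hB2⟩ := BC.const hh
  have h1 := hB2.int_mul hN hB1
  have h2 : Tendsto (fun k => √(Jf m (F k)) * √(Jf m h)) atTop (𝓝 (√(Jf m f) * √(Jf m h))) :=
    ((continuous_sqrt.tendsto _).comp (hB.int_mul hN hB1)).mul_const _
  refine le_of_tendsto_of_tendsto' h1 h2 fun k => ?_
  have h3 : ∀ x : Euc N, ‖x‖ < 1 → ContDiffAt ℝ 2 (Gop m (F k)) x := fun x hx =>
    contDiffAt_Gop_two hN (hF k).continuous hx (hF k).contDiffAt
  have h4 := An_Gop_le hN hm (hF k).continuous (hF0 k) h3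
  refine (dual_le hN hm hh hh0 (H10'_Gop hN hm (hF k).continuous (hF0 k)) h4.1).trans ?_
  exact mul_le_mul_of_nonneg_right (sqrt_le_sqrt h4.2) (sqrt_nonneg _)

/-- (ii) -/
lemma An_eq {m : ℕ} (hN : N = 2 * m + 2) (hm : 1 ≤ m) {f : Fn N} (hf : Continuous f) (hf0 : ∀ x, 0 ≤ f x) 
    (h2 : ∀ x : Euc N, ‖x‖ < 1 → ContDiffAt ℝ 2 (Gop m f) x) : An (Gop m f) = Jf m f := by
  obtain ⟨h3, h4⟩ := An_Gop_le hN hm hf hf0 h2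
  refine le_antisymm h4 ?_
  have h5 : Jf m f ≤ _ := dual_le hN hm hf hf0 (H10'_Gop hN hm hf hf0) h3
  have hJ := Jf_nonneg hN hm hf0
  have hA := An_nonneg (Gop m f)
  rw [← sqrt_mul hA] at h5
  have := sq_sqrt (mul_nonneg hA hJ)
  rcases hJ.eq_or_lt with e | e
  · rw [← e]; exact hA
  · have h6 := pow_le_pow_left₀ hJ h5 2
    rw [this] at h6
    nlinarith

end Henon

namespace Henon
open Topology Metric
variable {N : ℕ}

def sg (n : ℕ) (j : Fin N) : ℝ := if (j : ℕ) < n then 1 else -1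
def tau (n : ℕ) (j : Fin N) : Fin N := ⟨(j + n) % N, Nat.mod_lt _ j.pos⟩
def qf (n : ℕ) (x : Euc N) : ℝ := ∑ j, sg n j * x j ^ 2
def bf (n : ℕ) (x : Euc N) : ℝ := ∑ j, x j * x (tau n j)
def JL (n : ℕ) : Euc N →ₗ[ℝ] Euc N where
  toFun x := WithLp.toLp 2 fun j => - (sg n j * x (tau n j))
  map_add' x y := by ext j; simp; ring
  map_smul' c x := by ext j; simp; ring

lemma JL_apply (n : ℕ) (x : Euc N) (j : Fin N) : JL n x j = - (sg n j * x (tau n j)) := rfl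

lemma tau_tau {n : ℕ} (hN : N = 2 * n) (j : Fin N) : tau n (tau n j) = j := by
  ext
  have := j.2
  simp only [tau]
  rcases lt_or_ge (j : ℕ) n with h | h
  · rw [Nat.mod_eq_of_lt (a := j + n) (by omega), show (j : ℕ) + n + n = j + N by omega, Nat.add_mod_right, Nat.mod_eq_of_lt this]
  · rw [show (j : ℕ) + n = (j - n) + N by omega, Nat.add_mod_right, Nat.mod_eq_of_lt (a := j - n) (by omega),
      show (j : ℕ) - n + n = j by omega, Nat.mod_eq_of_lt this]

lemma sg_tau {n : ℕ} (hN : N = 2 * n) (j : Fin N) : sg n (tau n j) = - sg n j := by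
  have := j.2
  rcases lt_or_ge (j : ℕ) n with h | h
  · have e : ((tau n j : Fin N) : ℕ) = j + n := Nat.mod_eq_of_lt (a := j + n) (by omega)
    unfold sg; rw [if_neg (by rw [e]; omega), if_pos h]
  · have e : ((tau n j : Fin N) : ℕ) = j - n := by
      change (j + n) % N = _
      rw [show (j : ℕ) + n = (j - n) + N by omega, Nat.add_mod_right, Nat.mod_eq_of_lt (a := j - n) (by omega)]
    unfold sg; rw [if_pos (by rw [e]; omega), if_neg (by omega)]; ring

lemma sg_sq (n : ℕ) (j : Fin N) : sg n j ^ 2 = 1 := by unfold sg; split_ifs <;> norm_num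

lemma sum_tau {n : ℕ} (hN : N = 2 * n) (g : Fin N → ℝ) : ∑ j, g (tau n j) = ∑ j, g j :=
  Equiv.sum_comp (Function.Involutive.toPerm (tau n) (tau_tau hN)) g

lemma rot_sum {n : ℕ} (x : Euc N) (c s : ℝ) (w : Fin N → ℝ) :
    ∑ j, w j * (c • x + s • JL n x) j ^ 2 = c ^ 2 * ∑ j, w j * x j ^ 2 - 2 * c * s * ∑ j, w j * sg n j * (x j * x (tau n j))
      + s ^ 2 * ∑ j, w j * x (tau n j) ^ 2 := by
  simp only [Finset.mul_sum, ← Finset.sum_add_distrib, ← Finset.sum_sub_distrib]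
  refine Finset.sum_congr rfl fun j _ => ?_
  have := sg_sq n j
  simp only [PiLp.add_apply, PiLp.smul_apply, smul_eq_mul, JL_apply]
  linear_combination (w j * s ^ 2 * x (tau n j) ^ 2) * this

lemma sum_sg_tau {n : ℕ} (hN : N = 2 * n) (g : Fin N → ℝ) : ∑ j, sg n j * g (tau n j) = - ∑ j, sg n j * g j := by
  rw [← sum_tau hN, ← Finset.sum_neg_distrib]
  exact Finset.sum_congr rfl fun j _ => by rw [tau_tau hN, sg_tau hN]; ring

lemma norm_rot {n : ℕ} (hN : N = 2 * n) (x : Euc N) {c s : ℝ} (h : c ^ 2 + s ^ 2 = 1) : ‖c • x + s • JL n x‖ = ‖x‖ := by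
  have h1 := rot_sum (n := n) x c s (fun _ => 1)
  have h2 : ∑ j, sg n j * (x j * x (tau n j)) = 0 := by
    have := sum_sg_tau hN (fun j => x j * x (tau n j))
    simp only [tau_tau hN] at this
    simp only [mul_comm (x (tau n _)) (x _)] at this
    linarith
  simp only [one_mul, h2] at h1
  rw [sum_tau hN (fun j => x j ^ 2), ← EuclideanSpace.real_norm_sq_eq, ← EuclideanSpace.real_norm_sq_eq] at h1
  have : ‖c • x + s • JL n x‖ ^ 2 = ‖x‖ ^ 2 := by rw [h1]; linear_combination ‖x‖ ^ 2 * h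
  exact (pow_left_inj₀ (norm_nonneg _) (norm_nonneg _) two_ne_zero).1 this

lemma qf_rot {n : ℕ} (hN : N = 2 * n) (x : Euc N) (c s : ℝ) :
    qf n (c • x + s • JL n x) = (c ^ 2 - s ^ 2) * qf n x - 2 * c * s * bf n x := by
  unfold qf bf
  rw [rot_sum x c s (sg n), sum_sg_tau hN fun j => x j ^ 2]
  have : ∑ j, sg n j * sg n j * (x j * x (tau n j)) = ∑ j, x j * x (tau n j) :=
    Finset.sum_congr rfl fun j _ => by rw [← sq, sg_sq, one_mul]
  rw [this]; ring

lemma bf_rot {n : ℕ} (hN : N = 2 * n) (x : Euc N) (c s : ℝ) :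
    bf n (c • x + s • JL n x) = (c ^ 2 - s ^ 2) * bf n x + 2 * c * s * qf n x := by
  have e : bf n (c • x + s • JL n x) = c ^ 2 * bf n x - s ^ 2 * bf n x + c * s * ∑ j, sg n j * x j ^ 2
      - c * s * ∑ j, sg n j * x (tau n j) ^ 2 := by
    unfold bf
    simp only [Finset.mul_sum, ← Finset.sum_add_distrib, ← Finset.sum_sub_distrib]
    refine Finset.sum_congr rfl fun j _ => ?_
    have := sg_sq n j
    simp only [PiLp.add_apply, PiLp.smul_apply, smul_eq_mul, JL_apply, tau_tau hN, sg_tau hN]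
    linear_combination - (s ^ 2 * x j * x (tau n j)) * this
  rw [e, sum_sg_tau hN fun j => x j ^ 2]
  unfold qf; ring

/-- rotation isometry -/
def rotL' {n : ℕ} (hN : N = 2 * n) (t : ℝ) : Euc N →ₗᵢ[ℝ] Euc N where
  toLinearMap := cos t • LinearMap.id + sin t • JL n
  norm_map' x := by
    rw [LinearMap.add_apply, LinearMap.smul_apply, LinearMap.smul_apply, LinearMap.id_apply]
    exact norm_rot hN x (cos_sq_add_sin_sq t)

def rotL {n : ℕ} (hN : N = 2 * n) (t : ℝ) : Euc N ≃ₗᵢ[ℝ] Euc N :=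
  LinearIsometry.toLinearIsometryEquiv (rotL' hN t) rfl

lemma rotL_apply {n : ℕ} (hN : N = 2 * n) (t : ℝ) (x : Euc N) : rotL hN t x = cos t • x + sin t • JL n x := by
  unfold rotL
  rw [LinearIsometry.toLinearIsometryEquiv_apply]
  rfl

lemma qf_rotL {n : ℕ} (hN : N = 2 * n) (t : ℝ) (x : Euc N) :
    qf n (rotL hN t x) = cos (2 * t) * qf n x - sin (2 * t) * bf n x := by
  rw [rotL_apply, qf_rot hN, cos_two_mul', sin_two_mul]; ring

lemma bf_rotL {n : ℕ} (hN : N = 2 * n) (t : ℝ) (x : Euc N) :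
    bf n (rotL hN t x) = cos (2 * t) * bf n x + sin (2 * t) * qf n x := by
  rw [rotL_apply, bf_rot hN, cos_two_mul', sin_two_mul]; ring

lemma cont_qf (n : ℕ) : Continuous (qf n : Fn N) := by unfold qf; fun_prop
lemma cont_bf (n : ℕ) : Continuous (bf n : Fn N) := by unfold bf; fun_prop

/-- `q` and the splitting -/
def SL (n : ℕ) : Euc N →ₗ[ℝ] Euc N where
  toFun x := WithLp.toLp 2 fun j => sg n j * x j
  map_add' x y := by ext j; simp; ring
  map_smul' c x := by ext j; simp; ring

lemma SL_apply (n : ℕ) (x : Euc N) (j : Fin N) : SL n x j = sg n j * x j := rfl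
lemma SL_SL (n : ℕ) (x : Euc N) : SL n (SL n x) = x := by
  ext j; rw [SL_apply, SL_apply, ← mul_assoc, ← sq, sg_sq, one_mul]
lemma norm_SL (n : ℕ) (x : Euc N) : ‖SL n x‖ = ‖x‖ := by
  rw [EuclideanSpace.norm_eq, EuclideanSpace.norm_eq]
  simp [SL_apply, mul_pow, sg_sq]
lemma qf_eq_inner (n : ℕ) (x : Euc N) : qf n x = inner ℝ x (SL n x) := by
  simp [qf, PiLp.inner_apply, SL_apply]
  exact Finset.sum_congr rfl fun j _ => by ring
lemma inner_SL (n : ℕ) (x y : Euc N) : inner ℝ (SL n x) y = inner ℝ x (SL n y) := by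
  simp [PiLp.inner_apply, SL_apply]
  exact Finset.sum_congr rfl fun j _ => by ring

lemma qf_refl {n : ℕ} {v : Euc N} {e : ℝ} (hv : SL n v = e • v) (z : Euc N) :
    qf n ((ℝ ∙ v)ᗮ.reflection z) = qf n z := by
  have h1 : ∃ c : ℝ, (ℝ ∙ v)ᗮ.reflection z = z + c • v := by
    refine ⟨-(2 * (inner ℝ v z / ((‖v‖ : ℝ) ^ 2))), ?_⟩
    rw [Submodule.reflection_orthogonal_apply, Submodule.reflection_singleton_apply]
    simp only [RCLike.ofReal_real_eq_id, id, two_smul, neg_smul, two_mul, add_smul]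
    abel
  obtain ⟨c, hc⟩ := h1
  have h2 : ‖z + c • v‖ ^ 2 = ‖z‖ ^ 2 := by rw [← hc, LinearIsometryEquiv.norm_map]
  rw [hc, qf_eq_inner, qf_eq_inner, map_add, map_smul, hv]
  rw [norm_add_sq_real, norm_smul, real_inner_smul_right, mul_pow] at h2
  simp only [inner_add_left, inner_add_right, real_inner_smul_left, real_inner_smul_right, ← inner_SL, hv, real_inner_self_eq_norm_sq,
    real_inner_comm v z]
  rw [norm_eq_abs, sq_abs] at h2
  rw [real_inner_comm v z] at h2
  linear_combination e * h2

/-- transitivity: same norm and same `q` -/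
lemma exists_isom {n : ℕ} {x y : Euc N} (h1 : ‖x‖ = ‖y‖) (h2 : qf n x = qf n y) :
    ∃ R : Euc N ≃ₗᵢ[ℝ] Euc N, R x = y ∧ ∀ z, qf n (R z) = qf n z := by
  let a := (1/2:ℝ) • (x + SL n x)
  let b := (1/2:ℝ) • (x - SL n x)
  let a' := (1/2:ℝ) • (y + SL n y)
  let b' := (1/2:ℝ) • (y - SL n y)
  have hn : ∀ z : Euc N, ‖(1/2:ℝ) • (z + SL n z)‖ ^ 2 = (‖z‖ ^ 2 + qf n z) / 2 := fun z => by
    rw [norm_smul, mul_pow, norm_add_sq_real, norm_SL, ← qf_eq_inner]; norm_num; ring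
  have hn' : ∀ z : Euc N, ‖(1/2:ℝ) • (z - SL n z)‖ ^ 2 = (‖z‖ ^ 2 - qf n z) / 2 := fun z => by
    rw [norm_smul, mul_pow, norm_sub_sq_real, norm_SL, ← qf_eq_inner]; norm_num; ring
  have ha : ‖a‖ = ‖a'‖ := (pow_left_inj₀ (norm_nonneg _) (norm_nonneg _) two_ne_zero).1 (by rw [hn, hn, h1, h2])
  have hb : ‖b‖ = ‖b'‖ := (pow_left_inj₀ (norm_nonneg _) (norm_nonneg _) two_ne_zero).1 (by rw [hn', hn', h1, h2])
  have hx : x = a + b := by simp only [a, b]; module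
  have hy : y = a' + b' := by simp only [a', b']; module
  have hSa : ∀ z : Euc N, SL n ((1/2:ℝ) • (z + SL n z)) = (1/2:ℝ) • (z + SL n z) := fun z => by
    rw [map_smul, map_add, SL_SL, add_comm]
  have hSb : ∀ z : Euc N, SL n ((1/2:ℝ) • (z - SL n z)) = - ((1/2:ℝ) • (z - SL n z)) := fun z => by
    rw [map_smul, map_sub, SL_SL]; module
  have hva : SL n (a - a') = (1:ℝ) • (a - a') := by rw [map_sub, hSa, hSa, one_smul]
  have hvb : SL n (b - b') = (-1:ℝ) • (b - b') := by rw [map_sub, hSb, hSb]; module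
  have horth : ∀ u v : Euc N, SL n u = u → SL n v = -v → inner ℝ u v = 0 := fun u v hu hv => by
    have := inner_SL n u v
    rw [hu, hv, inner_neg_right] at this; linarith
  have r1 : (ℝ ∙ (a - a'))ᗮ.reflection b = b := by
    rw [Submodule.reflection_eq_self_iff, Submodule.mem_orthogonal_singleton_iff_inner_right]
    exact horth _ _ (by simpa using hva) (hSb x)
  have r2 : (ℝ ∙ (b - b'))ᗮ.reflection a' = a' := by
    rw [Submodule.reflection_eq_self_iff, Submodule.mem_orthogonal_singleton_iff_inner_right, real_inner_comm]
    exact horth _ _ (hSa y) (by simpa using hvb)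
  refine ⟨((ℝ ∙ (a - a'))ᗮ.reflection).trans ((ℝ ∙ (b - b'))ᗮ.reflection), ?_, fun z => ?_⟩
  · rw [LinearIsometryEquiv.trans_apply, hx, map_add, Submodule.reflection_sub ha, r1, map_add, r2, Submodule.reflection_sub hb, hy]
  · rw [LinearIsometryEquiv.trans_apply, qf_refl hvb, qf_refl hva]

end Henon

namespace Henon
open Topology Metric
variable {N : ℕ}

lemma lap_nonneg_of_min {W : Fn N} {x : Euc N} (h : ContDiffAt ℝ 2 W x) (hmin : IsLocalMin W x) : 0 ≤ lap W x := by
  rw [lap_eq h]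
  refine Finset.sum_nonneg fun i _ => ?_
  by_contra! hneg
  let l : ℝ → Euc N := fun t => x + t • ei i
  have hl : ∀ t, HasDerivAt l (ei i) t := fun t => by
    have := ((hasDerivAt_id t).smul_const (ei i : Euc N)).const_add x
    rwa [one_smul] at this
  have hlc : Continuous l := by fun_prop
  have l0 : l 0 = x := by simp [l]
  have hd : ∀ᶠ t in 𝓝 (0:ℝ), HasDerivAt (W ∘ l) (pd i W (l t)) t := by
    have : ∀ᶠ y in 𝓝 (l 0), ContDiffAt ℝ 2 W y := by rw [l0]; exact h.eventually (by simp)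
    filter_upwards [hlc.continuousAt.eventually this] with t ht
    exact (ht.differentiableAt (by norm_num)).hasFDerivAt.comp_hasDerivAt t (hl t)
  have hd1 : deriv (W ∘ l) =ᶠ[𝓝 0] fun t => pd i W (l t) := hd.mono fun t ht => ht.deriv
  have hdd : deriv (deriv (W ∘ l)) 0 = pd i (pd i W) x := by
    rw [hd1.deriv_eq]
    have h1 : DifferentiableAt ℝ (pd i W) (l 0) := by
      rw [l0]; exact (contDiffAt_pd (k := 1) h (by norm_num) i).differentiableAt (by norm_num)
    have := h1.hasFDerivAt.comp_hasDerivAt (0:ℝ) (hl 0)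
    rw [l0] at this
    exact this.deriv
  have hm : IsLocalMin (W ∘ l) 0 := by
    have := hlc.continuousAt.eventually (by rw [l0]; exact hmin : ∀ᶠ y in 𝓝 (l 0), W x ≤ W y)
    filter_upwards [this] with t ht
    simpa [l0] using ht
  have hM : IsLocalMax (W ∘ l) 0 := isLocalMax_of_deriv_deriv_neg (by rw [hdd]; exact hneg) hm.deriv_eq_zero
    hd.self_of_nhds.continuousAt
  have hc : (W ∘ l) =ᶠ[𝓝 0] fun _ => (W ∘ l) 0 := by
    filter_upwards [hm, hM] with t a b using le_antisymm b a
  have : deriv (deriv (W ∘ l)) 0 = 0 := by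
    rw [hc.deriv.deriv_eq]; simp
  rw [hdd] at this; linarith

/-- uniform smooth approximation on the ball -/
lemma unif_approx {f : Fn N} (hf : Continuous f) {ε : ℝ} (hε : 0 < ε) :
    ∃ F : Fn N, ContDiff ℝ 1 F ∧ ∀ x, ‖x‖ ≤ 1 → |F x - f x| ≤ ε := by
  let χ : ContDiffBump (0 : Euc N) := ⟨1, 2, by norm_num, by norm_num⟩
  have hu : UniformContinuous (fun x => χ x * f x) :=
    HasCompactSupport.uniformContinuous_of_continuous χ.hasCompactSupport.mul_right (χ.continuous.mul hf)
  obtain ⟨g, hg, hd⟩ := hu.exists_contDiff_dist_le hε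
  refine ⟨g, contDiff_infty.1 hg 1, fun x hx => ?_⟩
  have := hd x
  rw [χ.one_of_mem_closedBall (by simpa using hx), one_mul, dist_eq] at this
  exact this.le

lemma max_prin {m n : ℕ} (hN : N = 2 * m + 2) (hm : 1 ≤ m) {g : Fn N} (hg : Continuous g)
    (h0 : ∀ x, ‖x‖ ≤ 1 → 0 ≤ qf n x → 0 ≤ bf n x → 0 ≤ g x)
    (hb : ∀ x, ‖x‖ ≤ 1 → qf n x = 0 ∨ bf n x = 0 → 0 ≤ Gop m g x) {x : Euc N} (hx : ‖x‖ ≤ 1) (hq : 0 ≤ qf n x)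
    (hbx : 0 ≤ bf n x) : 0 ≤ Gop m g x := by
  by_contra! hneg
  obtain ⟨M, hM0, hM⟩ := bdd_of_cont (Gop_cont (f := fun _ : Euc N => (1:ℝ)) hN hm continuous_const) 1
  set ε := - Gop m g x / (8 * (M + 1)) with hε
  have hε0 : 0 < ε := by
    have : 0 < - Gop m g x := by linarith
    positivity
  have hε' : 8 * ε * (M + 1) = - Gop m g x := by rw [hε]; field_simp
  obtain ⟨F, hF, hFd⟩ := unif_approx (f := fun y => g y + 2 * ε) (by fun_prop) hε0
  set W := Gop m F
  have hWU : ∀ y, ‖y‖ ≤ 1 → |W y - Gop m g y| ≤ 3 * ε * M := fun y hy => by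
    have e : W y - Gop m g y = Gop m (fun z => F z + (-1) * g z) y := by
      rw [Gop_add hN hF.continuous (by fun_prop), Gop_smul]; ring
    rw [e]
    refine (Gop_abs_le hN hm (M := 3 * ε) (by have := hF.continuous; fun_prop) (fun z hz => ?_) y).trans ?_
    · have := abs_le.1 (hFd z hz.le)
      exact abs_le.2 ⟨by linarith, by linarith⟩
    · have := (le_abs_self _).trans (hM y (by simpa using hy))
      gcongr
  let K : Set (Euc N) := closedBall 0 1 ∩ ({y | 0 ≤ qf n y} ∩ {y | 0 ≤ bf n y})
  have hK : IsCompact K := (isCompact_closedBall _ _).inter_right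
    ((isClosed_le continuous_const (cont_qf n)).inter (isClosed_le continuous_const (cont_bf n)))
  obtain ⟨z, hz, hmin⟩ := hK.exists_isMinOn ⟨x, by simpa using hx, hq, hbx⟩ (Gop_cont hN hm hF.continuous).continuousOn
  have hzx : W z ≤ W x := hmin (by exact ⟨by simpa using hx, hq, hbx⟩)
  have hz1 : ‖z‖ ≤ 1 := by simpa using hz.1
  have hUz : Gop m g z < 0 := by
    have a := abs_le.1 (hWU z hz1)
    have b := abs_le.1 (hWU x hx)
    have : 3 * ε * M ≤ 3 * ε * (M + 1) := by gcongr; linarith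
    nlinarith
  have hz2 : ‖z‖ < 1 := lt_of_le_of_ne hz1 fun h => by rw [Gop_zero _ h.ge] at hUz; exact hUz.ne rfl
  have hzq : 0 < qf n z := lt_of_le_of_ne hz.2.1 fun h => (hb z hz1 (Or.inl h.symm)).not_gt hUz
  have hzb : 0 < bf n z := lt_of_le_of_ne hz.2.2 fun h => (hb z hz1 (Or.inr h.symm)).not_gt hUz
  have hloc : IsLocalMin W z := by
    filter_upwards [continuous_norm.continuousAt.eventually (gt_mem_nhds hz2), (cont_qf n).continuousAt.eventually (lt_mem_nhds hzq),
      (cont_bf n).continuousAt.eventually (lt_mem_nhds hzb)] with y h1 h2 h3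
    exact hmin (by exact ⟨by simpa using h1.le, h2.le, h3.le⟩)
  have hC := contDiffAt_Gop_two hN hF.continuous hz2 hF.contDiffAt
  have h1 := lap_nonneg_of_min hC hloc
  have h2 := neg_lap_Gop hN hm hF.continuous hz2 hC
  have h3 := abs_le.1 (hFd z hz1)
  have h4 := h0 z hz1 hzq.le hzb.le
  linarith

def Cone (n : ℕ) (f : Fn N) : Prop := ∀ x y, ‖x‖ = ‖y‖ → |qf n y| ≤ |qf n x| → f x ≤ f y

lemma Cone.eq {n : ℕ} {f : Fn N} (h : Cone n f) {x y : Euc N} (h1 : ‖x‖ = ‖y‖) (h2 : |qf n x| = |qf n y|) : f x = f y :=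
  le_antisymm (h _ _ h1 h2.ge) (h _ _ h1.symm h2.le)

lemma Gop_inv {m n : ℕ} (hn : N = 2 * n) {f : Fn N} (h : Cone n f) {x y : Euc N} (h1 : ‖x‖ = ‖y‖)
    (h2 : |qf n x| = |qf n y|) : Gop m f x = Gop m f y := by
  have key : ∀ x y : Euc N, ‖x‖ = ‖y‖ → qf n x = qf n y → Gop m f x = Gop m f y := fun x y a b => by
    obtain ⟨R, hR, hq⟩ := exists_isom a b
    rw [← hR, Gop_isom]
    congr 1; funext z
    exact h.eq (by simp) (by rw [hq])
  rcases abs_eq_abs.1 h2 with h2 | h2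
  · exact key x y h1 h2
  · have hr : ∀ z, qf n (rotL hn (π / 2) z) = - qf n z := fun z => by
      rw [qf_rotL, mul_div_cancel₀ _ two_ne_zero, cos_pi, sin_pi]; ring
    rw [key x (rotL hn (π / 2) y) (by simpa using h1) (by rw [hr, h2]), Gop_isom]
    congr 1; funext z
    exact h.eq (by simp) (by rw [hr, abs_neg])

lemma exists_axis {n : ℕ} (hn0 : 1 ≤ n) (hn : N = 2 * n) (r : ℝ) (hr : 0 ≤ r) :
    ∃ e : Euc N, ‖e‖ = r ∧ qf n e = r ^ 2 ∧ bf n e = 0 := by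
  let i : Fin N := ⟨0, by omega⟩
  have ht : tau n i ≠ i := fun h => by
    have := sg_tau hn i
    rw [h] at this
    have h2 := sg_sq n i
    rw [show sg n i = 0 by linarith] at h2; norm_num at h2
  refine ⟨EuclideanSpace.single i r, by simp [abs_of_nonneg hr], ?_, ?_⟩
  · unfold qf
    rw [Finset.sum_eq_single i]
    · simp [sg, i]; omega
    · intro b _ hb; simp [hb]
    · simp
  · unfold bf
    refine Finset.sum_eq_zero fun j _ => ?_
    by_cases h : j = i
    · subst h; simp [ht]
    · simp [h]

lemma abs_qf_le (n : ℕ) (x : Euc N) : |qf n x| ≤ ‖x‖ ^ 2 := by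
  rw [EuclideanSpace.real_norm_sq_eq]
  refine (Finset.abs_sum_le_sum_abs _ _).trans (Finset.sum_le_sum fun j _ => ?_)
  have : |sg n j| = 1 := by rw [← sq_eq_sq₀ (abs_nonneg _) zero_le_one, sq_abs, sg_sq, one_pow]
  rw [abs_mul, this, one_mul, abs_of_nonneg (sq_nonneg _)]

lemma Gop_cone {m n : ℕ} (hN : N = 2 * m + 2) (hm : 1 ≤ m) (hn : N = 2 * n) {f : Fn N} (hf : Continuous f) (h : Cone n f) :
    Cone n (Gop m f) := by
  intro x y hxy hq
  rcases le_or_gt 1 ‖x‖ with h1 | h1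
  · rw [Gop_zero f h1, Gop_zero f (hxy ▸ h1)]
  rcases eq_or_ne x 0 with rfl | hx0
  · rw [norm_zero] at hxy
    rw [norm_eq_zero.1 hxy.symm]
  set r := ‖x‖ with hr
  have hr0 : 0 < r := norm_pos_iff.2 hx0
  have hax : ∀ z : Euc N, ‖z‖ = r → ∃ φ, 0 ≤ φ ∧ φ ≤ π / 4 ∧ r ^ 2 * cos (2 * φ) = |qf n z| ∧ φ = arccos (|qf n z| / r ^ 2) / 2 := fun z hz => by
    have h0 : 0 ≤ |qf n z| / r ^ 2 := by positivity
    have h1 : |qf n z| / r ^ 2 ≤ 1 := by rw [div_le_one (by positivity), ← hz]; exact abs_qf_le n z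
    refine ⟨_, ?_, ?_, ?_, rfl⟩
    · have := arccos_nonneg (|qf n z| / r ^ 2); linarith
    · have := arccos_le_pi_div_two.2 h0; linarith
    · rw [mul_div_cancel₀ _ two_ne_zero, cos_arccos (by linarith) h1]; field_simp
  obtain ⟨a, ha0, ha1, hac, ha⟩ := hax x rfl
  obtain ⟨b, hb0, hb1, hbc, hb⟩ := hax y hxy.symm
  have hab : a ≤ b := by
    rw [ha, hb]
    have := arccos_le_arccos (div_le_div_of_nonneg_right hq (sq_nonneg r))
    linarith
  obtain ⟨e, he, heq, heb⟩ := exists_axis (n := n) (by omega) hn r hr0.le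
  set z := rotL hn ((a + b) / 2) e
  have hzq : qf n z = r ^ 2 * cos (a + b) := by
    rw [qf_rotL, heq, heb, mul_div_cancel₀ _ two_ne_zero]; ring
  have hzb : bf n z = r ^ 2 * sin (a + b) := by
    rw [bf_rotL, heq, heb, mul_div_cancel₀ _ two_ne_zero]; ring
  have hzn : ‖z‖ = r := by simp [z, he]
  set ψ := (b - a) / 2 with hψ
  let g : Fn N := fun w => f (rotL hn ψ w) + (-1) * f (rotL hn (-ψ) w)
  have hgc : Continuous g := by
    have h1 := (rotL hn ψ).continuous
    have h2 := (rotL hn (-ψ)).continuous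
    fun_prop
  have hU : ∀ w, Gop m g w = Gop m f (rotL hn ψ w) - Gop m f (rotL hn (-ψ) w) := fun w => by
    have h1 := (rotL hn ψ).continuous
    have h2 := (rotL hn (-ψ)).continuous
    rw [Gop_isom, Gop_isom, Gop_add hN (by fun_prop) (by fun_prop), Gop_smul]; ring
  have e1 : ∀ w, qf n (rotL hn ψ w) = cos (b - a) * qf n w - sin (b - a) * bf n w := fun w => by
    rw [qf_rotL, show 2 * ψ = b - a by rw [hψ]; ring]
  have e2 : ∀ w, qf n (rotL hn (-ψ) w) = cos (b - a) * qf n w + sin (b - a) * bf n w := fun w => by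
    rw [qf_rotL, show 2 * -ψ = -(b - a) by rw [hψ]; ring, cos_neg, sin_neg]; ring
  have hpi := pi_pos
  have hc : 0 ≤ cos (b - a) := cos_nonneg_of_neg_pi_div_two_le_of_le (by linarith) (by linarith)
  have hs : 0 ≤ sin (b - a) := sin_nonneg_of_nonneg_of_le_pi (by linarith) (by linarith)
  have key : 0 ≤ Gop m g z := by
    refine max_prin (n := n) hN hm hgc (fun w _ hw1 hw2 => ?_) (fun w _ hw => ?_) (hzn.trans_le h1.le) ?_ ?_
    · have := h (rotL hn (-ψ) w) (rotL hn ψ w) (by simp) (by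
        rw [e1, e2, abs_of_nonneg (a := _ + _) (by positivity)]
        have p1 : 0 ≤ cos (b - a) * qf n w := by positivity
        have p2 : 0 ≤ sin (b - a) * bf n w := by positivity
        exact abs_le.2 ⟨by linarith, by linarith⟩)
      simp only [g]; linarith
    · rw [hU, Gop_inv hn h (x := rotL hn ψ w) (y := rotL hn (-ψ) w) (by simp), sub_self]
      rw [e1, e2]
      rcases hw with hw | hw
      · rw [hw]; simp
      · rw [hw]; simp
    · rw [hzq]; exact mul_nonneg (sq_nonneg _) (cos_nonneg_of_neg_pi_div_two_le_of_le (by linarith) (by linarith))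
    · rw [hzb]; exact mul_nonneg (sq_nonneg _) (sin_nonneg_of_nonneg_of_le_pi (by linarith) (by linarith))
  rw [hU] at key
  have f1 : Gop m f (rotL hn ψ z) = Gop m f y := by
    refine Gop_inv hn h (by simp [hzn, hxy]) ?_
    rw [e1, hzq, hzb, ← abs_of_nonneg (abs_nonneg (qf n y)), ← hbc]
    rw [show 2 * b = (b - a) + (a + b) by ring, cos_add (b - a)]
    congr 1; ring
  have f2 : Gop m f (rotL hn (-ψ) z) = Gop m f x := by
    refine Gop_inv hn h (by simp [hzn, hr]) ?_
    rw [e2, hzq, hzb, ← abs_of_nonneg (abs_nonneg (qf n x)), ← hac]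
    rw [show 2 * a = (a + b) - (b - a) by ring, cos_sub (a + b)]
    congr 1; ring
  linarith

end Henon

namespace Henon
open Topology Metric
open scoped ENNReal
variable {N : ℕ}

lemma polar {n : ℕ} (hn : 1 ≤ n) {G : ℝ → ℝ≥0∞} (hG : Measurable G) {ψ : Euc n → ℝ≥0∞} (hψ : Measurable ψ)
    (hh : ∀ c : ℝ, 0 < c → ∀ y, ψ (c • y) = ψ y) :
    ∫⁻ y : Euc n, G ‖y‖ * ψ y = (∫⁻ w : sphere (0 : Euc n) 1, ψ w ∂(volume : Measure (Euc n)).toSphere) *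
      ∫⁻ r, G (r : Ioi (0:ℝ)) ∂(Measure.volumeIoiPow (n - 1)) := by
  have := nontriv hn
  have h1 : ∫⁻ y : Euc n, G ‖y‖ * ψ y = ∫⁻ y : ({(0 : Euc n)}ᶜ : Set (Euc n)), G ‖y.1‖ * ψ y ∂(volume.comap Subtype.val) := by
    rw [lintegral_subtype_comap (measurableSet_singleton _).compl fun y => G ‖y‖ * ψ y, restrict_compl_singleton]
  have h2 := (volume : Measure (Euc n)).measurePreserving_homeomorphUnitSphereProd.lintegral_comp_emb
    (Homeomorph.measurableEmbedding _) (fun q => ψ q.1 * G q.2)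
  rw [h1, ← lintegral_prod_mul (by fun_prop) (by fun_prop)]
  simp only [finrank_euclideanSpace, Fintype.card_fin] at h2
  rw [← h2]
  refine lintegral_congr fun y => ?_
  have hy : 0 < ‖y.1‖⁻¹ := inv_pos.2 (norm_pos_iff.2 y.2)
  rw [homeomorphUnitSphereProd_apply_fst_coe, homeomorphUnitSphereProd_apply_snd_coe, mul_comm]
  exact congrArg (· * _) (hh _ hy y.1).symm

lemma polar' {n : ℕ} (hn : 1 ≤ n) {ψ : Euc n → ℝ≥0∞} (hψ : Measurable ψ)
    (hh : ∀ c : ℝ, 0 < c → ∀ y, ψ (c • y) = ψ y) (hf : ∫⁻ y in ball (0 : Euc n) 1, ψ y ≠ ⊤) :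
    ∃ C : ℝ≥0∞, C ≠ ⊤ ∧ ∀ G : ℝ → ℝ≥0∞, Measurable G → ∫⁻ y : Euc n, G ‖y‖ * ψ y = C * ∫⁻ y : Euc n, G ‖y‖ := by
  have := nontriv hn
  let H : ℝ → ℝ≥0∞ := (Iio 1).indicator 1
  have hH : Measurable H := measurable_one.indicator measurableSet_Iio
  set A := ∫⁻ w : sphere (0 : Euc n) 1, ψ w ∂(volume : Measure (Euc n)).toSphere
  set S := (volume : Measure (Euc n)).toSphere univ with hS
  have hb : ∀ y : Euc n, H ‖y‖ * ψ y = (ball (0 : Euc n) 1).indicator ψ y := fun y => by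
    by_cases h : ‖y‖ < 1 <;> simp [H, indicator, h]
  have e1 : ∀ G : ℝ → ℝ≥0∞, Measurable G → ∫⁻ y : Euc n, G ‖y‖ = S * ∫⁻ r, G (r : Ioi (0:ℝ)) ∂(Measure.volumeIoiPow (n - 1)) := fun G hG => by
    have := polar hn hG (ψ := fun _ => 1) (by fun_prop) (fun _ _ _ => rfl)
    simpa [hS] using this
  have hS0 : S ≠ 0 := by
    intro h
    have := e1 1 (by fun_prop)
    rw [h, zero_mul] at this
    simp at this
  have hST : S ≠ ⊤ := measure_ne_top _ _
  have hA : A ≠ ⊤ := by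
    intro h
    have h3 := polar hn hH hψ hh
    simp only [hb] at h3
    rw [lintegral_indicator measurableSet_ball] at h3
    have h4 : ∫⁻ r, H (r : Ioi (0:ℝ)) ∂(Measure.volumeIoiPow (n - 1)) ≠ 0 := by
      intro h5
      have h6 := e1 H hH
      rw [h5, mul_zero] at h6
      have h7 : ∀ y : Euc n, H ‖y‖ = (ball (0 : Euc n) 1).indicator 1 y := fun y => by
        by_cases h : ‖y‖ < 1 <;> simp [H, indicator, h]
      simp only [h7] at h6
      rw [lintegral_indicator_one measurableSet_ball] at h6
      exact (measure_ball_pos volume (0 : Euc n) one_pos).ne' h6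
    rw [show (∫⁻ w : sphere (0 : Euc n) 1, ψ w ∂(volume : Measure (Euc n)).toSphere) = ⊤ from h, ENNReal.top_mul h4] at h3
    exact hf h3
  refine ⟨A / S, ENNReal.div_ne_top hA hS0, fun G hG => ?_⟩
  rw [polar hn hG hψ hh, e1 G hG, ← mul_assoc, ENNReal.div_mul_cancel hS0 hST]

lemma one_d {c : ℝ} (hc : c < 1) (R : ℝ) : IntegrableOn (fun t : ℝ => ‖t‖ ^ (-c)) (ball 0 R) volume := by
  rw [integrableOn_fun_norm_addHaar (E := ℝ) volume (f := fun r => r ^ (-c))]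
  rcases le_or_gt R 0 with hR | hR
  · simp [Ioo_eq_empty_of_le hR]
  have := (intervalIntegral.intervalIntegrable_rpow' (a := 0) (b := R) (r := -c) (by linarith)).1
  simpa using this.mono_set Ioo_subset_Ioc_self

def psi (m : ℕ) (β : ℝ) (y : Euc (m + 1)) : ℝ≥0∞ := ∏ j : Fin m, (‖y j.succ‖ₑ / ‖y‖ₑ) ^ (-β)

lemma meas_psi (m : ℕ) (β : ℝ) : Measurable (psi m β) := by
  unfold psi; fun_prop

lemma psi_hom (m : ℕ) (β : ℝ) {c : ℝ} (hc : 0 < c) (y : Euc (m + 1)) : psi m β (c • y) = psi m β y := by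
  unfold psi
  refine Finset.prod_congr rfl fun j _ => ?_
  rw [PiLp.smul_apply, enorm_smul, enorm_smul, ENNReal.mul_div_mul_left _ _ (by simpa using hc.ne') (by simp)]

lemma psi_fin (m : ℕ) {β : ℝ} (h0 : 0 < β) (hβ : β < 1) : ∫⁻ y in ball (0 : Euc (m + 1)) 1, psi m β y ≠ ⊤ := by
  let g : Fin (m + 1) → ℝ → ℝ := Fin.cons ((ball (0:ℝ) 1).indicator 1) fun _ => (ball (0:ℝ) 1).indicator fun t => ‖t‖ ^ (-β)
  have hg : ∀ i, Integrable (g i) volume := by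
    intro i
    refine Fin.cases ?_ (fun j => ?_) i
    · simp only [g, Fin.cons_zero]
      exact (integrable_indicator_iff measurableSet_ball).2 (integrableOn_const (by simp))
    · simp only [g, Fin.cons_succ]
      exact (integrable_indicator_iff measurableSet_ball).2 (one_d hβ 1)
  have hI : Integrable (fun y : Fin (m + 1) → ℝ => ∏ i, g i (y i)) := Integrable.fintype_prod hg
  rw [← (PiLp.volume_preserving_toLp (Fin (m + 1))).setLIntegral_comp_preimage measurableSet_ball (meas_psi m β)]
  refine ne_top_of_le_ne_top hI.2.ne ((lintegral_mono_ae ?_).trans (setLIntegral_le_lintegral _ _))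
  have hae : ∀ᵐ y : Fin (m + 1) → ℝ, ∀ i, y i ≠ 0 := ae_all_iff.2 fun i => Measure.ae_eval_ne (μ := fun _ => volume) i 0
  filter_upwards [ae_restrict_of_ae hae, ae_restrict_mem (measurableSet_ball.preimage (PiLp.volume_preserving_toLp (Fin (m + 1))).measurable)] with y hy hyb
  set z : Euc (m + 1) := WithLp.toLp 2 y
  have hz : ‖z‖ < 1 := by simpa using hyb
  have hzi : ∀ i, |y i| < 1 := fun i => lt_of_le_of_lt (PiLp.norm_apply_le z i) hz
  have hz0 : z ≠ 0 := fun h => hy 0 (by rw [show y 0 = z 0 from rfl, h]; rfl)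
  have e : ∏ i, g i (y i) = ∏ j : Fin m, |y j.succ| ^ (-β) := by
    rw [Fin.prod_univ_succ]
    simp only [g, Fin.cons_zero, Fin.cons_succ]
    rw [indicator_of_mem (by simpa using hzi 0), Pi.one_apply, one_mul]
    exact Finset.prod_congr rfl fun j _ => by rw [indicator_of_mem (by simpa using hzi _), norm_eq_abs]
  rw [e, enorm_eq_ofReal (Finset.prod_nonneg fun _ _ => by positivity), ENNReal.ofReal_prod_of_nonneg (fun _ _ => by positivity)]
  unfold psi
  refine Finset.prod_le_prod' fun j _ => ?_
  have hp : 0 < |y j.succ| := abs_pos.2 (hy _)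
  rw [← ENNReal.ofReal_rpow_of_pos hp, ENNReal.rpow_neg, ENNReal.rpow_neg]
  refine ENNReal.inv_le_inv.2 (ENNReal.rpow_le_rpow ?_ h0.le)
  rw [← enorm_eq_ofReal_abs]
  refine (ENNReal.le_div_iff_mul_le (Or.inl (by simpa using hz0)) (Or.inl (by simp))).2 ?_
  refine (mul_le_of_le_one_right' ?_)
  rw [← ofReal_norm]; exact ENNReal.ofReal_le_one.2 hz.le

end Henon

namespace Henon
open Topology Metric
open scoped ENNReal
variable {N : ℕ}

lemma split {n : ℕ} (hn : N = 2 * n) : ∃ Φ : Euc n × Euc n → Euc N, MeasurePreserving Φ ∧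
    (∀ a b, ‖Φ (a, b)‖ ^ 2 = ‖a‖ ^ 2 + ‖b‖ ^ 2) ∧ (∀ a b, qf n (Φ (a, b)) = ‖a‖ ^ 2 - ‖b‖ ^ 2) ∧
    (∀ w z, Φ w - Φ z = Φ (w - z)) := by
  let e : Fin n ⊕ Fin n ≃ Fin N := finSumFinEquiv.trans (finCongr (by omega))
  let Φ : Euc n × Euc n → Euc N := fun w => WithLp.toLp 2 (MeasurableEquiv.piCongrLeft (fun _ => ℝ) e
    ((MeasurableEquiv.sumPiEquivProdPi fun _ => ℝ).symm (w.1.ofLp, w.2.ofLp)))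
  have h1 : ∀ w i, Φ w (e (Sum.inl i)) = w.1 i := fun w i => Equiv.piCongrLeft_apply_apply (fun _ => ℝ) e _ _
  have h2 : ∀ w i, Φ w (e (Sum.inr i)) = w.2 i := fun w i => Equiv.piCongrLeft_apply_apply (fun _ => ℝ) e _ _
  refine ⟨Φ, ?_, fun a b => ?_, fun a b => ?_, fun w z => ?_⟩
  · have k := (PiLp.volume_preserving_toLp (Fin N)).comp ((volume_measurePreserving_piCongrLeft (fun _ => ℝ) e).comp
      ((volume_measurePreserving_sumPiEquivProdPi_symm (fun _ : Fin n ⊕ Fin n => ℝ)).comp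
        ((PiLp.volume_preserving_ofLp (Fin n)).prod (PiLp.volume_preserving_ofLp (Fin n)))))
    exact k
  · rw [EuclideanSpace.norm_sq_eq, EuclideanSpace.norm_sq_eq, EuclideanSpace.norm_sq_eq, ← e.sum_comp, Fintype.sum_sum_type]
    simp only [h1, h2]
  · unfold qf
    rw [EuclideanSpace.norm_sq_eq, EuclideanSpace.norm_sq_eq, ← e.sum_comp, Fintype.sum_sum_type]
    simp only [h1, h2]
    have k1 : ∀ i : Fin n, sg n (e (Sum.inl i)) = 1 := fun i => by simp [sg, e]
    have k2 : ∀ i : Fin n, sg n (e (Sum.inr i)) = -1 := fun i => by simp [sg, e]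
    simp [k1, k2, sub_eq_add_neg]
  · ext j
    obtain ⟨i | i, rfl⟩ := e.surjective j
    · simp [h1]
    · simp [h2]

lemma block (m : ℕ) {s ε β : ℝ} (hs : 0 < s) (hε : 0 < ε) (hβ : 0 < β) (h : (m : ℝ) = ε + m * β) (a : Euc (m + 1)) :
    ‖EuclideanSpace.single 0 s - a‖ₑ ^ (-(m : ℝ)) ≤
      (‖s - ‖a‖‖ₑ ^ (-ε) * (‖s‖ₑ ^ (-β)) ^ m) * psi m β a := by
  set d := ‖EuclideanSpace.single 0 s - a‖ₑ with hd
  have hd1 : d ^ (-(m : ℝ)) ≤ d ^ (-ε) * ∏ j : Fin m, d ^ (-β) := by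
    by_cases h0 : d = 0
    · rw [h0]; simp [hε, hβ, ENNReal.zero_rpow_of_neg, ENNReal.top_mul]
    · rw [Finset.prod_const, Finset.card_univ, Fintype.card_fin, ← ENNReal.rpow_natCast, ← ENNReal.rpow_mul,
        ← ENNReal.rpow_add _ _ h0 (by simp [hd])]
      exact le_of_eq (by congr 1; linarith)
  refine hd1.trans ?_
  rw [mul_assoc]
  unfold psi
  have hc : (‖s‖ₑ ^ (-β)) ^ m = ∏ j : Fin m, ‖s‖ₑ ^ (-β) := by simp
  rw [hc, ← Finset.prod_mul_distrib]
  have hanti : ∀ {u v : ℝ≥0∞} {c : ℝ}, 0 < c → u ≤ v → v ^ (-c) ≤ u ^ (-c) := fun hc h => by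
    rw [ENNReal.rpow_neg, ENNReal.rpow_neg]; exact ENNReal.inv_le_inv.2 (ENNReal.rpow_le_rpow h hc.le)
  have hsn : ‖(EuclideanSpace.single 0 s : Euc (m + 1))‖ = s := by simp [abs_of_pos hs]
  refine mul_le_mul' (hanti hε ?_) (Finset.prod_le_prod' fun j _ => ?_)
  · rw [hd, enorm_le_iff_norm_le]
    have := abs_norm_sub_norm_le (EuclideanSpace.single 0 s) a
    rwa [hsn] at this
  · rw [← ENNReal.mul_rpow_of_ne_top (by simp)]
    · refine hanti hβ ?_
      by_cases ha : a = 0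
      · simp [ha]
      rw [← mul_div_assoc]
      refine ENNReal.div_le_of_le_mul ?_
      rw [hd, ← enorm_norm a, ← enorm_norm (EuclideanSpace.single 0 s - a), ← enorm_mul, ← enorm_mul, enorm_le_iff_norm_le,
        norm_mul, norm_mul, norm_norm, norm_norm, norm_eq_abs, norm_eq_abs, abs_of_pos hs]
      refine le_of_sq_le_sq ?_ (by positivity)
      rw [mul_pow, mul_pow, sq_abs, EuclideanSpace.norm_sq_eq (EuclideanSpace.single 0 s - a), Fin.sum_univ_succ]
      have k : ‖a‖ ^ 2 = a 0 ^ 2 + ∑ i : Fin m, a i.succ ^ 2 := by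
        rw [EuclideanSpace.norm_sq_eq, Fin.sum_univ_succ]; simp
      have kj : a j.succ ^ 2 ≤ ∑ i : Fin m, a i.succ ^ 2 :=
        Finset.single_le_sum (f := fun i : Fin m => a i.succ ^ 2) (fun _ _ => sq_nonneg _) (Finset.mem_univ j)
      simp [k]
      set S := ∑ i : Fin m, a i.succ ^ 2
      nlinarith [sq_nonneg (s * a 0 - (a 0 ^ 2 + S)), mul_le_mul_of_nonneg_left kj (sq_nonneg s)]
    · by_cases ha : a = 0
      · simp [ha]
      · exact ENNReal.div_ne_top (by simp) (by simpa using ha)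

lemma C1_fin {n : ℕ} (hn : 1 ≤ n) (s : ℝ) : ∫⁻ a in ball (0 : Euc n) 2, ‖s - ‖a‖‖ₑ ^ (-(1/2:ℝ)) ≠ ⊤ := by
  have := nontriv hn
  have h : IntegrableOn (fun a : Euc n => ‖s - ‖a‖‖ ^ (-(1/2:ℝ))) (ball 0 2) volume := by
    rw [integrableOn_fun_norm_addHaar (E := Euc n) volume (f := fun r => ‖s - r‖ ^ (-(1/2:ℝ)))]
    have h1 : IntegrableOn (fun t : ℝ => ‖s - t‖ ^ (-(1/2:ℝ))) (Ioo 0 2) volume := by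
      have := (one_d (c := 1/2) (by norm_num) (|s| + 2)).integrable_indicator measurableSet_ball
      refine ((this.comp_sub_left s).integrableOn (s := Ioo 0 2)).congr_fun (fun t ht => ?_) measurableSet_Ioo
      beta_reduce
      rw [indicator_of_mem]
      rw [mem_ball_zero_iff]
      refine (norm_sub_le _ _).trans_lt ?_
      rw [norm_eq_abs, norm_eq_abs, abs_of_pos ht.1]; linarith [ht.2]
    have h2 : IntegrableOn (fun t : ℝ => t ^ (Module.finrank ℝ (Euc n) - 1) * ‖s - t‖ ^ (-(1/2:ℝ))) (Ioo 0 2) volume := by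
      refine Integrable.bdd_mul (c := 2 ^ (Module.finrank ℝ (Euc n) - 1)) h1 (by fun_prop) ?_
      filter_upwards [ae_restrict_mem measurableSet_Ioo] with t ht
      rw [norm_pow, norm_eq_abs, abs_of_pos ht.1]
      exact pow_le_pow_left₀ ht.1.le ht.2.le _
    simpa using h2
  have hne : ∀ᵐ a : Euc n ∂(volume.restrict (ball 0 2)), ‖s - ‖a‖‖ ≠ 0 := by
    refine ae_restrict_of_ae ?_
    have : volume (sphere (0 : Euc n) s) = 0 := by
      by_cases h : s = 0
      · subst h; simp
      · exact Measure.addHaar_sphere_of_ne_zero _ _ h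
    filter_upwards [measure_eq_zero_iff_ae_notMem.1 this] with a ha h
    exact ha (by rw [mem_sphere_zero_iff_norm]; linarith [norm_eq_zero.1 h])
  refine ne_top_of_le_ne_top h.2.ne (lintegral_mono_ae ?_)
  filter_upwards [hne] with a ha
  rw [enorm_eq_ofReal (r := _ ^ _) (by positivity), ← ENNReal.ofReal_rpow_of_pos ((norm_nonneg _).lt_of_ne' ha), ofReal_norm]


lemma unit_est {m : ℕ} (hm : 1 ≤ m) (hN : N = 2 * m + 2) {p q : ℝ} (hpq : p.HolderConjugate q) :
    ∃ x : Euc N, ‖x‖ = 1 ∧ qf (m + 1) x = 0 ∧ ∃ C : ℝ≥0∞, C ≠ ⊤ ∧ ∀ W : Euc N → ℝ≥0∞, Measurable W →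
      (∀ y z, ‖y‖ = ‖z‖ → qf (m + 1) y = qf (m + 1) z → W y = W z) →
      ∫⁻ z in ball 0 2, ENNReal.ofReal (rad m (x - z)) * W z ≤ C * (∫⁻ z in ball 0 2, W z ^ q) ^ (1 / q) := by
  obtain ⟨Φ, hΦ, hΦn, hΦq, hΦs⟩ := split (N := N) (n := m + 1) (by omega)
  have hp := hpq.lt
  set s : ℝ := √(1 / 2)
  have hs : 0 < s := by positivity
  have hs2 : s ^ 2 = 1 / 2 := sq_sqrt (by norm_num)
  set ε : ℝ := 1 / (2 * p)
  have hε : 0 < ε := by positivity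
  have hε1 : ε < 1 := by
    rw [div_lt_one (by positivity)]; linarith
  have hm' : (1:ℝ) ≤ m := by exact_mod_cast hm
  set β : ℝ := (m - ε) / m
  have hβ : 0 < β := div_pos (by linarith) (by linarith)
  have hβ1 : β < 1 := by rw [div_lt_one (by linarith)]; linarith
  have hmβ : (m : ℝ) = ε + m * β := by
    simp only [β]; field_simp; ring
  obtain ⟨C, hC, hpol⟩ := polar' (n := m + 1) (by omega) (meas_psi m β) (fun c hc y => psi_hom m β hc y) (psi_fin m hβ hβ1)
  set e0 : ℝ → Euc (m + 1) := fun t => EuclideanSpace.single 0 t with he0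
  have he0n : ∀ t, ‖e0 t‖ ^ 2 = t ^ 2 := fun t => by simp [he0]
  have he0m : Measurable e0 := by
    have : e0 = fun t => t • EuclideanSpace.single 0 1 := by
      funext t; ext i; simp [he0, Pi.single_apply]
    rw [this]; fun_prop
  set K : ℝ → ℝ≥0∞ := fun ρ => (‖s - ρ‖ₑ ^ (-ε) * (‖s‖ₑ ^ (-β)) ^ m) * (Iio 2).indicator 1 ρ with hK
  have hKm : Measurable K := by
    have : Measurable ((Iio (2:ℝ)).indicator (1 : ℝ → ℝ≥0∞)) := measurable_one.indicator measurableSet_Iio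
    fun_prop
  set I := ∫⁻ a : Euc (m + 1), K ‖a‖ ^ p with hI
  have hIf : I ≠ ⊤ := by
    have e1 : ∀ a : Euc (m + 1), K ‖a‖ ^ p = (ball (0 : Euc (m + 1)) 2).indicator
        (fun a => ((‖s‖ₑ ^ (-β)) ^ m) ^ p * ‖s - ‖a‖‖ₑ ^ (-(1/2:ℝ))) a := fun a => by
      by_cases h : ‖a‖ < 2
      · rw [indicator_of_mem (by simpa using h)]
        simp only [hK]
        rw [indicator_of_mem (by simpa using h), Pi.one_apply, mul_one, ENNReal.mul_rpow_of_nonneg _ _ (by linarith),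
          ← ENNReal.rpow_mul, mul_comm]
        congr 2
        simp only [ε]; field_simp
      · rw [indicator_of_notMem (by simpa using h)]
        simp only [hK]
        rw [indicator_of_notMem (by simpa using h), mul_zero, ENNReal.zero_rpow_of_pos (by linarith)]
    rw [hI]; simp only [e1]
    rw [lintegral_indicator measurableSet_ball, lintegral_const_mul _ (by fun_prop)]
    refine ENNReal.mul_ne_top ?_ (C1_fin (by omega) s)
    refine ENNReal.rpow_ne_top_of_nonneg (by linarith) (ENNReal.pow_ne_top ?_)
    exact ENNReal.rpow_ne_top_of_ne_zero (by simpa using hs.ne') (by simp)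
  refine ⟨Φ (e0 s, e0 s), ?_, by rw [hΦq, sub_self], C * C * (I * I) ^ (1 / p), ?_, fun W hW hWi => ?_⟩
  · have := hΦn (e0 s) (e0 s)
    rw [he0n, hs2] at this
    exact (sq_eq_sq₀ (norm_nonneg _) zero_le_one).1 (by rw [this]; norm_num)
  · exact ENNReal.mul_ne_top (ENNReal.mul_ne_top hC hC) (ENNReal.rpow_ne_top_of_nonneg (by positivity) (ENNReal.mul_ne_top hIf hIf))
  set g : ℝ → ℝ → ℝ≥0∞ := fun ρ σ => (ball (0 : Euc N) 2).indicator W (Φ (e0 ρ, e0 σ)) with hg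
  have hWm : Measurable ((ball (0 : Euc N) 2).indicator W) := hW.indicator measurableSet_ball
  have hgm : Measurable (Function.uncurry g) := by
    have := hΦ.measurable
    exact hWm.comp (this.comp (Measurable.prodMk (he0m.comp measurable_fst) (he0m.comp measurable_snd)))
  have hgW : ∀ a b, (ball (0 : Euc N) 2).indicator W (Φ (a, b)) = g ‖a‖ ‖b‖ := fun a b => by
    have hn : ‖Φ (a, b)‖ = ‖Φ (e0 ‖a‖, e0 ‖b‖)‖ := by
      rw [← sq_eq_sq₀ (norm_nonneg _) (norm_nonneg _), hΦn, hΦn, he0n, he0n]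
    have hw := hWi (Φ (a, b)) (Φ (e0 ‖a‖, e0 ‖b‖)) hn (by rw [hΦq, hΦq, he0n, he0n])
    simp only [hg, indicator, mem_ball_zero_iff, hn, hw]
  have hg2 : ∀ a b : Euc (m + 1), ¬ (‖a‖ < 2 ∧ ‖b‖ < 2) → g ‖a‖ ‖b‖ = 0 := fun a b h => by
    rw [← hgW]
    refine indicator_of_notMem (fun h2 => h ?_) _
    rw [mem_ball_zero_iff] at h2
    have := hΦn a b
    constructor <;> nlinarith [norm_nonneg a, norm_nonneg b, norm_nonneg (Φ (a, b))]
  have key : ∀ a b : Euc (m + 1), ENNReal.ofReal (rad m (Φ (e0 s, e0 s) - Φ (a, b))) * g ‖a‖ ‖b‖ ≤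
      (K ‖a‖ * psi m β a) * ((K ‖b‖ * g ‖a‖ ‖b‖) * psi m β b) := fun a b => by
    by_cases h : ‖a‖ < 2 ∧ ‖b‖ < 2
    swap
    · rw [hg2 a b h]; simp
    have hb := block m hs hε hβ hmβ
    have ha' : ‖e0 s - a‖ₑ ^ (-(m : ℝ)) ≤ K ‖a‖ * psi m β a := by
      simp only [hK]; rw [indicator_of_mem (by simpa using h.1), Pi.one_apply, mul_one]; exact hb a
    have hb' : ‖e0 s - b‖ₑ ^ (-(m : ℝ)) ≤ K ‖b‖ * psi m β b := by
      simp only [hK]; rw [indicator_of_mem (by simpa using h.2), Pi.one_apply, mul_one]; exact hb b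
    have hr : ENNReal.ofReal (rad m (Φ (e0 s, e0 s) - Φ (a, b))) ≤ ‖e0 s - a‖ₑ ^ (-(m : ℝ)) * ‖e0 s - b‖ₑ ^ (-(m : ℝ)) := by
      rw [hΦs, Prod.mk_sub_mk]
      set A := e0 s - a
      set B := e0 s - b
      have mn : (0:ℝ) < m := by linarith
      by_cases hA : A = 0
      · have hk : ‖A‖ₑ ^ (-(m : ℝ)) = ⊤ := by rw [hA, enorm_zero, ENNReal.zero_rpow_of_neg (by linarith)]
        rw [hk, ENNReal.top_mul]
        · exact le_top
        · simp [ENNReal.rpow_eq_zero_iff]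
      by_cases hB : B = 0
      · have hk : ‖B‖ₑ ^ (-(m : ℝ)) = ⊤ := by rw [hB, enorm_zero, ENNReal.zero_rpow_of_neg (by linarith)]
        rw [hk, ENNReal.mul_top]
        · exact le_top
        · simp [ENNReal.rpow_eq_zero_iff]
      have hA' := norm_pos_iff.2 hA
      have hB' := norm_pos_iff.2 hB
      rw [← ofReal_norm A, ← ofReal_norm B, ENNReal.ofReal_rpow_of_pos hA', ENNReal.ofReal_rpow_of_pos hB',
        ← ENNReal.ofReal_mul (by positivity)]
      refine ENNReal.ofReal_le_ofReal ?_
      rw [rpow_neg hA'.le, rpow_neg hB'.le, rpow_natCast, rpow_natCast, ← mul_inv, ← mul_pow]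
      unfold rad
      rw [hΦn]
      refine inv_anti₀ (by positivity) (pow_le_pow_left₀ (by positivity) ?_ _)
      nlinarith [sq_nonneg (‖A‖ - ‖B‖)]
    refine (mul_le_mul_left (hr.trans (mul_le_mul' ha' hb')) _).trans (le_of_eq (by ring))
  have hgm' : ∀ ρ, Measurable (g ρ) := fun ρ => hgm.of_uncurry_left
  have hgn : Measurable fun w : Euc (m + 1) × Euc (m + 1) => g ‖w.1‖ ‖w.2‖ :=
    hgm.comp (f := fun w : Euc (m + 1) × Euc (m + 1) => (‖w.1‖, ‖w.2‖)) (by fun_prop)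
  have hψ := meas_psi m β
  have hrm := meas_rad (N := N) m
  have hmm : Measurable fun z => ENNReal.ofReal (rad m (Φ (e0 s, e0 s) - z)) * (ball (0 : Euc N) 2).indicator W z := by fun_prop
  have hin : Measurable fun ρ => ∫⁻ b : Euc (m + 1), K ‖b‖ * g ρ ‖b‖ := by
    refine Measurable.lintegral_prod_right' (f := fun w : ℝ × Euc (m + 1) => K ‖w.2‖ * g w.1 ‖w.2‖) ?_
    exact (hKm.comp (by fun_prop)).mul (hgm.comp (f := fun w : ℝ × Euc (m + 1) => (w.1, ‖w.2‖)) (by fun_prop))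
  calc ∫⁻ z in ball 0 2, ENNReal.ofReal (rad m (Φ (e0 s, e0 s) - z)) * W z
      = ∫⁻ z, ENNReal.ofReal (rad m (Φ (e0 s, e0 s) - z)) * (ball (0 : Euc N) 2).indicator W z := by
        rw [← lintegral_indicator measurableSet_ball]
        refine lintegral_congr fun z => ?_
        by_cases h : z ∈ ball (0 : Euc N) 2 <;> simp [indicator, h]
    _ = ∫⁻ w, ENNReal.ofReal (rad m (Φ (e0 s, e0 s) - Φ w)) * g ‖w.1‖ ‖w.2‖ := by
        rw [← hΦ.lintegral_comp hmm]
        exact lintegral_congr fun w => by rw [← hgW]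
    _ ≤ ∫⁻ w : Euc (m + 1) × Euc (m + 1), (K ‖w.1‖ * psi m β w.1) * ((K ‖w.2‖ * g ‖w.1‖ ‖w.2‖) * psi m β w.2) :=
        lintegral_mono fun w => key w.1 w.2
    _ = ∫⁻ a : Euc (m + 1), (K ‖a‖ * psi m β a) * (C * ∫⁻ b : Euc (m + 1), K ‖b‖ * g ‖a‖ ‖b‖) := by
        rw [Measure.volume_eq_prod, lintegral_prod _ (by fun_prop)]
        refine lintegral_congr fun a => ?_
        dsimp only
        rw [lintegral_const_mul _ (by have := hgm' ‖a‖; fun_prop), hpol (fun ρ => K ρ * g ‖a‖ ρ) (hKm.mul (hgm' _))]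
    _ = C * (C * ∫⁻ a : Euc (m + 1), K ‖a‖ * ∫⁻ b : Euc (m + 1), K ‖b‖ * g ‖a‖ ‖b‖) := by
        rw [← hpol (fun ρ => K ρ * ∫⁻ b : Euc (m + 1), K ‖b‖ * g ρ ‖b‖) (hKm.mul hin),
          ← lintegral_const_mul _ (by fun_prop)]
        exact lintegral_congr fun a => by ring
    _ = C * C * ∫⁻ w : Euc (m + 1) × Euc (m + 1), (K ‖w.1‖ * K ‖w.2‖) * g ‖w.1‖ ‖w.2‖ := by
        rw [mul_assoc, Measure.volume_eq_prod, lintegral_prod _ (by fun_prop)]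
        congr 2
        refine lintegral_congr fun a => ?_
        rw [← lintegral_const_mul _ (by have := hgm' ‖a‖; fun_prop)]
        exact lintegral_congr fun b => by ring
    _ ≤ C * C * ((∫⁻ w : Euc (m + 1) × Euc (m + 1), (K ‖w.1‖ * K ‖w.2‖) ^ p) ^ (1 / p) *
          (∫⁻ w : Euc (m + 1) × Euc (m + 1), (g ‖w.1‖ ‖w.2‖) ^ q) ^ (1 / q)) :=
        mul_le_mul_right (ENNReal.lintegral_mul_le_Lp_mul_Lq _ hpq (by fun_prop) (by fun_prop)) _
    _ = C * C * (I * I) ^ (1 / p) * (∫⁻ z in ball 0 2, W z ^ q) ^ (1 / q) := by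
        have q1 : ∫⁻ w : Euc (m + 1) × Euc (m + 1), (K ‖w.1‖ * K ‖w.2‖) ^ p = I * I := by
          simp only [ENNReal.mul_rpow_of_nonneg _ _ hpq.nonneg]
          rw [Measure.volume_eq_prod]
          exact lintegral_prod_mul (f := fun a : Euc (m + 1) => K ‖a‖ ^ p) (g := fun a => K ‖a‖ ^ p) (by fun_prop) (by fun_prop)
        have q2 : ∫⁻ w : Euc (m + 1) × Euc (m + 1), (g ‖w.1‖ ‖w.2‖) ^ q = ∫⁻ z in ball 0 2, W z ^ q := by
          rw [← lintegral_indicator measurableSet_ball, ← hΦ.lintegral_comp ((hW.pow_const q).indicator measurableSet_ball)]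
          refine lintegral_congr fun w => ?_
          rw [← hgW]
          by_cases h : Φ w ∈ ball (0 : Euc N) 2
          · rw [indicator_of_mem h, indicator_of_mem h]
          · rw [indicator_of_notMem h, indicator_of_notMem h, ENNReal.zero_rpow_of_pos hpq.symm.pos]
        rw [q1, q2, mul_assoc (C * C)]

end Henon

namespace Henon
open Topology Metric
open scoped ENNReal
variable {N : ℕ}

lemma qf_smul (n : ℕ) (c : ℝ) (x : Euc N) : qf n (c • x) = c ^ 2 * qf n x := by
  unfold qf; rw [Finset.mul_sum]
  exact Finset.sum_congr rfl fun j _ => by rw [PiLp.smul_apply, smul_eq_mul]; ring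

lemma lint_scale {r : ℝ} (hr : 0 < r) {G : Euc N → ℝ≥0∞} (hG : Measurable G) :
    ∫⁻ z, G (r • z) = ENNReal.ofReal (r ^ (-(N:ℝ))) * ∫⁻ y, G y := by
  have h := Measure.map_addHaar_smul (volume : Measure (Euc N)) hr.ne'
  have h2 := lintegral_map hG (measurable_const_smul r) (μ := (volume : Measure (Euc N)))
  rw [h, lintegral_smul_measure] at h2
  rw [← h2, finrank_euclideanSpace, Fintype.card_fin, abs_of_pos (by positivity), rpow_neg hr.le, rpow_natCast]
  rfl

lemma near_est {m : ℕ} (hm : 1 ≤ m) (hN : N = 2 * m + 2) {p q α : ℝ} (hpq : p.HolderConjugate q) (hα : 0 < α) :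
    ∃ x : Euc N, ‖x‖ = 1 ∧ qf (m + 1) x = 0 ∧ ∃ C : ℝ≥0∞, C ≠ ⊤ ∧ ∀ v : Fn N, Continuous v → (∀ x, 0 ≤ v x) →
      Cone (m + 1) v → ∀ r : ℝ, 0 < r →
      ∫⁻ y in ball 0 (2 * r), ENNReal.ofReal (rad m (r • x - y)) * (ball 0 1).indicator (fun y => ENNReal.ofReal (‖y‖ ^ α * v y ^ (p - 1))) y
       ≤ C * ENNReal.ofReal (r ^ (-(2 * m : ℝ) + (N + α) / p)) * (∫⁻ y, ENNReal.ofReal (‖y‖ ^ α * v y ^ p) ∂mu N) ^ (1 / q) := by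
  obtain ⟨x, hx, hxq, C, hC, h⟩ := unit_est hm hN hpq
  have hp0 := hpq.pos
  have hq0 := hpq.symm.pos
  refine ⟨x, hx, hxq, C * ENNReal.ofReal (2 ^ (α / p)), ENNReal.mul_ne_top hC (by simp), fun v hv hv0 hvc r hr => ?_⟩
  set F : Euc N → ℝ≥0∞ := (ball 0 1).indicator (fun y => ENNReal.ofReal (‖y‖ ^ α * v y ^ (p - 1))) with hF
  have hFm : Measurable F := Measurable.indicator (by have := hv.measurable; fun_prop) measurableSet_ball
  have hrm := meas_rad (N := N) m
  set Dd := ∫⁻ y, ENNReal.ofReal (‖y‖ ^ α * v y ^ p) ∂mu N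
  have hs : ∀ G : Euc N → ℝ≥0∞, Measurable G → ∫⁻ z in ball 0 2, G (r • z) = ENNReal.ofReal (r ^ (-(N:ℝ))) * ∫⁻ y in ball 0 (2 * r), G y := fun G hG => by
    rw [← lintegral_indicator measurableSet_ball, ← lintegral_indicator measurableSet_ball, ← lint_scale hr (hG.indicator measurableSet_ball)]
    refine lintegral_congr fun z => ?_
    have : r • z ∈ ball (0 : Euc N) (2 * r) ↔ z ∈ ball (0 : Euc N) 2 := by
      rw [mem_ball_zero_iff, mem_ball_zero_iff, norm_smul, norm_eq_abs, abs_of_pos hr, mul_comm, mul_lt_mul_iff_left₀ hr]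
    by_cases hz : z ∈ ball (0 : Euc N) 2
    · rw [indicator_of_mem hz, indicator_of_mem (this.2 hz)]
    · rw [indicator_of_notMem hz, indicator_of_notMem (mt this.1 hz)]
  have h1 := hs (fun y => ENNReal.ofReal (rad m (r • x - y)) * F y) (by fun_prop)
  have h2 := h (fun z => F (r • z)) (by fun_prop) (fun y z hyz hq => by
    have hn : ‖r • y‖ = ‖r • z‖ := by rw [norm_smul, norm_smul, hyz]
    have hvv := hvc.eq hn (by rw [qf_smul, qf_smul, hq])
    simp only [hF, indicator, mem_ball_zero_iff, hn, hvv])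
  rw [hs (fun y => F y ^ q) (by fun_prop)] at h2
  have hrad : ∀ z, ENNReal.ofReal (rad m (r • x - r • z)) = ENNReal.ofReal (r ^ (-(2 * m : ℝ))) * ENNReal.ofReal (rad m (x - z)) := fun z => by
    rw [← ENNReal.ofReal_mul (by positivity), rad_eq, rad_eq, ← smul_sub, norm_smul, norm_eq_abs, abs_of_pos hr,
      mul_rpow hr.le (norm_nonneg _)]
  have h3 : ∫⁻ y in ball 0 (2 * r), F y ^ q ≤ ENNReal.ofReal ((2 * r) ^ (α * (q - 1))) * Dd := by
    have : ∫⁻ y in ball 0 (2 * r), F y ^ q ≤ ∫⁻ y in ball 0 (2 * r), (ball 0 1).indicator (fun y => ENNReal.ofReal ((2 * r) ^ (α * (q - 1))) * ENNReal.ofReal (‖y‖ ^ α * v y ^ p)) y := by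
      refine lintegral_mono_ae ?_
      filter_upwards [ae_restrict_mem measurableSet_ball] with y hy
      rw [mem_ball_zero_iff] at hy
      by_cases h1 : y ∈ ball (0 : Euc N) 1
      · rw [hF, indicator_of_mem h1, indicator_of_mem h1, ENNReal.ofReal_rpow_of_nonneg (mul_nonneg (by positivity) (rpow_nonneg (hv0 _) _)) hq0.le,
          ← ENNReal.ofReal_mul (by positivity)]
        refine ENNReal.ofReal_le_ofReal ?_
        rw [mul_rpow (by positivity) (rpow_nonneg (hv0 _) _), ← rpow_mul (norm_nonneg _), ← rpow_mul (hv0 _), hpq.sub_one_mul_conj,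
          ← mul_assoc]
        refine mul_le_mul_of_nonneg_right ?_ (rpow_nonneg (hv0 _) _)
        rw [show α * q = α * (q - 1) + α by ring, rpow_add' (norm_nonneg _) (by nlinarith [hpq.symm.lt])]
        refine mul_le_mul_of_nonneg_right (rpow_le_rpow (norm_nonneg _) hy.le (mul_nonneg hα.le (by linarith [hpq.symm.lt]))) (by positivity)
      · rw [hF, indicator_of_notMem h1, indicator_of_notMem h1, ENNReal.zero_rpow_of_pos hq0]
    refine this.trans ((setLIntegral_le_lintegral _ _).trans ?_)
    rw [lintegral_indicator measurableSet_ball, lintegral_const_mul _ (by have := hv.measurable; fun_prop)]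
    rfl
  simp only [hrad, mul_assoc] at h1
  rw [lintegral_const_mul _ (by fun_prop)] at h1
  have h4 : ∫⁻ y in ball 0 (2 * r), ENNReal.ofReal (rad m (r • x - y)) * F y = ENNReal.ofReal (r ^ (N : ℝ)) * (ENNReal.ofReal (r ^ (-(2 * m : ℝ))) * ∫⁻ z in ball 0 2, ENNReal.ofReal (rad m (x - z)) * F (r • z)) := by
    rw [h1, ← mul_assoc, ← ENNReal.ofReal_mul (by positivity), ← rpow_add hr, add_neg_cancel, rpow_zero, ENNReal.ofReal_one, one_mul]
  rw [h4]
  calc _ ≤ ENNReal.ofReal (r ^ (N : ℝ)) * (ENNReal.ofReal (r ^ (-(2 * m : ℝ))) * (C * (ENNReal.ofReal (r ^ (-(N:ℝ))) * (ENNReal.ofReal ((2 * r) ^ (α * (q - 1))) * Dd)) ^ (1 / q))) := by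
        gcongr
        exact h2.trans (by gcongr)
    _ = C * (ENNReal.ofReal (r ^ (N : ℝ)) * ENNReal.ofReal (r ^ (-(2 * m : ℝ))) * (ENNReal.ofReal (r ^ (-(N:ℝ))) ^ (1 / q) * ENNReal.ofReal ((2 * r) ^ (α * (q - 1))) ^ (1 / q))) * Dd ^ (1 / q) := by
        rw [ENNReal.mul_rpow_of_nonneg _ _ (by positivity), ENNReal.mul_rpow_of_nonneg _ _ (by positivity)]; ring
    _ = _ := by
        rw [mul_assoc C (ENNReal.ofReal _)]
        congr 2
        rw [ENNReal.ofReal_rpow_of_pos (by positivity), ENNReal.ofReal_rpow_of_pos (by positivity), ← ENNReal.ofReal_mul (by positivity),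
          ← ENNReal.ofReal_mul (by positivity), ← ENNReal.ofReal_mul (by positivity), ← ENNReal.ofReal_mul (by positivity)]
        congr 1
        have hq1 : α * (q - 1) * (1 / q) = α / p := by
          have := hpq.inv_add_inv_eq_one; field_simp at this ⊢; linarith
        rw [← rpow_mul hr.le, ← rpow_mul (by positivity), hq1, mul_rpow (by norm_num) hr.le, ← rpow_add hr,
          mul_left_comm (r ^ (-(N:ℝ) * _)), mul_left_comm, ← rpow_add hr, ← rpow_add hr]
        congr 2
        have := hpq.inv_add_inv_eq_one
        have h5 : 1 / q = 1 - 1 / p := by simp only [one_div]; linarith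
        rw [h5]; ring

def fv (α p : ℝ) (v : Fn N) (y : Euc N) : ℝ := ‖y‖ ^ α * v y ^ (p - 1)
def Dv (α p : ℝ) (v : Fn N) : ℝ := ∫ y, ‖y‖ ^ α * v y ^ p ∂mu N

lemma cont_wt {α c : ℝ} (hα : 0 < α) (hc : 0 ≤ c) {v : Fn N} (hv : Continuous v) :
    Continuous fun y => ‖y‖ ^ α * v y ^ c := (cont_nrpow hα.le).mul (hv.rpow_const fun _ => Or.inr hc)

lemma fv_nonneg {α p : ℝ} {v : Fn N} (h : ∀ x, 0 ≤ v x) (y : Euc N) : 0 ≤ fv α p v y :=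
  mul_nonneg (by positivity) (rpow_nonneg (h _) _)

lemma cone_fv {n : ℕ} {α p : ℝ} (hp : 2 < p) {v : Fn N} (h0 : ∀ x, 0 ≤ v x) (h : Cone n v) : Cone n (fv α p v) := fun x y hxy hq => by
  unfold fv; rw [hxy]
  exact mul_le_mul_of_nonneg_left (rpow_le_rpow (h0 _) (h x y hxy hq) (by linarith)) (by positivity)

lemma Dv_lint {α p : ℝ} (hα : 0 < α) (hp : 2 < p) {v : Fn N} (hv : Continuous v) (h0 : ∀ x, 0 ≤ v x) :
    ∫⁻ y, ENNReal.ofReal (‖y‖ ^ α * v y ^ p) ∂mu N = ENNReal.ofReal (Dv α p v) :=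
  (ofReal_integral_eq_lintegral_ofReal (int_cont (cont_wt hα (by linarith) hv))
    (ae_of_all _ fun y => mul_nonneg (by positivity) (rpow_nonneg (h0 _) _))).symm

lemma Dv_nonneg {α p : ℝ} {v : Fn N} (h0 : ∀ x, 0 ≤ v x) : 0 ≤ Dv α p v :=
  integral_nonneg fun y => mul_nonneg (by positivity) (rpow_nonneg (h0 _) _)

lemma D0 {m : ℕ} (hm : 1 ≤ m) (hN : N = 2 * m + 2) {p α e : ℝ} (hα : 0 < α) (hp : 2 < p) (he0 : 0 < e)
    (he : 2 * m - (N + α) / p < e) : ∃ C : ℝ, 0 ≤ C ∧ ∀ v : Fn N, Continuous v → (∀ x, 0 ≤ v x) →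
      Cone (m + 1) v → ∀ x, x ≠ 0 → Gop m (fv α p v) x ≤ C * ‖x‖ ^ (-e) * Dv α p v ^ ((p - 1) / p) := by
  set q := p / (p - 1)
  have hpq : p.HolderConjugate q := Real.HolderConjugate.conjExponent (by linarith)
  have hq1 : 1 / q = (p - 1) / p := by simp only [q]; rw [one_div_div]
  obtain ⟨x0, hx0, hxq, C1, hC1, h1⟩ := near_est hm hN hpq hα
  have hp0 : 0 < p := by linarith
  have hm' : (1 : ℝ) ≤ m := by exact_mod_cast hm
  set C2 := (∫⁻ y, ENNReal.ofReal (‖y‖ ^ ((e - 2 * m) * p + α)) ∂mu N) ^ (1 / p) with hC2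
  have hC2f : C2 ≠ ⊤ := by
    refine ENNReal.rpow_ne_top_of_nonneg (by positivity) ?_
    have : Integrable (fun y : Euc N => ‖y‖ ^ (-((2 * m - e) * p - α))) (mu N) := int_rpow_ball (by omega) (by
      have := (sub_lt_comm.1 he); rw [lt_div_iff₀ hp0] at this; linarith) 1
    have := this.lintegral_lt_top.ne
    convert this using 6; ring
  set K := C1 + ENNReal.ofReal (4 ^ m) * C2 with hK
  have hKf : K ≠ ⊤ := ENNReal.add_ne_top.2 ⟨hC1, ENNReal.mul_ne_top (by simp) hC2f⟩
  have hkap := kap_pos hN hm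
  refine ⟨(kap N m)⁻¹ * K.toReal, by positivity, fun v hv hv0 hvc x hx => ?_⟩
  have hfc : Continuous (fv α p v) := cont_wt hα (by linarith) hv
  have hf0 := fv_nonneg (α := α) (p := p) hv0
  set r := ‖x‖
  have hr : 0 < r := norm_pos_iff.2 hx
  have hDn := Dv_nonneg (α := α) (p := p) hv0
  rcases le_or_gt 1 r with hr1 | hr1
  · rw [Gop_zero _ hr1]; positivity
  have hcone := Gop_cone hN hm (by omega) hfc (cone_fv hp hv0 hvc) x (r • x0) (by rw [norm_smul, hx0, mul_one, norm_norm]) (by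
    rw [qf_smul, hxq, mul_zero, abs_zero]; positivity)
  refine hcone.trans ?_
  unfold Gop
  rw [mul_assoc, mul_assoc]
  refine mul_le_mul_of_nonneg_left ?_ (inv_nonneg.2 hkap.le)
  set F : Euc N → ℝ≥0∞ := fun y => ENNReal.ofReal (fv α p v y) with hF
  have hFm : Measurable F := by have := hfc.measurable; fun_prop
  have hrm := meas_rad (N := N) m
  set Dd := ENNReal.ofReal (Dv α p v)
  have main : ∫⁻ y, ENNReal.ofReal (rad m (r • x0 - y)) * F y ∂mu N ≤ K * ENNReal.ofReal (r ^ (-e)) * Dd ^ (1 / q) := by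
    have e1 : ∫⁻ y, ENNReal.ofReal (rad m (r • x0 - y)) * F y ∂mu N = ∫⁻ y, ENNReal.ofReal (rad m (r • x0 - y)) * (ball 0 1).indicator F y := by
      unfold mu; rw [← lintegral_indicator measurableSet_ball]
      refine lintegral_congr fun z => ?_
      by_cases h : z ∈ ball (0 : Euc N) 1 <;> simp [indicator, h]
    rw [e1, ← lintegral_add_compl _ (measurableSet_ball (x := (0 : Euc N)) (ε := 2 * r)), hK, add_mul, add_mul]
    refine add_le_add ?_ ?_
    · refine (h1 v hv hv0 hvc r hr).trans ?_
      rw [Dv_lint hα hp hv hv0]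
      gcongr C1 * ?_ * _
      exact ENNReal.ofReal_le_ofReal (rpow_le_rpow_of_exponent_ge hr hr1.le (by linarith))
    · set g1 : Euc N → ℝ≥0∞ := fun y => ENNReal.ofReal (‖y‖ ^ (e - 2 * m + α / p))
      set g2 : Euc N → ℝ≥0∞ := fun y => ENNReal.ofReal (‖y‖ ^ (α / q) * v y ^ (p - 1))
      have hg1 : Measurable g1 := by fun_prop
      have hg2 : Measurable g2 := by have := hv.measurable; fun_prop
      have hαpq : α / p + α / q = α := by
        have := hpq.inv_add_inv_eq_one; rw [div_eq_mul_inv, div_eq_mul_inv, ← mul_add, this, mul_one]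
      have hpt : ∀ y ∈ (ball (0 : Euc N) (2 * r))ᶜ, ENNReal.ofReal (rad m (r • x0 - y)) * (ball 0 1).indicator F y ≤
          (ball 0 1).indicator (fun y => ENNReal.ofReal (4 ^ m) * ENNReal.ofReal (r ^ (-e)) * (g1 y * g2 y)) y := fun y hy => by
        by_cases hb : y ∈ ball (0 : Euc N) 1
        swap
        · simp [hb]
        rw [indicator_of_mem hb, indicator_of_mem hb]
        have hy2 : 2 * r ≤ ‖y‖ := by simpa using hy
        have hy0 : 0 < ‖y‖ := by linarith
        simp only [hF, g1, g2]
        rw [← ENNReal.ofReal_mul (rad_nonneg _ _), ← ENNReal.ofReal_mul (by positivity), ← ENNReal.ofReal_mul (by positivity), ← ENNReal.ofReal_mul (by positivity)]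
        refine ENNReal.ofReal_le_ofReal ?_
        unfold fv
        rw [show 4 ^ m * r ^ (-e) * (‖y‖ ^ (e - 2 * m + α / p) * (‖y‖ ^ (α / q) * v y ^ (p - 1))) =
          (4 ^ m * r ^ (-e) * ‖y‖ ^ (e - 2 * m)) * ((‖y‖ ^ (α / p) * ‖y‖ ^ (α / q)) * v y ^ (p - 1)) by rw [rpow_add hy0]; ring,
          ← rpow_add hy0, hαpq]
        refine mul_le_mul_of_nonneg_right ?_ (mul_nonneg (by positivity) (rpow_nonneg (hv0 _) _))
        have hd : ‖y‖ / 2 ≤ ‖r • x0 - y‖ := by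
          have := norm_sub_norm_le y (r • x0)
          rw [norm_smul, hx0, mul_one, norm_eq_abs, abs_of_pos hr, norm_sub_rev] at this
          linarith
        have k1 : rad m (r • x0 - y) ≤ 4 ^ m * ‖y‖ ^ (-(2 * m : ℝ)) := by
          rw [show (4:ℝ) ^ m * ‖y‖ ^ (-(2 * m : ℝ)) = (((‖y‖ / 2) ^ 2) ^ m)⁻¹ by
            rw [rpow_neg hy0.le, show (2 * m : ℝ) = ((2 * m : ℕ) : ℝ) by push_cast; rfl, rpow_natCast, div_pow, div_pow, pow_mul]
            field_simp; norm_num]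
          unfold rad
          gcongr
        refine k1.trans ?_
        rw [mul_assoc, show e - 2 * m = -(2 * m : ℝ) + e by ring, rpow_add hy0, mul_left_comm (r ^ (-e))]
        refine mul_le_mul_of_nonneg_left (le_mul_of_one_le_right (by positivity) ?_) (by positivity)
        rw [rpow_neg hr.le, ← div_eq_inv_mul, one_le_div (by positivity)]
        exact rpow_le_rpow hr.le (by linarith) he0.le
      refine (setLIntegral_mono' measurableSet_ball.compl hpt).trans ((setLIntegral_le_lintegral _ _).trans ?_)
      rw [lintegral_indicator measurableSet_ball, lintegral_const_mul _ (by fun_prop)]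
      have hH := ENNReal.lintegral_mul_le_Lp_mul_Lq (mu N) hpq hg1.aemeasurable hg2.aemeasurable
      have i1 : ∫⁻ y, g1 y ^ p ∂mu N = ∫⁻ y, ENNReal.ofReal (‖y‖ ^ ((e - 2 * m) * p + α)) ∂mu N := lintegral_congr fun y => by
        rw [ENNReal.ofReal_rpow_of_nonneg (by positivity) hp0.le, ← rpow_mul (norm_nonneg _)]
        congr 2; field_simp
      have i2 : ∫⁻ y, g2 y ^ q ∂mu N = Dd := by
        refine Eq.trans ?_ (Dv_lint hα hp hv hv0)
        refine lintegral_congr fun y => ?_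
        rw [ENNReal.ofReal_rpow_of_nonneg (mul_nonneg (by positivity) (rpow_nonneg (hv0 _) _)) hpq.symm.nonneg,
          mul_rpow (by positivity) (rpow_nonneg (hv0 _) _), ← rpow_mul (norm_nonneg _), ← rpow_mul (hv0 _), hpq.sub_one_mul_conj,
          div_mul_cancel₀ _ hpq.symm.ne_zero]
      rw [i1, i2] at hH
      refine (mul_le_mul_right hH _).trans (le_of_eq ?_)
      rw [← hC2]; ring
  have hRi : Integrable (fun y => rad m (r • x0 - y) * fv α p v y) (mu N) := by
    obtain ⟨M, -, hM⟩ := bdd_of_cont hfc 1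
    refine (int_rad hN _).mul_bdd (c := M) hfc.aestronglyMeasurable (ae_mu fun y hy => hM y (by simpa using hy.le))
  have e2 : ∫ y, gk m (r • x0) y * fv α p v y ∂mu N ≤ ∫ y, rad m (r • x0 - y) * fv α p v y ∂mu N := by
    refine integral_mono (int_gk_mul hN _ hfc) hRi fun y => mul_le_mul_of_nonneg_right (gk_le_rad _ _ _) (hf0 y)
  refine e2.trans ?_
  rw [integral_eq_lintegral_of_nonneg_ae (ae_of_all _ fun y => mul_nonneg (rad_nonneg _ _) (hf0 y)) hRi.1]
  simp only [ENNReal.ofReal_mul (rad_nonneg m _)]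
  refine (ENNReal.toReal_mono ?_ main).trans (le_of_eq ?_)
  · exact ENNReal.mul_ne_top (ENNReal.mul_ne_top hKf (by simp)) (ENNReal.rpow_ne_top_of_nonneg (by have := hpq.symm.pos; positivity) (by simp [Dd]))
  · rw [ENNReal.toReal_mul, ENNReal.toReal_mul, ENNReal.toReal_ofReal (by positivity), ← ENNReal.toReal_rpow, ENNReal.toReal_ofReal hDn, hq1, mul_assoc]

end Henon

namespace Henon
open Topology Metric
open scoped ENNReal
variable {N : ℕ}

lemma riesz_unit {m : ℕ} (hN : N = 2 * m + 2) {c : ℝ} (hc : 2 < c) (hcN : c < N) :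
    ∃ C : ℝ≥0∞, C ≠ ⊤ ∧ ∀ x : Euc N, ‖x‖ = 1 → ∫⁻ z, ENNReal.ofReal (rad m (x - z)) * ENNReal.ofReal (‖z‖ ^ (-c)) ≤ C := by
  set f1 : Fn N := (ball 0 1).indicator fun z => ‖z‖ ^ (-c)
  set f2 : Fn N := (ball 0 1)ᶜ.indicator fun z => ‖z‖ ^ (-(2 * m + c))
  set f3 : Fn N := (ball 0 3).indicator (rad m)
  have hNr : (N : ℝ) = 2 * m + 2 := by rw [hN]; push_cast; ring
  have i1 : Integrable f1 := (int_rpow_ball (by omega) hcN 1).integrable_indicator measurableSet_ball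
  have i2 : Integrable f2 := (int_rpow_compl (by omega) (by linarith) one_pos).integrable_indicator measurableSet_ball.compl
  have i3 : Integrable f3 := (int_rad_ball hN 3).integrable_indicator measurableSet_ball
  have p1 : ∀ z, 0 ≤ f1 z := fun z => indicator_nonneg (fun _ _ => by positivity) z
  have p2 : ∀ z, 0 ≤ f2 z := fun z => indicator_nonneg (fun _ _ => by positivity) z
  have p3 : ∀ z, 0 ≤ f3 z := fun z => indicator_nonneg (fun _ _ => rad_nonneg _ _) z
  refine ⟨ENNReal.ofReal (∫ z, (4 ^ m * f1 z + 4 ^ m * f2 z)) + ENNReal.ofReal (∫ z, 2 ^ c * f3 z), by simp, fun x hx => ?_⟩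
  have key : ∀ z, ENNReal.ofReal (rad m (x - z)) * ENNReal.ofReal (‖z‖ ^ (-c)) ≤
      ENNReal.ofReal (4 ^ m * f1 z + 4 ^ m * f2 z) + ENNReal.ofReal (2 ^ c * f3 (x - z)) := fun z => by
    have q1 := p1 z; have q2 := p2 z; have q3 := p3 (x - z)
    rw [← ENNReal.ofReal_add (by positivity) (by positivity), ← ENNReal.ofReal_mul (rad_nonneg _ _)]
    refine ENNReal.ofReal_le_ofReal ?_
    have hr : ∀ t > 0, t ≤ ‖x - z‖ → rad m (x - z) ≤ ((t ^ 2) ^ m)⁻¹ := fun t ht h => by unfold rad; gcongr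
    rcases le_or_gt ‖z‖ (1 / 2) with h | h
    · have e1 : f1 z = ‖z‖ ^ (-c) := indicator_of_mem (by rw [mem_ball_zero_iff]; linarith) _
      have := hr (1 / 2) (by norm_num) (by linarith [norm_sub_norm_le x z])
      rw [show (((1 / 2 : ℝ) ^ 2) ^ m)⁻¹ = 4 ^ m by rw [← inv_pow]; norm_num] at this
      have := mul_le_mul_of_nonneg_right this (show 0 ≤ ‖z‖ ^ (-c) by positivity)
      rw [← e1] at this ⊢
      nlinarith [mul_nonneg (show (0:ℝ) ≤ 4 ^ m by positivity) q2, mul_nonneg (show (0:ℝ) ≤ 2 ^ c by positivity) q3]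
    rcases le_or_gt 2 ‖z‖ with h2 | h2
    · have hz : 0 < ‖z‖ := by linarith
      have e1 : f2 z = ‖z‖ ^ (-(2 * m + c)) := indicator_of_mem (by rw [mem_compl_iff, mem_ball_zero_iff]; linarith) _
      have := hr (‖z‖ / 2) (by linarith) (by have := norm_sub_norm_le z x; rw [norm_sub_rev] at this; linarith)
      have := mul_le_mul_of_nonneg_right this (show 0 ≤ ‖z‖ ^ (-c) by positivity)
      have e2 : (((‖z‖ / 2) ^ 2) ^ m)⁻¹ * ‖z‖ ^ (-c) = 4 ^ m * f2 z := by
        rw [e1, show -(2 * m + c) = -(2 * m : ℝ) + -c by ring, rpow_add hz, rpow_neg hz.le (2 * m), show (2 * m : ℝ) = ((2 * m : ℕ) : ℝ) by push_cast; rfl,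
          rpow_natCast, div_pow, div_pow, pow_mul]
        field_simp; norm_num
      nlinarith [mul_nonneg (show (0:ℝ) ≤ 4 ^ m by positivity) q1, mul_nonneg (show (0:ℝ) ≤ 2 ^ c by positivity) q3]
    · have e1 : f3 (x - z) = rad m (x - z) := indicator_of_mem (by rw [mem_ball_zero_iff]; linarith [norm_sub_le x z]) _
      have : ‖z‖ ^ (-c) ≤ 2 ^ c := by
        rw [show (2:ℝ) ^ c = (1 / 2) ^ (-c) by rw [rpow_neg (by norm_num), ← inv_rpow (by norm_num)]; norm_num]
        exact rpow_le_rpow_of_nonpos (by norm_num) h.le (by linarith)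
      rw [e1]
      nlinarith [mul_nonneg (show (0:ℝ) ≤ 4 ^ m by positivity) q1, mul_nonneg (show (0:ℝ) ≤ 4 ^ m by positivity) q2, mul_le_mul_of_nonneg_left this (rad_nonneg m (x - z))]
  refine (lintegral_mono key).trans ?_
  have hs : Integrable fun z => 4 ^ m * f1 z + 4 ^ m * f2 z := (i1.const_mul _).add (i2.const_mul _)
  rw [lintegral_add_left' hs.1.aemeasurable.ennreal_ofReal, lintegral_sub_left_eq_self (fun z => ENNReal.ofReal (2 ^ c * f3 z)) x,
    ← ofReal_integral_eq_lintegral_ofReal hs (ae_of_all _ fun z => add_nonneg (mul_nonneg (by positivity) (p1 z)) (mul_nonneg (by positivity) (p2 z))),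
    ← ofReal_integral_eq_lintegral_ofReal (i3.const_mul _) (ae_of_all _ fun z => mul_nonneg (by positivity) (p3 z))]

lemma riesz {m : ℕ} (hm : 1 ≤ m) (hN : N = 2 * m + 2) {c : ℝ} (hc : 2 < c) (hcN : c < N) :
    ∃ C : ℝ, 0 ≤ C ∧ ∀ f : Fn N, Continuous f → (∀ y, 0 ≤ f y) → (∀ y, y ≠ 0 → ‖y‖ < 1 → f y ≤ ‖y‖ ^ (-c)) →
      ∀ x, x ≠ 0 → Gop m f x ≤ C * ‖x‖ ^ (-(c - 2)) := by
  obtain ⟨C, hC, h⟩ := riesz_unit hN hc hcN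
  have hkap := kap_pos hN hm
  have hNr : (N : ℝ) = 2 * m + 2 := by rw [hN]; push_cast; ring
  refine ⟨(kap N m)⁻¹ * C.toReal, by positivity, fun f hf hf0 hfc x hx => ?_⟩
  unfold Gop
  rw [mul_assoc]
  refine mul_le_mul_of_nonneg_left ?_ (inv_nonneg.2 hkap.le)
  set r := ‖x‖
  have hr : 0 < r := norm_pos_iff.2 hx
  have hrm := meas_rad (N := N) m
  rw [integral_eq_lintegral_of_nonneg_ae (ae_of_all _ fun y => mul_nonneg (gk_nonneg _ _ _) (hf0 y)) (int_gk_mul hN x hf).1]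
  have h1 : ∫⁻ y, ENNReal.ofReal (gk m x y * f y) ∂mu N ≤ ∫⁻ y, ENNReal.ofReal (rad m (x - y)) * ENNReal.ofReal (‖y‖ ^ (-c)) := by
    refine (lintegral_mono_ae ?_).trans (setLIntegral_le_lintegral (ball 0 1) _)
    filter_upwards [ae_ne hN 0, ae_mu (fun y hy => hy)] with y h0 hy
    rw [← ENNReal.ofReal_mul (rad_nonneg _ _)]
    exact ENNReal.ofReal_le_ofReal (mul_le_mul (gk_le_rad _ _ _) (hfc y h0.symm hy) (hf0 y) (rad_nonneg _ _))
  have h2 := lint_scale hr (G := fun y => ENNReal.ofReal (rad m (x - y)) * ENNReal.ofReal (‖y‖ ^ (-c))) (by fun_prop)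
  have h3 : ∀ z, ENNReal.ofReal (rad m (x - r • z)) * ENNReal.ofReal (‖r • z‖ ^ (-c)) = ENNReal.ofReal (r ^ (-(2 * m + c))) *
      (ENNReal.ofReal (rad m (r⁻¹ • x - z)) * ENNReal.ofReal (‖z‖ ^ (-c))) := fun z => by
    rw [← ENNReal.ofReal_mul (rad_nonneg _ _), ← ENNReal.ofReal_mul (rad_nonneg _ _), ← ENNReal.ofReal_mul (by positivity), rad_eq, rad_eq,
      show x - r • z = r • (r⁻¹ • x - z) by rw [smul_sub, smul_inv_smul₀ hr.ne'], norm_smul, norm_smul, norm_eq_abs, abs_of_pos hr,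
      mul_rpow hr.le (norm_nonneg _), mul_rpow hr.le (norm_nonneg _), neg_add, rpow_add hr]
    congr 1; ring
  simp only [h3] at h2
  rw [lintegral_const_mul _ (by fun_prop)] at h2
  have h4 := h (r⁻¹ • x) (by rw [norm_smul, norm_inv, norm_norm, inv_mul_cancel₀ hr.ne'])
  have h5 : ∫⁻ y, ENNReal.ofReal (rad m (x - y)) * ENNReal.ofReal (‖y‖ ^ (-c)) ≤ C * ENNReal.ofReal (r ^ (-(c - 2))) := by
    have : ∫⁻ y, ENNReal.ofReal (rad m (x - y)) * ENNReal.ofReal (‖y‖ ^ (-c)) = ENNReal.ofReal (r ^ (N : ℝ)) * (ENNReal.ofReal (r ^ (-(N:ℝ))) * ∫⁻ y, ENNReal.ofReal (rad m (x - y)) * ENNReal.ofReal (‖y‖ ^ (-c))) := by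
      rw [← mul_assoc, ← ENNReal.ofReal_mul (by positivity), ← rpow_add hr, add_neg_cancel, rpow_zero, ENNReal.ofReal_one, one_mul]
    rw [this, ← h2, ← mul_assoc, ← ENNReal.ofReal_mul (by positivity), ← rpow_add hr, mul_comm]
    rw [show (N:ℝ) + -(2 * m + c) = -(c - 2) by rw [hNr]; ring]
    gcongr
  refine (ENNReal.toReal_mono (ENNReal.mul_ne_top hC (by simp)) (h1.trans h5)).trans (le_of_eq ?_)
  rw [ENNReal.toReal_mul, ENNReal.toReal_ofReal (by positivity)]

end Henon

namespace Henon
open Topology Metric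
variable {N : ℕ}

structure Par (N m : ℕ) (α p : ℝ) : Prop where
  hN : N = 2 * m + 2
  hm : 1 ≤ m
  hα : 0 < α
  hp : 2 < p
  hc : m * p < N + α

structure Adm (m : ℕ) (v : Fn N) : Prop where
  cont : Continuous v
  nn : ∀ x, 0 ≤ v x
  cone : Cone (m + 1) v

def Tv (m : ℕ) (α p : ℝ) (v : Fn N) : Fn N := Gop m (fv α p v)
def Jv (m : ℕ) (α p : ℝ) (v : Fn N) : ℝ := Jf m (fv α p v)

def Nv (m : ℕ) (α p : ℝ) (v : Fn N) : Fn N := fun y => (Dv α p (Tv m α p v) ^ (1 / p))⁻¹ * Tv m α p v y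

lemma young {p w z : ℝ} (hp : 1 < p) (hw : 0 ≤ w) (hz : 0 ≤ z) :
    p * (w ^ (p - 1) * z) ≤ (p - 1) * w ^ p + z ^ p ∧ (p * (w ^ (p - 1) * z) = (p - 1) * w ^ p + z ^ p → z = w) := by
  rcases hw.eq_or_lt with rfl | hw
  · rw [zero_rpow (by linarith), zero_rpow (by linarith)]
    refine ⟨by have := rpow_nonneg hz p; linarith, fun h => ?_⟩
    exact (rpow_eq_zero hz (show p ≠ 0 by linarith)).1 (by linarith)
  have e : w ^ (p - 1) * w = w ^ p := by rw [← rpow_add_one hw.ne', sub_add_cancel]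
  have hwp : 0 < w ^ p := rpow_pos_of_pos hw _
  by_cases h : z = w
  · subst h; exact ⟨by rw [e]; linarith, fun _ => rfl⟩
  have hzw : 0 ≤ z / w := by positivity
  have := one_add_mul_self_lt_rpow_one_add (s := z / w - 1) (by linarith) (by
    intro h'; exact h ((div_eq_one_iff_eq hw.ne').1 (by linarith))) hp
  rw [add_sub_cancel, div_rpow hz hw.le, lt_div_iff₀ hwp] at this
  have e2 : (1 + p * (z / w - 1)) * w ^ p = p * (w ^ (p - 1) * z) - (p - 1) * w ^ p := by
    rw [← e]; field_simp; ring
  exact ⟨by linarith, fun h' => by linarith⟩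

lemma int_zero {g : Fn N} (hg : Continuous g) (h0 : ∀ x, 0 ≤ g x) (h : ∫ x, g x ∂mu N ≤ 0) (x : Euc N) (hx : ‖x‖ < 1) : g x = 0 := by
  have h1 := (integral_eq_zero_iff_of_nonneg h0 (int_cont hg)).1 (le_antisymm h (integral_nonneg h0))
  exact Measure.eqOn_open_of_ae_eq (g := 0) h1 isOpen_ball hg.continuousOn continuousOn_const (by simpa using hx)

variable {m : ℕ} {α p : ℝ}

lemma fv_smul {c : ℝ} (hc : 0 ≤ c) {v : Fn N} (hv : ∀ x, 0 ≤ v x) : fv α p (fun y => c * v y) = fun y => c ^ (p - 1) * fv α p v y := by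
  ext y; unfold fv; rw [mul_rpow hc (hv y)]; ring

lemma Dv_smul {c : ℝ} (hc : 0 ≤ c) {v : Fn N} (hv : ∀ x, 0 ≤ v x) : Dv α p (fun y => c * v y) = c ^ p * Dv α p v := by
  unfold Dv; rw [← integral_const_mul]; congr 1; ext y; rw [mul_rpow hc (hv y)]; ring

lemma Jv_smul {c : ℝ} (hc : 0 ≤ c) {v : Fn N} (hv : ∀ x, 0 ≤ v x) : Jv m α p (fun y => c * v y) = (c ^ (p - 1)) ^ 2 * Jv m α p v := by
  unfold Jv Jf; rw [fv_smul hc hv, ← integral_const_mul]; congr 1; ext y; rw [Gop_smul]; ring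

lemma Tv_smul {c : ℝ} (hc : 0 ≤ c) {v : Fn N} (hv : ∀ x, 0 ≤ v x) (x : Euc N) : Tv m α p (fun y => c * v y) x = c ^ (p - 1) * Tv m α p v x := by
  unfold Tv; rw [fv_smul hc hv, Gop_smul]

lemma Adm.smul {v : Fn N} (h : Adm m v) {c : ℝ} (hc : 0 ≤ c) : Adm m (fun y => c * v y) :=
  ⟨h.cont.const_mul c, fun x => mul_nonneg hc (h.nn x), fun x y h1 h2 => mul_le_mul_of_nonneg_left (h.cone x y h1 h2) hc⟩

lemma Dv_eq {v : Fn N} (h : ∀ x, 0 ≤ v x) (hp : 2 < p) : Dv α p v = ∫ x, fv α p v x * v x ∂mu N := by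
  unfold Dv fv; congr 1; ext y; rw [mul_assoc]; congr 1
  rcases (h y).eq_or_lt with h0 | h0
  · rw [← h0, zero_rpow (by linarith), mul_zero]
  · rw [← rpow_add_one h0.ne', sub_add_cancel]

namespace Par

lemma cfv (P : Par N m α p) {v : Fn N} (hv : Continuous v) : Continuous (fv α p v) := cont_wt P.hα (by linarith [P.hp]) hv

lemma adm_T (P : Par N m α p) {v : Fn N} (h : Adm m v) : Adm m (Tv m α p v) :=
  ⟨Gop_cont P.hN P.hm (P.cfv h.cont), Gop_nonneg P.hN P.hm fun y _ => fv_nonneg h.nn y,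
    Gop_cone P.hN P.hm (by have := P.hN; omega) (P.cfv h.cont) (cone_fv P.hp h.nn h.cone)⟩

lemma young_int (P : Par N m α p) {w z : Fn N} (hw : Adm m w) (hz : Adm m z) :
    p * ∫ x, fv α p w x * z x ∂mu N ≤ (p - 1) * Dv α p w + Dv α p z ∧
    (p * ∫ x, fv α p w x * z x ∂mu N = (p - 1) * Dv α p w + Dv α p z → ∀ x : Euc N, ‖x‖ < 1 → z x = w x) := by
  have hp := P.hp
  have c1 : Continuous fun x => fv α p w x * z x := (P.cfv hw.cont).mul hz.cont
  have c2 := cont_wt (c := p) P.hα (by linarith) hw.cont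
  have c3 := cont_wt (c := p) P.hα (by linarith) hz.cont
  let g : Fn N := fun x => ((p - 1) * (‖x‖ ^ α * w x ^ p) + ‖x‖ ^ α * z x ^ p) - p * (fv α p w x * z x)
  have hgc : Continuous g := ((c2.const_mul _).add c3).sub (c1.const_mul p)
  have hge : ∀ x, g x = ‖x‖ ^ α * ((p - 1) * w x ^ p + z x ^ p - p * (w x ^ (p - 1) * z x)) := fun x => by simp only [g, fv]; ring
  have hg0 : ∀ x, 0 ≤ g x := fun x => by
    rw [hge]; exact mul_nonneg (by positivity) (sub_nonneg.2 (young (by linarith) (hw.nn x) (hz.nn x)).1)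
  have hgi : ∫ x, g x ∂mu N = (p - 1) * Dv α p w + Dv α p z - p * ∫ x, fv α p w x * z x ∂mu N := by
    simp only [g, Dv]
    rw [integral_sub (f := fun x => (p - 1) * (‖x‖ ^ α * w x ^ p) + ‖x‖ ^ α * z x ^ p) (((int_cont c2).const_mul _).add (int_cont c3))
      ((int_cont c1).const_mul p), integral_add ((int_cont c2).const_mul _) (int_cont c3),
      integral_const_mul, integral_const_mul]
  refine ⟨by linarith [integral_nonneg (μ := mu N) (f := g) hg0], fun he => ?_⟩
  have h1 : EqOn z w (ball 0 1 \ {0}) := fun x hx => by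
    have := int_zero hgc hg0 (by linarith) x (by simpa using hx.1)
    rw [hge, mul_eq_zero] at this
    have h0 : 0 < ‖x‖ ^ α := rpow_pos_of_pos (norm_pos_iff.2 hx.2) _
    exact (young (p := p) (by linarith) (hw.nn x) (hz.nn x)).2 (by rcases this with h | h <;> linarith)
  have := P.hN
  have := nontriv (N := N) (by omega)
  have h2 := h1.of_subset_closure hz.cont.continuousOn hw.cont.continuousOn (t := ball 0 1) sdiff_subset
    ((dense_compl_singleton (0 : Euc N)).open_subset_closure_inter isOpen_ball)
  exact fun x hx => h2 (by simpa using hx)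

lemma T_pos (P : Par N m α p) {v : Fn N} (h : Adm m v) (hD : 0 < Dv α p v) {x : Euc N} (hx : ‖x‖ < 1) : 0 < Tv m α p v x := by
  have : ∃ y : Euc N, ‖y‖ < 1 ∧ 0 < fv α p v y := by
    by_contra! hc
    rw [Dv_eq h.nn P.hp] at hD
    refine hD.ne' ?_
    refine integral_eq_zero_of_ae (ae_mu fun y hy => ?_)
    simp [le_antisymm (hc y hy) (fv_nonneg h.nn y)]
  obtain ⟨y, hy, h0⟩ := this
  exact Gop_pos P.hN P.hm (P.cfv h.cont) (fun y _ => fv_nonneg h.nn y) hy h0 hx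

lemma D_pos (P : Par N m α p) {v : Fn N} (h : Adm m v) (hp : ∀ x : Euc N, ‖x‖ < 1 → 0 < v x) : 0 < Dv α p v := by
  have := P.hN
  have := nontriv (N := N) (by omega)
  obtain ⟨y, hy⟩ := NormedSpace.exists_lt_norm ℝ (Euc N) 0
  by_contra! hD
  have hn : ‖(2 * ‖y‖)⁻¹ • y‖ = 1 / 2 := by rw [norm_smul, norm_inv, norm_mul, norm_norm]; simp; field_simp
  have := int_zero (cont_wt (c := p) P.hα (by linarith [P.hp]) h.cont) (fun x => mul_nonneg (by positivity) (rpow_nonneg (h.nn x) _)) hD _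
    (hn.trans_lt (by norm_num))
  have h1 := rpow_pos_of_pos (hp ((2 * ‖y‖)⁻¹ • y) (hn.trans_lt (by norm_num))) p
  rw [hn] at this
  have h2 : (0:ℝ) < (1 / 2) ^ α := by positivity
  exact (mul_pos h2 h1).ne' this

lemma J_le (P : Par N m α p) {v : Fn N} (h : Adm m v) (hD : Dv α p v = 1) : 0 < Dv α p (Tv m α p v) ∧ Jv m α p v ≤ Dv α p (Tv m α p v) ^ (1 / p) ∧
    (Jv m α p v = Dv α p (Tv m α p v) ^ (1 / p) → ∀ x : Euc N, ‖x‖ < 1 → Tv m α p v x = Jv m α p v * v x) := by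
  have hp := P.hp
  have hT := P.adm_T h
  have h0 := P.D_pos hT fun x hx => P.T_pos h (by linarith) hx
  set D := Dv α p (Tv m α p v)
  set d := D ^ (1 / p) with hd
  have hd0 : 0 < d := rpow_pos_of_pos h0 _
  have hdp : d ^ p = D := by rw [hd, ← rpow_mul h0.le, one_div_mul_cancel (by linarith), rpow_one]
  have hz := hT.smul (inv_nonneg.2 hd0.le)
  have hDz : Dv α p (fun y => d⁻¹ * Tv m α p v y) = 1 := by
    rw [Dv_smul (inv_nonneg.2 hd0.le) hT.nn, inv_rpow hd0.le, hdp, inv_mul_cancel₀ h0.ne']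
  have hI : ∫ x, fv α p v x * (d⁻¹ * Tv m α p v x) ∂mu N = d⁻¹ * Jv m α p v := by
    unfold Jv Jf; rw [← integral_const_mul]; congr 1; ext x; unfold Tv; ring
  have hy := P.young_int h hz
  rw [hI, hDz, hD] at hy
  refine ⟨h0, ?_, fun he x hx => ?_⟩
  · have := le_of_mul_le_mul_left (a := p) (b := d⁻¹ * Jv m α p v) (c := 1) (by linarith [hy.1]) (by linarith)
    rwa [inv_mul_le_iff₀ hd0, mul_one] at this
  · have h3 : ∀ x : Euc N, ‖x‖ < 1 → d⁻¹ * Tv m α p v x = v x := by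
      exact hy.2 (by rw [he, inv_mul_cancel₀ hd0.ne']; ring)
    rw [← h3 x hx, he, mul_inv_cancel_left₀ hd0.ne']

lemma step (P : Par N m α p) {v : Fn N} (h : Adm m v) (hD : Dv α p v = 1) : Adm m (Nv m α p v) ∧ Dv α p (Nv m α p v) = 1 ∧ Jv m α p v ≤ Jv m α p (Nv m α p v) ∧
    Dv α p (Tv m α p v) ^ (1 / p) ≤ √(Jv m α p v) * √(Jv m α p (Nv m α p v)) := by
  have hp := P.hp
  obtain ⟨h0, hJ, -⟩ := P.J_le h hD
  have hT := P.adm_T h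
  set D := Dv α p (Tv m α p v) with hDd
  set d := D ^ (1 / p) with hd
  have hd0 : 0 < d := rpow_pos_of_pos h0 _
  have hdp : d ^ p = D := by rw [hd, ← rpow_mul h0.le, one_div_mul_cancel (by linarith), rpow_one]
  have hz : Adm m (Nv m α p v) := hT.smul (inv_nonneg.2 hd0.le)
  refine ⟨hz, ?_, ?_⟩
  · unfold Nv; rw [← hDd, ← hd, Dv_smul (inv_nonneg.2 hd0.le) hT.nn, inv_rpow hd0.le, hdp, inv_mul_cancel₀ h0.ne']
  have eT : Tv m α p v = fun y => d * Nv m α p v y := by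
    ext y; unfold Nv; rw [← hDd, ← hd, mul_inv_cancel_left₀ hd0.ne']
  have hJ0 := Jf_nonneg P.hN P.hm (fv_nonneg (α := α) (p := p) h.nn)
  change 0 ≤ Jv m α p v at hJ0
  have hJ1 := Jf_nonneg P.hN P.hm (fv_nonneg (α := α) (p := p) hz.nn)
  change 0 ≤ Jv m α p (Nv m α p v) at hJ1
  have h1 : D ≤ √(Jv m α p v) * √(Jv m α p (Tv m α p v)) := by
    rw [hDd, Dv_eq hT.nn hp]
    exact Jf_cs P.hN P.hm (P.cfv h.cont) (fv_nonneg h.nn) (P.cfv hT.cont) (fv_nonneg hT.nn)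
  have hdp1 : 0 < d ^ (p - 1) := rpow_pos_of_pos hd0 _
  rw [eT, Jv_smul hd0.le hz.nn, sqrt_mul (by positivity), sqrt_sq hdp1.le, ← hdp] at h1
  have e : d ^ (p - 1) * d = d ^ p := by rw [← rpow_add_one hd0.ne', sub_add_cancel]
  rw [← e] at h1
  have h2 : d ≤ √(Jv m α p v) * √(Jv m α p (Nv m α p v)) := le_of_mul_le_mul_left (by linarith) hdp1
  refine ⟨?_, h2⟩
  by_contra! hlt
  have h3 := mul_self_sqrt hJ0
  have h4 := sqrt_lt_sqrt hJ1 hlt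
  have h5 : 0 < √(Jv m α p v) := (sqrt_nonneg _).trans_lt h4
  nlinarith

end Par
end Henon

namespace Henon
open Topology Metric
variable {N : ℕ}

def Bd (A b : ℝ) (v : Fn N) : Prop := ∀ y : Euc N, y ≠ 0 → ‖y‖ < 1 → v y ≤ A * ‖y‖ ^ (-b)

lemma compact_seq {F : ℕ → Fn N} {M : ℝ} (hM : ∀ j x, |F j x| ≤ M) (h0 : ∀ j x, 1 ≤ ‖x‖ → F j x = 0)
    (hE : ∀ x, ∀ ε > 0, ∀ᶠ x' in 𝓝 x, ∀ j, |F j x' - F j x| < ε) :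
    ∃ φ : ℕ → ℕ, StrictMono φ ∧ ∃ w : Fn N, Continuous w ∧ ∀ x, Tendsto (fun k => F (φ k) x) atTop (𝓝 (w x)) := by
  have hc : ∀ j, Continuous (F j) := fun j => continuous_iff_continuousAt.2 fun x =>
    Metric.tendsto_nhds.2 fun ε hε => (hE x ε hε).mono fun x' h => h j
  let G : ℕ → BoundedContinuousFunction (closedBall (0 : Euc N) 1) ℝ := fun j =>
    BoundedContinuousFunction.mkOfCompact ⟨fun x => F j x, (hc j).comp continuous_subtype_val⟩
  have hK := BoundedContinuousFunction.arzela_ascoli (closedBall (0:ℝ) M) (isCompact_closedBall _ _) (range G) (by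
    rintro _ x ⟨j, rfl⟩; simpa [G] using hM j x) (by
    intro x
    rw [Metric.equicontinuousAt_iff_right]
    intro ε hε
    filter_upwards [continuous_subtype_val.continuousAt.eventually (hE x ε hε)] with x' h
    rintro ⟨_, j, rfl⟩
    rw [dist_comm]; exact h j)
  obtain ⟨g, -, φ, hφ, hg⟩ := hK.tendsto_subseq fun j => subset_closure (mem_range_self j)
  have hw : ∀ x, ∃ y, Tendsto (fun k => F (φ k) x) atTop (𝓝 y) := fun x => by
    by_cases h : ‖x‖ ≤ 1
    · exact ⟨_, (BoundedContinuousFunction.tendsto_iff_tendstoUniformly.1 hg).tendsto_at ⟨x, by simpa using h⟩⟩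
    · exact ⟨0, by simp only [h0 _ x (not_le.1 h).le]; exact tendsto_const_nhds⟩
  choose w hw using hw
  refine ⟨φ, hφ, w, continuous_iff_continuousAt.2 fun x => Metric.tendsto_nhds.2 fun ε hε => ?_, hw⟩
  filter_upwards [hE x (ε / 2) (by positivity)] with x' h
  refine lt_of_le_of_lt (b := ε / 2) ?_ (by linarith)
  rw [dist_eq]
  exact le_of_tendsto' ((hw x').sub (hw x)).abs fun k => (h _).le

namespace Par
variable {m : ℕ} {α p : ℝ}

lemma exp (P : Par N m α p) : ∃ e, 0 < e ∧ 2 * m - (N + α) / p < e ∧ e * p < N + α ∧ e * (p - 2) < α + 2 ∧ e < 2 * m := by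
  obtain ⟨hN, hm, hα, hp, hc⟩ := P
  have hm' : (1:ℝ) ≤ m := by exact_mod_cast hm
  have hN' : (N:ℝ) = 2 * m + 2 := by rw [hN]; push_cast; ring
  have hp0 : 0 < p := by linarith
  have hL : 0 < (N + α) / p := by rw [hN']; positivity
  have h1 : m < (N + α) / p := by rwa [lt_div_iff₀ hp0]
  obtain ⟨e, he1, he2⟩ := exists_between (show max 0 (2 * m - (N + α) / p) < min ((N + α) / p) (min ((α + 2) / (p - 2)) (2 * m)) by
    refine max_lt (lt_min hL (lt_min (div_pos (by linarith) (by linarith)) (by linarith))) (lt_min (by linarith) (lt_min ?_ (by linarith)))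
    rw [lt_div_iff₀ (by linarith)]
    have h2 : (N + α) / p * p = N + α := div_mul_cancel₀ _ hp0.ne'
    nlinarith)
  rw [max_lt_iff] at he1
  rw [lt_min_iff, lt_min_iff, lt_div_iff₀ hp0, lt_div_iff₀ (by linarith)] at he2
  exact ⟨e, he1.1, he1.2, he2.1, he2.2.1, he2.2.2⟩

lemma fv_bd (P : Par N m α p) {v : Fn N} {A b : ℝ} (hA : 0 < A) (h : Adm m v) (hv : Bd A b v) {y : Euc N} (hy : y ≠ 0) (hy1 : ‖y‖ < 1) :
    fv α p v y ≤ A ^ (p - 1) * ‖y‖ ^ (α - b * (p - 1)) := by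
  have h0 : 0 < ‖y‖ := norm_pos_iff.2 hy
  unfold fv
  calc _ ≤ ‖y‖ ^ α * (A * ‖y‖ ^ (-b)) ^ (p - 1) :=
        mul_le_mul_of_nonneg_left (rpow_le_rpow (h.nn y) (hv y hy hy1) (by linarith [P.hp])) (by positivity)
    _ = _ := by
        rw [mul_rpow hA.le (by positivity), ← rpow_mul h0.le, mul_left_comm, ← rpow_add h0]; ring_nf

lemma T_bd (P : Par N m α p) {b b' : ℝ} (h1 : b * (p - 1) - α - 2 ≤ b') (h2 : 0 < b') (h3 : b' < 2 * m) : ∃ C : ℝ, 0 ≤ C ∧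
    ∀ A > 0, ∀ v : Fn N, Adm m v → Bd A b v → Bd (A ^ (p - 1) * C) b' (Tv m α p v) := by
  obtain ⟨C, hC, h⟩ := riesz (N := N) P.hm P.hN (c := b' + 2) (by linarith) (by have := P.hN; rw [this]; push_cast; linarith)
  refine ⟨C, hC, fun A hA v hv hb y hy hy1 => ?_⟩
  have hA' : 0 < A ^ (p - 1) := rpow_pos_of_pos hA _
  have := h (fun y => (A ^ (p - 1))⁻¹ * fv α p v y) ((P.cfv hv.cont).const_mul _) (fun x => mul_nonneg (by positivity) (fv_nonneg hv.nn x))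
    (fun y hy hy1 => by
      rw [inv_mul_le_iff₀ hA']
      refine (P.fv_bd hA hv hb hy hy1).trans (mul_le_mul_of_nonneg_left ?_ hA'.le)
      exact rpow_le_rpow_of_exponent_ge (norm_pos_iff.2 hy) hy1.le (by linarith)) y hy
  rw [Gop_smul, inv_mul_le_iff₀ hA', add_sub_cancel_right, ← mul_assoc] at this
  exact this

lemma T_up (P : Par N m α p) : ∃ C : ℝ, ∀ v : Fn N, Adm m v → Dv α p v = 1 → Dv α p (Tv m α p v) ^ (1 / p) ≤ C := by
  obtain ⟨e, he0, he1, he2, -, -⟩ := P.exp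
  have hp := P.hp
  obtain ⟨C, hC, h⟩ := D0 P.hm P.hN P.hα P.hp he0 he1
  refine ⟨(∫ y, C ^ p * ‖y‖ ^ (-(e * p - α)) ∂mu N) ^ (1 / p), fun v hv hD => rpow_le_rpow (Dv_nonneg (P.adm_T hv).nn) ?_ (by positivity)⟩
  have hi : Integrable (fun y : Euc N => ‖y‖ ^ (-(e * p - α))) (mu N) := int_rpow_ball (by have := P.hN; omega) (by linarith) 1
  refine integral_mono_ae (int_cont (cont_wt P.hα (by linarith) (P.adm_T hv).cont)) (hi.const_mul _) ?_
  filter_upwards [ae_ne P.hN 0] with y hy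
  have h0 : 0 < ‖y‖ := norm_pos_iff.2 hy.symm
  have := h v hv.cont hv.nn hv.cone y hy.symm
  rw [hD, one_rpow, mul_one] at this
  refine (mul_le_mul_of_nonneg_left (rpow_le_rpow ((P.adm_T hv).nn y) this (by linarith)) (by positivity)).trans (le_of_eq ?_)
  rw [mul_rpow hC (by positivity), ← rpow_mul h0.le, mul_left_comm, ← rpow_add h0]; ring_nf

lemma iter (P : Par N m α p) {v : Fn N} (h : Adm m v) (hD : Dv α p v = 1) (k : ℕ) :
    Adm m ((Nv m α p)^[k] v) ∧ Dv α p ((Nv m α p)^[k] v) = 1 ∧ Jv m α p v ≤ Jv m α p ((Nv m α p)^[k] v) := by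
  induction k with
  | zero => exact ⟨h, hD, le_rfl⟩
  | succ k ih =>
    rw [Function.iterate_succ_apply']
    have := P.step ih.1 ih.2.1
    exact ⟨this.1, this.2.1, ih.2.2.trans this.2.2.1⟩

lemma N_bd (P : Par N m α p) {v : Fn N} {A b c0 : ℝ} (hc0 : 0 < c0) (h : Adm m v) (hD : Dv α p v = 1) (hJ : c0 ≤ Jv m α p v)
    (hb : Bd A b (Tv m α p v)) : Bd (c0⁻¹ * A) b (Nv m α p v) := fun y hy hy1 => by
  unfold Nv
  rw [mul_assoc]
  exact mul_le_mul (inv_anti₀ hc0 (hJ.trans (P.J_le h hD).2.1)) (hb y hy hy1) ((P.adm_T h).nn y) (by positivity)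

lemma boot (P : Par N m α p) {c0 : ℝ} (hc0 : 0 < c0) : ∃ k : ℕ, ∃ M : ℝ, ∀ v : Fn N, Adm m v → Dv α p v = 1 → c0 ≤ Jv m α p v →
    ∀ y : Euc N, ‖y‖ < 1 → fv α p ((Nv m α p)^[k] v) y ≤ M := by
  obtain ⟨e, he0, he1, he2, he3, he4⟩ := P.exp
  have hp := P.hp
  have hα := P.hα
  set δ := min (α / (p - 1)) e
  have hδ0 : 0 < δ := lt_min (div_pos hα (by linarith)) he0
  have hδe : δ ≤ e := min_le_right _ _
  have hδα : δ * (p - 1) ≤ α := (le_div_iff₀ (by linarith)).1 (min_le_left _ _)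
  set κ := α + 2 - e * (p - 2)
  have hκ : 0 < κ := by simp only [κ]; linarith
  let Q : ℝ → Prop := fun b => ∃ k : ℕ, ∃ A : ℝ, 0 < A ∧ ∀ v : Fn N, Adm m v → Dv α p v = 1 → c0 ≤ Jv m α p v → Bd A b ((Nv m α p)^[k] v)
  have hQ : ∀ j : ℕ, Q (max (e - j * κ) δ) := fun j => by
    induction j with
    | zero =>
      rw [Nat.cast_zero, zero_mul, sub_zero, max_eq_left hδe]
      obtain ⟨C, hC, h⟩ := D0 P.hm P.hN P.hα P.hp he0 he1
      refine ⟨1, c0⁻¹ * (C + 1), by positivity, fun v hv hD hJ => P.N_bd hc0 hv hD hJ fun y hy hy1 => ?_⟩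
      have := h v hv.cont hv.nn hv.cone y hy
      rw [hD, one_rpow, mul_one] at this
      exact this.trans (mul_le_mul_of_nonneg_right (by linarith) (by positivity))
    | succ j ih =>
      obtain ⟨k, A, hA, ih⟩ := ih
      set b := max (e - j * κ) δ
      have hjk : 0 ≤ j * κ := by positivity
      have hjk' : 0 ≤ (j + 1 : ℕ) * κ := by positivity
      have hbe : b ≤ e := max_le (by linarith) hδe
      have hb' : b * (p - 1) - α - 2 ≤ max (e - (j + 1 : ℕ) * κ) δ := by
        have : b * (p - 1) - α - 2 ≤ b - κ := by simp only [κ]; nlinarith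
        refine this.trans ?_
        rw [sub_le_iff_le_add]
        refine max_le ?_ (by linarith [le_max_right (e - (j + 1 : ℕ) * κ) δ])
        have := le_max_left (e - (j + 1 : ℕ) * κ) δ
        push_cast at this ⊢; linarith
      obtain ⟨C, hC, h⟩ := P.T_bd hb' (lt_max_of_lt_right hδ0) (max_lt (by linarith) (by linarith))
      have hA' : 0 < A ^ (p - 1) := rpow_pos_of_pos hA _
      refine ⟨k + 1, c0⁻¹ * (A ^ (p - 1) * C) + 1, by positivity, fun v hv hD hJ => ?_⟩
      rw [Function.iterate_succ_apply']
      obtain ⟨i1, i2, i3⟩ := P.iter hv hD k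
      have := P.N_bd hc0 i1 i2 (hJ.trans i3) (h A hA _ i1 (ih v hv hD hJ))
      exact fun y hy hy1 => (this y hy hy1).trans (mul_le_mul_of_nonneg_right (by linarith) (by positivity))
  obtain ⟨j, hj⟩ := exists_nat_gt (e / κ)
  rw [div_lt_iff₀ hκ] at hj
  have := hQ j
  rw [max_eq_right (by linarith)] at this
  obtain ⟨k, A, hA, h⟩ := this
  refine ⟨k, A ^ (p - 1), fun v hv hD hJ y hy => ?_⟩
  have hA' : 0 < A ^ (p - 1) := rpow_pos_of_pos hA _
  by_cases h0 : y = 0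
  · unfold fv; rw [h0, norm_zero, zero_rpow hα.ne', zero_mul]; exact hA'.le
  refine (P.fv_bd hA (P.iter hv hD k).1 (h v hv hD hJ) h0 hy).trans (mul_le_of_le_one_right hA'.le ?_)
  exact rpow_le_one (norm_nonneg _) hy.le (by linarith)

end Par
end Henon

namespace Henon
open Topology Metric
variable {N : ℕ}

namespace Par
variable {m : ℕ} {α p : ℝ}

lemma J_pos (P : Par N m α p) {v : Fn N} (h : Adm m v) (hD : 0 < Dv α p v) : 0 < Jv m α p v := by
  have hT := P.adm_T h
  by_contra! hJ
  refine hD.ne' ?_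
  rw [Dv_eq h.nn P.hp]
  refine integral_eq_zero_of_ae (ae_mu fun y hy => ?_)
  have := int_zero ((P.cfv h.cont).mul hT.cont) (fun x => mul_nonneg (fv_nonneg h.nn x) (hT.nn x)) hJ y hy
  rcases mul_eq_zero.1 this with h' | h'
  · simp [h']
  · exact absurd h' (P.T_pos h hD hy).ne'

lemma exists_max (P : Par N m α p) : ∃ w : Fn N, Adm m w ∧ Dv α p w = 1 ∧ (∀ x, 1 ≤ ‖x‖ → w x = 0) ∧ 0 < Jv m α p w ∧
    ∀ v : Fn N, Adm m v → Dv α p v = 1 → Jv m α p v ≤ Jv m α p w := by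
  have hp := P.hp
  obtain ⟨C, hC⟩ := P.T_up
  let S : Set ℝ := {r | ∃ v : Fn N, Adm m v ∧ Dv α p v = 1 ∧ Jv m α p v = r}
  have hSb : BddAbove S := ⟨C, by rintro _ ⟨v, h, hD, rfl⟩; exact (P.J_le h hD).2.1.trans (hC v h hD)⟩
  have h1 : Adm m (fun _ : Euc N => (1:ℝ)) := ⟨continuous_const, fun _ => zero_le_one, fun _ _ _ _ => le_rfl⟩
  have hD1 := P.D_pos h1 fun _ _ => zero_lt_one
  set s := Dv α p (fun _ : Euc N => (1:ℝ))
  have hs0 : 0 < s ^ (-(1 / p)) := rpow_pos_of_pos hD1 _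
  have hv0 := h1.smul hs0.le
  have hDv0 : Dv α p (fun _ : Euc N => s ^ (-(1 / p)) * (1:ℝ)) = 1 := by
    rw [Dv_smul hs0.le h1.nn, ← rpow_mul hD1.le, neg_mul, one_div_mul_cancel (by linarith), rpow_neg_one, inv_mul_cancel₀ hD1.ne']
  have hmem : Jv m α p (fun _ : Euc N => s ^ (-(1 / p)) * (1:ℝ)) ∈ S := ⟨_, hv0, hDv0, rfl⟩
  set R := sSup S
  have hR : 0 < R := (P.J_pos hv0 (by linarith)).trans_le (le_csSup hSb hmem)
  have hle : ∀ v : Fn N, Adm m v → Dv α p v = 1 → Jv m α p v ≤ R := fun v h hD => le_csSup hSb ⟨v, h, hD, rfl⟩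
  have hseq : ∀ j : ℕ, ∃ v : Fn N, Adm m v ∧ Dv α p v = 1 ∧ R - R / 2 * (1 / ((j:ℝ) + 1)) < Jv m α p v := fun j => by
    obtain ⟨_, ⟨v, h, hD, rfl⟩, hlt⟩ := exists_lt_of_lt_csSup ⟨_, hmem⟩ (show R - R / 2 * (1 / ((j:ℝ) + 1)) < R by
      have : 0 < R / 2 * (1 / ((j:ℝ) + 1)) := by positivity
      linarith)
    exact ⟨v, h, hD, hlt⟩
  choose v hv hvD hvJ using hseq
  have hvc : ∀ j, R / 2 ≤ Jv m α p (v j) := fun j => by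
    have : (1 / ((j:ℝ) + 1)) ≤ 1 := by rw [div_le_one (by positivity)]; linarith [(Nat.cast_nonneg j : (0:ℝ) ≤ j)]
    nlinarith [hvJ j]
  obtain ⟨k, M, hM⟩ := P.boot (c0 := R / 2) (by positivity)
  let F : ℕ → Fn N := fun j => (Nv m α p)^[k + 1] (v j)
  have hF := fun j => P.iter (hv j) (hvD j) (k + 1)
  have hI := fun j => P.iter (hv j) (hvD j) k
  set d : ℕ → ℝ := fun j => (Dv α p (Tv m α p ((Nv m α p)^[k] (v j))) ^ (1 / p))⁻¹ with hd
  have hFe : ∀ j x, F j x = d j * Gop m (fv α p ((Nv m α p)^[k] (v j))) x := fun j x => by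
    simp only [F, Function.iterate_succ_apply', d]; rfl
  have hd0 : ∀ j, 0 ≤ d j := fun j => inv_nonneg.2 (rpow_nonneg (Dv_nonneg (P.adm_T (hI j).1).nn) _)
  have hdj : ∀ j, d j ≤ (R / 2)⁻¹ := fun j => inv_anti₀ (by positivity) (((hvc j).trans (hI j).2.2).trans (P.J_le (hI j).1 (hI j).2.1).2.1)
  have hfM : ∀ j y, ‖y‖ < 1 → |fv α p ((Nv m α p)^[k] (v j)) y| ≤ M := fun j y hy => by
    rw [abs_of_nonneg (fv_nonneg (hI j).1.nn y)]; exact hM _ (hv j) (hvD j) (hvc j) y hy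
  have hM0 : 0 ≤ M := (abs_nonneg _).trans (hfM 0 0 (by simp))
  have hF0 : ∀ j x, 1 ≤ ‖x‖ → F j x = 0 := fun j x hx => by rw [hFe, Gop_zero _ hx, mul_zero]
  obtain ⟨B, hB0, hB⟩ := bdd_of_cont (Gop_cont P.hN P.hm (f := fun _ : Euc N => (1:ℝ)) (by fun_prop)) 1
  set M1 := (R / 2)⁻¹ * (M * B)
  have hM1 : ∀ j x, |F j x| ≤ M1 := fun j x => by
    rcases le_or_gt 1 ‖x‖ with hx | hx
    · rw [hF0 j x hx, abs_zero]; positivity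
    rw [hFe, abs_mul, abs_of_nonneg (hd0 j)]
    refine mul_le_mul (hdj j) ((Gop_abs_le P.hN P.hm (P.cfv (hI j).1.cont) (hfM j) x).trans ?_) (abs_nonneg _) (by positivity)
    exact mul_le_mul_of_nonneg_left ((le_abs_self _).trans (hB x (by simpa using hx.le))) hM0
  have hk := kap_pos P.hN P.hm
  obtain ⟨φ, hφ, w, hwc, hw⟩ := compact_seq hM1 hF0 fun x ε hε => by
    set c := (R / 2)⁻¹ * ((kap N m)⁻¹ * M) with hc
    have hc0 : 0 ≤ c := by positivity
    filter_upwards [gk_L1 P.hN x (show 0 < ε / (c + 1) by positivity)] with x' hx' j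
    rw [hFe, hFe, ← mul_sub, abs_mul, abs_of_nonneg (hd0 j)]
    rw [lt_div_iff₀ (by positivity)] at hx'
    refine lt_of_le_of_lt (mul_le_mul (hdj j) (Gop_diff_le P.hN P.hm (P.cfv (hI j).1.cont) (hfM j) x x') (abs_nonneg _) (by positivity)) ?_
    have h0 : 0 ≤ ∫ y, |gk m x' y - gk m x y| ∂mu N := integral_nonneg fun _ => abs_nonneg _
    have : (R / 2)⁻¹ * ((kap N m)⁻¹ * (M * ∫ y, |gk m x' y - gk m x y| ∂mu N)) = c * ∫ y, |gk m x' y - gk m x y| ∂mu N := by rw [hc]; ring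
    rw [this]; linarith
  have hwA : Adm m w := ⟨hwc, fun x => ge_of_tendsto' (hw x) fun k => (hF _).1.nn x,
    fun x y h1 h2 => le_of_tendsto_of_tendsto' (hw x) (hw y) fun k => (hF _).1.cone x y h1 h2⟩
  have B1 : BC (fun k => F (φ k)) w M1 := ⟨fun k => (hF _).1.cont, hwc, fun k y _ => hM1 _ y, fun y _ _ => hw y⟩
  have B2 : BC (fun k => fv α p (F (φ k))) (fv α p w) (M1 ^ (p - 1)) := by
    refine ⟨fun k => P.cfv (hF _).1.cont, P.cfv hwc, fun k y hy => ?_, fun y _ _ => ?_⟩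
    · rw [abs_of_nonneg (fv_nonneg (hF _).1.nn y)]
      exact (mul_le_of_le_one_left (rpow_nonneg ((hF _).1.nn y) _) (rpow_le_one (norm_nonneg _) hy.le P.hα.le)).trans
        (rpow_le_rpow ((hF _).1.nn y) ((le_abs_self _).trans (hM1 _ y)) (by linarith))
    · exact ((hw y).rpow_const (Or.inr (by linarith))).const_mul _
  have hDw : Dv α p w = 1 := by
    have := B2.int_mul P.hN B1
    simp only [← Dv_eq hwA.nn hp] at this
    refine tendsto_nhds_unique this ?_
    have e : ∀ k, ∫ x, fv α p (F (φ k)) x * F (φ k) x ∂mu N = 1 := fun k => by rw [← Dv_eq (hF _).1.nn hp]; exact (hF _).2.1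
    simp only [e]; exact tendsto_const_nhds
  obtain ⟨M', B3⟩ := B2.Gop' P.hN P.hm
  have hJw : R ≤ Jv m α p w := by
    have hl : Tendsto (fun k => R - R / 2 * (1 / ((φ k : ℝ) + 1))) atTop (𝓝 R) := by
      have := ((tendsto_one_div_add_atTop_nhds_zero_nat (𝕜 := ℝ)).comp hφ.tendsto_atTop).const_mul (R / 2)
      simpa using this.const_sub R
    exact le_of_tendsto_of_tendsto' hl (B2.int_mul P.hN B3) fun k => (hvJ _).le.trans (hF _).2.2
  refine ⟨w, hwA, hDw, fun x hx => tendsto_nhds_unique (hw x) ?_, hR.trans_le hJw, fun v h hD => (hle v h hD).trans hJw⟩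
  simp only [hF0 _ x hx]; exact tendsto_const_nhds

lemma main (P : Par N m α p) : ∃ (R : ℝ) (u : Fn N), 0 < R ∧ Adm m u ∧ Tv m α p u = u ∧ 0 < Dv α p u ∧
    (∀ v : Fn N, Adm m v → Jv m α p v ≤ R * Dv α p v ^ (2 * (p - 1) / p)) ∧ Jv m α p u = Dv α p u ∧
    Dv α p u = R * Dv α p u ^ (2 * (p - 1) / p) := by
  have hp := P.hp
  obtain ⟨w, hw, hD, hw0, hR, hmax⟩ := P.exists_max
  set R := Jv m α p w with hRdef
  have hs := P.step hw hD
  have hTw : ∀ x, Tv m α p w x = R * w x := fun x => by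
    rcases le_or_gt 1 ‖x‖ with hx | hx
    · rw [hw0 x hx, mul_zero]; exact Gop_zero _ hx
    refine (P.J_le hw hD).2.2 (le_antisymm (P.J_le hw hD).2.1 (hs.2.2.2.trans ?_)) x hx
    rw [← sqrt_mul hR.le]
    refine (sqrt_le_sqrt (mul_le_mul_of_nonneg_left (hmax _ hs.1 hs.2.1) hR.le)).trans (le_of_eq (sqrt_mul_self hR.le))
  set c := R ^ (-(1 / (p - 2)))
  have hc : 0 < c := rpow_pos_of_pos hR _
  have hcR : c ^ (p - 1) * R = c := by
    rw [← rpow_mul hR.le, ← rpow_add_one hR.ne']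
    congr 1; field_simp [show p - 2 ≠ 0 by linarith]; ring
  have hexp : ∀ s : ℝ, 0 < s → (s ^ (p - 1)) ^ 2 = (s ^ p) ^ (2 * (p - 1) / p) := fun s hs => by
    rw [← rpow_natCast, ← rpow_mul hs.le, ← rpow_mul hs.le]; congr 1; push_cast; field_simp
  have hu := hw.smul hc.le
  have hTu : Tv m α p (fun y => c * w y) = fun y => c * w y := by
    ext x; rw [Tv_smul hc.le hw.nn, hTw, ← mul_assoc, hcR]
  have hDu : Dv α p (fun y => c * w y) = c ^ p := by rw [Dv_smul hc.le hw.nn, hD, mul_one]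
  have hJu : Jv m α p (fun y => c * w y) = Dv α p (fun y => c * w y) := by
    rw [Dv_eq hu.nn hp]; unfold Jv Jf; congr 1; ext x; rw [show Gop m _ x = _ from congrFun hTu x]
  refine ⟨R, fun y => c * w y, hR, hu, hTu, by rw [hDu]; positivity, fun v hv => ?_, hJu, ?_⟩
  · rcases (Dv_nonneg (α := α) (p := p) hv.nn).eq_or_lt with h0 | h0
    · rw [← h0, Real.zero_rpow (by have : 0 < 2 * (p - 1) / p := div_pos (by linarith) (by linarith)
                                   exact this.ne'), mul_zero]
      refine le_of_eq (integral_eq_zero_of_ae (ae_mu fun y hy => ?_))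
      have h1 := h0
      rw [Dv_eq hv.nn hp] at h1
      have := int_zero ((P.cfv hv.cont).mul hv.cont) (fun x => mul_nonneg (fv_nonneg hv.nn x) (hv.nn x)) h1.ge y hy
      rcases mul_eq_zero.1 this with h' | h'
      · simp [h']
      · simp [fv, h', zero_rpow (show p - 1 ≠ 0 by linarith)]
    · set s := Dv α p v ^ (1 / p) with hsd
      have hs0 : 0 < s := rpow_pos_of_pos h0 _
      have hsp : s ^ p = Dv α p v := by rw [hsd, ← rpow_mul h0.le, one_div_mul_cancel (by linarith), rpow_one]
      have hz := hv.smul (inv_nonneg.2 hs0.le)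
      have hDz : Dv α p (fun y => s⁻¹ * v y) = 1 := by
        rw [Dv_smul (inv_nonneg.2 hs0.le) hv.nn, inv_rpow hs0.le, hsp, inv_mul_cancel₀ h0.ne']
      have e : v = fun y => s * (s⁻¹ * v y) := by ext y; rw [mul_inv_cancel_left₀ hs0.ne']
      rw [← hsp, ← hexp s hs0]
      conv_lhs => rw [e, Jv_smul hs0.le hz.nn]
      rw [mul_comm]
      exact mul_le_mul_of_nonneg_right (hmax _ hz hDz) (by positivity)
  · conv_lhs => rw [← hJu, Jv_smul hc.le hw.nn]
    rw [hDu, ← hexp c hc, mul_comm]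

end Par
end Henon

namespace Henon
open Topology Metric
variable {N : ℕ}

lemma s_sq (n : ℕ) (x : Euc N) : sVar n x ^ 2 = ∑ j : Fin N, if (j : ℕ) < n then x j ^ 2 else 0 :=
  sq_sqrt (Finset.sum_nonneg fun j _ => by split_ifs <;> positivity)

lemma t_sq (n : ℕ) (x : Euc N) : tVar n x ^ 2 = ∑ j : Fin N, if n ≤ (j : ℕ) then x j ^ 2 else 0 :=
  sq_sqrt (Finset.sum_nonneg fun j _ => by split_ifs <;> positivity)

lemma st_norm (n : ℕ) (x : Euc N) : sVar n x ^ 2 + tVar n x ^ 2 = ‖x‖ ^ 2 := by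
  rw [s_sq, t_sq, ← Finset.sum_add_distrib, EuclideanSpace.norm_sq_eq]
  refine Finset.sum_congr rfl fun j _ => ?_
  rw [norm_eq_abs, sq_abs]
  by_cases h : (j : ℕ) < n
  · rw [if_pos h, if_neg (by omega), add_zero]
  · rw [if_neg h, if_pos (by omega), zero_add]

lemma st_qf (n : ℕ) (x : Euc N) : sVar n x ^ 2 - tVar n x ^ 2 = qf n x := by
  rw [s_sq, t_sq, ← Finset.sum_sub_distrib]
  refine Finset.sum_congr rfl fun j _ => ?_
  unfold sg
  by_cases h : (j : ℕ) < n
  · rw [if_pos h, if_pos h, if_neg (by omega)]; ring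
  · rw [if_neg h, if_neg h, if_pos (by omega)]; ring

lemma Kplus_of {n : ℕ} {u : Fn N} (h1 : MemH10 (ball (0 : Euc N) 1) u) (h0 : ∀ x, 0 ≤ u x) (hc : Cone n u) : u ∈ Kplus n (ball (0 : Euc N) 1) := by
  classical
  let W : ℝ → ℝ → ℝ := fun a b => if h : ∃ x : Euc N, ‖x‖ ^ 2 = a ∧ |qf n x| = b then u h.choose else 0
  have hW : ∀ x, u x = W (sVar n x ^ 2 + tVar n x ^ 2) |sVar n x ^ 2 - tVar n x ^ 2| := fun x => by
    rw [st_norm, st_qf]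
    have h : ∃ y : Euc N, ‖y‖ ^ 2 = ‖x‖ ^ 2 ∧ |qf n y| = |qf n x| := ⟨x, rfl, rfl⟩
    simp only [W, dif_pos h]
    exact hc.eq ((sq_eq_sq₀ (norm_nonneg _) (norm_nonneg _)).1 h.choose_spec.1).symm h.choose_spec.2.symm
  refine ⟨h1, h0, fun s t => W (s ^ 2 + t ^ 2) |s ^ 2 - t ^ 2|, hW, fun s t => ?_, ?_⟩
  · simp only; rw [add_comm, abs_sub_comm]
  · rintro r θ₁ θ₂ a1 a2 a3 ⟨x, -, hx1, hx2⟩ ⟨y, -, hy1, hy2⟩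
    have e1 := hW x
    have e2 := hW y
    rw [hx1, hx2] at e1
    rw [hy1, hy2] at e2
    change W _ _ ≤ W _ _
    rw [← e1, ← e2]
    have n1 := st_norm n x
    have n2 := st_norm n y
    have q1 := st_qf n x
    have q2 := st_qf n y
    rw [hx1, hx2] at n1 q1
    rw [hy1, hy2] at n2 q2
    have c1 : (r * cos θ₁) ^ 2 - (r * sin θ₁) ^ 2 = r ^ 2 * cos (2 * θ₁) := by rw [cos_two_mul']; ring
    have c2 : (r * cos θ₂) ^ 2 - (r * sin θ₂) ^ 2 = r ^ 2 * cos (2 * θ₂) := by rw [cos_two_mul']; ring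
    refine hc x y ((sq_eq_sq₀ (norm_nonneg _) (norm_nonneg _)).1 ?_) ?_
    · rw [← n1, ← n2]; have := sin_sq_add_cos_sq θ₁; have := sin_sq_add_cos_sq θ₂; nlinarith
    · have hp := pi_pos
      have h0 : 0 ≤ cos (2 * θ₂) := cos_nonneg_of_mem_Icc ⟨by linarith, by linarith⟩
      have h1 : cos (2 * θ₂) ≤ cos (2 * θ₁) := cos_le_cos_of_nonneg_of_le_pi (by linarith) (by linarith) (by linarith)
      rw [← q1, ← q2, c1, c2, abs_of_nonneg (by positivity), abs_of_nonneg (mul_nonneg (by positivity) (h0.trans h1))]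
      exact mul_le_mul_of_nonneg_left h1 (by positivity)

lemma Kplus_cone {n : ℕ} (hn0 : 1 ≤ n) (hn : N = 2 * n) {φ : Fn N} (hφ : φ ∈ Kplus n (ball (0 : Euc N) 1)) : Cone n φ := by
  obtain ⟨⟨hcont, -, hz, -⟩, h0, w, hw, hsym, hmono⟩ := hφ
  let i : Fin N := ⟨0, by omega⟩
  let j : Fin N := ⟨n, by omega⟩
  have hij : i ≠ j := fun h => by have := congrArg Fin.val h; simp only [i, j] at this; omega
  let z : ℝ → ℝ → Euc N := fun s t => EuclideanSpace.single i s + EuclideanSpace.single j t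
  have hzc : ∀ s t k, (z s t) k = (if k = i then s else 0) + (if k = j then t else 0) := fun s t k => by simp [z]
  have hs : ∀ s t, 0 ≤ s → sVar n (z s t) = s := fun s t h => by
    rw [← sq_eq_sq₀ (show 0 ≤ sVar n (z s t) from sqrt_nonneg _) h, s_sq, Finset.sum_eq_single i]
    · rw [if_pos (show (i:ℕ) < n from hn0), hzc, if_pos rfl, if_neg hij, add_zero]
    · intro k _ hk
      split_ifs with hkn
      · rw [hzc, if_neg hk, if_neg (fun h => by rw [h] at hkn; exact lt_irrefl _ hkn)]; simp
      · rfl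
    · simp
  have ht : ∀ s t, 0 ≤ t → tVar n (z s t) = t := fun s t h => by
    rw [← sq_eq_sq₀ (show 0 ≤ tVar n (z s t) from sqrt_nonneg _) h, t_sq, Finset.sum_eq_single j]
    · rw [if_pos (show n ≤ (j:ℕ) from le_rfl), hzc, if_neg hij.symm, if_pos rfl, zero_add]
    · intro k _ hk
      split_ifs with hkn
      · rw [hzc, if_neg hk, if_neg (fun h => by rw [h] at hkn; exact absurd hkn (by simp only [i]; omega))]; simp
      · rfl
    · simp
  have hπ := pi_pos
  intro x y hxy hq
  set ρ := ‖x‖ with hρ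
  have hρ0 : 0 ≤ ρ := norm_nonneg _
  rcases le_or_gt 1 ρ with h1 | h1
  · rw [hz x (by simpa using h1), hz y (by simpa using hxy ▸ h1)]
  let g : ℝ → ℝ := fun θ => φ (z (ρ * cos θ) (ρ * sin θ))
  have hgc : Continuous g := by
    have h1 : Continuous fun s : ℝ => EuclideanSpace.single (𝕜 := ℝ) i s := (Isometry.of_dist_eq fun a b => EuclideanSpace.dist_single_same i a b).continuous
    have h2 : Continuous fun s : ℝ => EuclideanSpace.single (𝕜 := ℝ) j s := (Isometry.of_dist_eq fun a b => EuclideanSpace.dist_single_same j a b).continuous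
    exact hcont.comp ((h1.comp (by fun_prop)).add (h2.comp (by fun_prop)))
  have hcs : ∀ θ, 0 ≤ θ → θ ≤ π / 4 → 0 ≤ ρ * cos θ ∧ 0 ≤ ρ * sin θ := fun θ a b =>
    ⟨mul_nonneg hρ0 (cos_nonneg_of_mem_Icc ⟨by linarith, by linarith⟩), mul_nonneg hρ0 (sin_nonneg_of_nonneg_of_le_pi a (by linarith))⟩
  have hgw : ∀ θ, 0 ≤ θ → θ ≤ π / 4 → g θ = w (ρ * cos θ) (ρ * sin θ) := fun θ a b => by
    simp only [g]; rw [hw, hs _ _ (hcs θ a b).1, ht _ _ (hcs θ a b).2]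
  have hcr : ∀ θ, 0 ≤ θ → θ ≤ π / 4 → inCross n (ball (0 : Euc N) 1) (ρ * cos θ) (ρ * sin θ) := fun θ a b => by
    refine ⟨_, ?_, hs _ (ρ * sin θ) (hcs θ a b).1, ht _ _ (hcs θ a b).2⟩
    have := st_norm n (z (ρ * cos θ) (ρ * sin θ))
    rw [hs _ _ (hcs θ a b).1, ht _ _ (hcs θ a b).2] at this
    have e : ‖z (ρ * cos θ) (ρ * sin θ)‖ = ρ := by
      rw [← sq_eq_sq₀ (norm_nonneg _) hρ0, ← this]; nlinarith [sin_sq_add_cos_sq θ]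
    rw [mem_ball_zero_iff, e]; exact h1
  have hgm : ∀ a b, 0 ≤ a → a ≤ b → b ≤ π / 4 → g a ≤ g b := fun a b ha hab hb => by
    have hl : ∀ c, Tendsto (fun ε : ℝ => g ((1 - ε) * c + ε * (π / 8))) (𝓝[>] 0) (𝓝 (g c)) := fun c => by
      have : Continuous fun ε : ℝ => g ((1 - ε) * c + ε * (π / 8)) := hgc.comp (by fun_prop)
      simpa using (this.tendsto 0).mono_left nhdsWithin_le_nhds
    refine le_of_tendsto_of_tendsto (hl a) (hl b) ?_
    filter_upwards [Ioo_mem_nhdsGT (zero_lt_one (α := ℝ))] with ε hε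
    obtain ⟨e1, e2⟩ := hε
    have b1 : 0 < (1 - ε) * a + ε * (π / 8) := by nlinarith
    have b2 : (1 - ε) * a + ε * (π / 8) ≤ (1 - ε) * b + ε * (π / 8) := by nlinarith
    have b3 : (1 - ε) * b + ε * (π / 8) < π / 4 := by nlinarith
    rw [hgw _ b1.le (b2.trans b3.le), hgw _ (b1.le.trans b2) b3.le]
    exact hmono ρ _ _ b1 b2 b3 (hcr _ b1.le (b2.trans b3.le)) (hcr _ (b1.le.trans b2) b3.le)
  have hrep : ∀ v : Euc N, ‖v‖ = ρ → φ v = g (arccos (|qf n v| / ρ ^ 2) / 2) := fun v hv => by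
    set a := |qf n v| / ρ ^ 2 with ha
    have hab := abs_qf_le n v
    rw [hv] at hab
    have ha1 : a ≤ 1 := div_le_one_of_le₀ hab (by positivity)
    have ha0 : 0 ≤ a := by positivity
    have hq : |qf n v| = ρ ^ 2 * a := by
      rcases hρ0.eq_or_lt with h | h
      · rw [← h] at hab ⊢; nlinarith [abs_nonneg (qf n v)]
      · rw [ha]; field_simp
    set θ := arccos a / 2 with hθ
    have t1 : 0 ≤ θ := by have := arccos_nonneg a; positivity
    have t2 : θ ≤ π / 4 := by have := arccos_le_pi_div_two.2 ha0; linarith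
    have hc2 : cos (2 * θ) = a := by rw [hθ, mul_div_cancel₀ _ two_ne_zero, cos_arccos (by linarith) ha1]
    have k1 := cos_sq θ
    have k2 := sin_sq_add_cos_sq θ
    rw [hc2] at k1
    have n1 := st_norm n v
    have q1 := st_qf n v
    rw [hv] at n1
    have hsn : 0 ≤ sVar n v := sqrt_nonneg _
    have htn : 0 ≤ tVar n v := sqrt_nonneg _
    have C := hcs θ t1 t2
    have key : ∀ s t, 0 ≤ s → 0 ≤ t → s ^ 2 + t ^ 2 = ρ ^ 2 → s ^ 2 - t ^ 2 = ρ ^ 2 * a → s = ρ * cos θ ∧ t = ρ * sin θ := fun s t h3 h4 h5 h6 => by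
      constructor
      · rw [← sq_eq_sq₀ h3 C.1, mul_pow, k1]; linarith
      · rw [← sq_eq_sq₀ h4 C.2, mul_pow, show sin θ ^ 2 = 1 - (1 / 2 + a / 2) by linarith]; linarith
    rw [hw, hgw _ t1 t2]
    rcases abs_cases (qf n v) with ⟨h, -⟩ | ⟨h, -⟩
    · obtain ⟨e1, e2⟩ := key _ _ hsn htn n1 (by linarith)
      rw [e1, e2]
    · obtain ⟨e1, e2⟩ := key _ _ htn hsn (by linarith) (by linarith)
      rw [hsym, e1, e2]
  rw [hrep x rfl, hrep y hxy.symm]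
  refine hgm _ _ (by have := arccos_nonneg (|qf n x| / ρ ^ 2); positivity) ?_ (by
    have := arccos_le_pi_div_two.2 (show 0 ≤ |qf n y| / ρ ^ 2 by positivity); linarith)
  have := antitone_arccos (div_le_div_of_nonneg_right hq (sq_nonneg ρ))
  linarith

lemma Par.reg {m : ℕ} {α p : ℝ} (P : Par N m α p) {u : Fn N} (hu : Adm m u) (hT : Tv m α p u = u) (hD : 0 < Dv α p u) :
    (∀ x : Euc N, ‖x‖ < 1 → 0 < u x) ∧ (∀ x : Euc N, ‖x‖ < 1 → ContDiffAt ℝ 2 u x) ∧ ∀ x : Euc N, ‖x‖ < 1 → - lap u x = ‖x‖ ^ α * u x ^ (p - 1) := by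
  have hf := P.cfv hu.cont
  have hpos : ∀ x : Euc N, ‖x‖ < 1 → 0 < u x := fun x hx => by have := P.T_pos hu hD hx; rwa [hT] at this
  have hG : Gop m (fv α p u) = u := hT
  have h2 : ∀ x : Euc N, ‖x‖ < 1 → ContDiffAt ℝ 2 u x := fun x hx => by
    have h1 : ContDiffAt ℝ 1 (fun y => u y ^ (p - 1)) x := by
      have := contDiffAt_Gop_one P.hN hf hx
      rw [hG] at this
      exact this.rpow_const_of_ne (hpos x hx).ne'
    rw [← hG]
    by_cases h0 : x = 0
    · subst h0
      exact contDiffAt_Gop_zero P.hN P.hα hf (fun _ => rfl) h1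
    · exact contDiffAt_Gop_two P.hN hf hx ((contDiffAt_nrpow α h0).mul h1)
  refine ⟨hpos, h2, fun x hx => ?_⟩
  have := neg_lap_Gop P.hN P.hm hf hx (by rw [hG]; exact h2 x hx)
  rwa [hG] at this

end Henon

namespace Henon
open Topology Metric
variable {N : ℕ}

abbrev BB (N : ℕ) : Set (Euc N) := ball (0 : Euc N) 1

lemma energy_eq {α p : ℝ} {φ : Fn N} (h0 : ∀ x, 0 ≤ φ x) :
    energy (BB N) (fun x => ‖x‖ ^ α) p φ = 1 / 2 * An φ - 1 / p * Dv α p φ := by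
  unfold energy An Dv mu
  simp only [norm_grad, abs_of_nonneg (h0 _)]

lemma mem_gp {φ : Fn N} (h : MemH10 (BB N) φ) : Integrable (gp φ φ) (mu N) := by
  have := h.2.2.2.1
  simp only [norm_grad] at this
  exact this

lemma mem_of {φ : Fn N} (hc : Continuous φ) (hd : ∀ x : Euc N, ‖x‖ < 1 → DifferentiableAt ℝ φ x) (hz : ∀ x : Euc N, 1 ≤ ‖x‖ → φ x = 0)
    (hi : Integrable (gp φ φ) (mu N)) : MemH10 (BB N) φ := by
  refine ⟨hc, fun x hx => hd x (by simpa using hx), fun x hx => hz x (by simpa using hx), ?_, int_cont (hc.pow 2)⟩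
  simp only [norm_grad]
  exact hi

lemma mem_H10' {φ : Fn N} (h : MemH10 (BB N) φ) (h0 : ∀ x, 0 ≤ φ x) : H10' φ where
  cont := h.1
  diff := fun x hx => h.2.1 x (by simpa using hx)
  zero := fun x hx => h.2.2.1 x (by simpa using hx)
  nonneg := h0
  loc := fun K _ hKb i => by
    have h1 : Integrable (pd i φ) (mu N) := by
      refine ((mem_gp h).add (int_cont (continuous_const (y := (1:ℝ))))).mono' (meas_pd i φ).aestronglyMeasurable (ae_of_all _ fun x => ?_)
      have h2 : pd i φ x * pd i φ x ≤ gp φ φ x :=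
        Finset.single_le_sum (f := fun i => pd i φ x * pd i φ x) (fun i _ => mul_self_nonneg _) (Finset.mem_univ i)
      simp only [Pi.add_apply, norm_eq_abs]
      rcases abs_cases (pd i φ x) with ⟨h, -⟩ | ⟨h, -⟩ <;> rw [h] <;> nlinarith [sq_nonneg (pd i φ x - 1), sq_nonneg (pd i φ x + 1)]
    exact IntegrableOn.mono_set (t := ball 0 1) h1 hKb

lemma gp_diff {φ ψ : Fn N} (h : MemH10 (BB N) φ) (k : MemH10 (BB N) ψ) {x : Euc N} (hx : ‖x‖ < 1) :
    gp (φ - ψ) (φ - ψ) x = gp φ φ x + gp ψ ψ x - 2 * gp ψ φ x ∧ gp ψ (φ - ψ) x = gp ψ φ x - gp ψ ψ x := by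
  have hx' : x ∈ BB N := by simpa using hx
  have e : ∀ i, pd i (φ - ψ) x = pd i φ x - pd i ψ x := fun i => by
    unfold pd; rw [fderiv_sub (h.2.1 x hx') (k.2.1 x hx')]; rfl
  unfold gp
  simp only [e]
  constructor
  · rw [Finset.mul_sum, ← Finset.sum_add_distrib, ← Finset.sum_sub_distrib]
    exact Finset.sum_congr rfl fun i _ => by ring
  · rw [← Finset.sum_sub_distrib]
    exact Finset.sum_congr rfl fun i _ => by ring

lemma mem_sub {φ ψ : Fn N} (h : MemH10 (BB N) φ) (k : MemH10 (BB N) ψ) : MemH10 (BB N) (φ - ψ) := by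
  refine mem_of (h.1.sub k.1) (fun x hx => (h.2.1 x (by simpa using hx)).sub (k.2.1 x (by simpa using hx)))
    (fun x hx => ?_) ?_
  · rw [Pi.sub_apply, h.2.2.1 x (by simpa using hx), k.2.2.1 x (by simpa using hx), sub_zero]
  · refine Integrable.congr (((mem_gp h).add (mem_gp k)).sub ((int_gp (mem_gp k) (mem_gp h)).const_mul 2)) (ae_mu fun x hx => ?_)
    rw [(gp_diff h k hx).1]; rfl

lemma An_diff {φ ψ : Fn N} (h : MemH10 (BB N) φ) (k : MemH10 (BB N) ψ) :
    |An φ - An ψ| ≤ 2 * (√(An ψ) * √(An (φ - ψ))) + √(An (φ - ψ)) ^ 2 := by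
  have hd := mem_sub h k
  have h1 := gp_cs (c := fun _ => 1) (mem_gp k) (mem_gp hd) (by simp)
  have h2 := gp_cs (c := fun _ => -1) (mem_gp k) (mem_gp hd) (by simp)
  simp only [one_mul, neg_one_mul, integral_neg] at h1 h2
  have e : An φ = An ψ + 2 * ∫ x, gp ψ (φ - ψ) x ∂mu N + An (φ - ψ) := by
    unfold An
    have i1 := int_gp (mem_gp k) (mem_gp hd)
    rw [← integral_const_mul, ← integral_add (mem_gp k) (i1.const_mul 2),
      ← integral_add (f := fun x => gp ψ ψ x + 2 * gp ψ (φ - ψ) x) ((mem_gp k).add (i1.const_mul 2)) (mem_gp hd)]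
    refine integral_congr_ae (ae_mu fun x hx => ?_)
    simp only
    rw [(gp_diff h k hx).1, (gp_diff h k hx).2]; ring
  rw [sq_sqrt (An_nonneg _), e]
  have := An_nonneg (φ - ψ)
  exact abs_le.2 ⟨by linarith, by linarith⟩

lemma An_vnorm {α p : ℝ} {φ : Fn N} (h : MemH10 (BB N) φ) : √(An φ) ≤ vnorm (BB N) (fun x => ‖x‖ ^ α) p φ := by
  unfold vnorm
  simp only [norm_grad]
  have h1 : 0 ≤ (∫ x in BB N, ‖x‖ ^ α * |φ x| ^ p) ^ (1 / p) :=
    rpow_nonneg (integral_nonneg fun x => by positivity) _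
  have h2 : An φ ≤ ∫ x in BB N, (gp φ φ x + φ x ^ 2) :=
    integral_mono (mem_gp h) ((mem_gp h).add (int_cont (h.1.pow 2))) fun x => by simp only; nlinarith [sq_nonneg (φ x)]
  rw [← sqrt_eq_rpow]
  linarith [sqrt_le_sqrt h2]

lemma gp_smul (c : ℝ) (u : Fn N) (x : Euc N) : gp (fun y => c * u y) (fun y => c * u y) x = c ^ 2 * gp u u x := by
  have e : ∀ i, pd i (fun y => c * u y) x = c * pd i u x := fun i => by
    unfold pd
    have e2 : (fun y => c * u y) = c • u := rfl
    rw [e2, fderiv_const_smul_field]; rfl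
  unfold gp
  simp only [e]
  rw [Finset.mul_sum]
  exact Finset.sum_congr rfl fun i _ => by ring

lemma An_smul (c : ℝ) (u : Fn N) : An (fun y => c * u y) = c ^ 2 * An u := by
  unfold An; simp only [gp_smul]; rw [integral_const_mul]

lemma vnorm_smul {α p : ℝ} (hp : 2 < p) (c : ℝ) (u : Fn N) :
    vnorm (BB N) (fun x => ‖x‖ ^ α) p (fun y => c * u y) = |c| * vnorm (BB N) (fun x => ‖x‖ ^ α) p u := by
  unfold vnorm
  simp only [norm_grad, gp_smul, mul_pow, ← mul_add, abs_mul, mul_rpow (abs_nonneg _) (abs_nonneg _)]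
  have e : ∀ x : Euc N, ‖x‖ ^ α * (|c| ^ p * |u x| ^ p) = |c| ^ p * (‖x‖ ^ α * |u x| ^ p) := fun x => by ring
  simp only [e]
  rw [integral_const_mul, integral_const_mul, mul_rpow (by positivity) (integral_nonneg fun x => by have := gp_self_nonneg u x; positivity),
    mul_rpow (by positivity) (integral_nonneg fun x => by positivity), ← rpow_mul (abs_nonneg _), mul_one_div_cancel (by linarith),
    rpow_one, ← sqrt_eq_rpow, sqrt_sq_eq_abs]
  ring

lemma num {p R d A D : ℝ} (hp : 2 < p) (hd : 0 < d) (hA : 0 ≤ A) (hD : 0 ≤ D) (h1 : D ^ 2 ≤ A * (R * D ^ (2 * (p - 1) / p)))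
    (h2 : d = R * d ^ (2 * (p - 1) / p)) : (D / d) ^ (2 / p) ≤ A / d := by
  rcases hD.eq_or_lt with h | h
  · rw [← h, zero_div, zero_rpow (by positivity)]; positivity
  have e : ∀ x : ℝ, 0 < x → x ^ 2 = x ^ (2 * (p - 1) / p) * x ^ (2 / p) := fun x hx => by
    rw [← rpow_add hx, ← rpow_natCast]; congr 1; push_cast; field_simp; ring
  have hDe := rpow_pos_of_pos h (2 * (p - 1) / p)
  have hde := rpow_pos_of_pos hd (2 * (p - 1) / p)
  have hd2 := rpow_pos_of_pos hd (2 / p)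
  have k1 : D ^ (2 / p) ≤ A * R := by
    rw [e D h] at h1
    refine le_of_mul_le_mul_left ?_ hDe
    linarith
  have k2 : d ^ (2 / p) = R * d := by
    have := e d hd
    refine mul_left_cancel₀ hde.ne' ?_
    rw [← this]
    nth_rewrite 1 [sq, h2]
    ring
  rw [div_rpow hD hd.le, k2, div_le_div_iff₀ (by rw [← k2]; exact hd2) hd]
  nlinarith

end Henon

namespace Henon
open Topology Metric
variable {N : ℕ}

lemma Par.K_data {m : ℕ} {α p R d : ℝ} (P : Par N m α p) (hd : 0 < d)
    (hR : ∀ v : Fn N, Adm m v → Jv m α p v ≤ R * Dv α p v ^ (2 * (p - 1) / p)) (hdR : d = R * d ^ (2 * (p - 1) / p))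
    {φ : Fn N} (hφ : φ ∈ Kplus (m + 1) (BB N)) : (Dv α p φ / d) ^ (2 / p) ≤ An φ / d := by
  have hA : Adm m φ := ⟨hφ.1.1, hφ.2.1, Kplus_cone (by omega) (by have := P.hN; omega) hφ⟩
  have h1 := dual_le P.hN P.hm (P.cfv hA.cont) (fv_nonneg hA.nn) (mem_H10' hφ.1 hφ.2.1) (mem_gp hφ.1)
  rw [← Dv_eq hA.nn P.hp] at h1
  have hD := Dv_nonneg (α := α) (p := p) hA.nn
  have hJ := Jf_nonneg P.hN P.hm (fv_nonneg (α := α) (p := p) hA.nn)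
  refine num P.hp hd (An_nonneg φ) hD ?_ hdR
  have h2 := pow_le_pow_left₀ hD h1 2
  rw [mul_pow, sq_sqrt (An_nonneg _), sq_sqrt hJ] at h2
  exact h2.trans (mul_le_mul_of_nonneg_left (hR φ hA) (An_nonneg _))

lemma Par.mp_lower {m : ℕ} {α p R d : ℝ} (P : Par N m α p) (hd : 0 < d)
    (hR : ∀ v : Fn N, Adm m v → Jv m α p v ≤ R * Dv α p v ^ (2 * (p - 1) / p)) (hdR : d = R * d ^ (2 * (p - 1) / p))
    {γ : ℝ → Fn N} (h1 : ∀ t ∈ Icc (0 : ℝ) 1, γ t ∈ Kplus (m + 1) (BB N))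
    (h2 : ∀ t ∈ Icc (0 : ℝ) 1, ∀ ε > (0 : ℝ), ∃ δ > (0 : ℝ), ∀ s ∈ Icc (0 : ℝ) 1,
      |s - t| < δ → vnorm (BB N) (fun x => ‖x‖ ^ α) p (γ s - γ t) < ε) (h3 : γ 0 = 0) (h4 : γ 1 ≠ 0)
    (h5 : energy (BB N) (fun x => ‖x‖ ^ α) p (γ 1) ≤ 0) :
    1 / 2 * d - 1 / p * d ≤ sSup ((fun t => energy (BB N) (fun x => ‖x‖ ^ α) p (γ t)) '' Icc (0 : ℝ) 1) := by
  have hp := P.hp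
  have hcont : ContinuousOn (fun t => An (γ t)) (Icc 0 1) := by
    rw [Metric.continuousOn_iff]
    intro t ht ε hε
    have hs := sqrt_nonneg (An (γ t))
    obtain ⟨η, hη0, hη⟩ := exists_between (show 0 < min 1 (ε / (2 * √(An (γ t)) + 1)) from lt_min one_pos (by positivity))
    obtain ⟨δ, hδ, H⟩ := h2 t ht η hη0
    refine ⟨δ, hδ, fun s hs' hst => ?_⟩
    have k1 := H s hs' hst
    have k2 := An_vnorm (α := α) (p := p) (mem_sub (h1 s hs').1 (h1 t ht).1)
    have k3 := An_diff (h1 s hs').1 (h1 t ht).1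
    have k4 := sqrt_nonneg (An (γ s - γ t))
    have l1 := hη.trans_le (min_le_left _ _)
    have l2 := hη.trans_le (min_le_right _ _)
    rw [lt_div_iff₀ (by positivity)] at l2
    rw [dist_eq]
    have k5 : √(An (γ s - γ t)) ≤ η := by linarith
    have k6 := mul_le_mul_of_nonneg_left k5 hs
    have k7 : √(An (γ s - γ t)) ^ 2 ≤ η := by nlinarith
    nlinarith
  have i0 : (0 : ℝ) ∈ Icc (0 : ℝ) 1 := by simp
  have i1 : (1 : ℝ) ∈ Icc (0 : ℝ) 1 := by simp
  have hbdd : BddAbove ((fun t => energy (BB N) (fun x => ‖x‖ ^ α) p (γ t)) '' Icc (0 : ℝ) 1) := by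
    obtain ⟨M, hM⟩ := (isCompact_Icc.image_of_continuousOn hcont).bddAbove
    refine ⟨1 / 2 * M, ?_⟩
    rintro _ ⟨t, ht, rfl⟩
    simp only
    rw [energy_eq (h1 t ht).2.1]
    have a1 : An (γ t) ≤ M := hM ⟨t, ht, rfl⟩
    have a2 : 0 ≤ 1 / p * Dv α p (γ t) := mul_nonneg (by positivity) (Dv_nonneg (h1 t ht).2.1)
    linarith
  have hA0 : An (γ 0) = 0 := by
    rw [h3]
    have := An_smul 0 (0 : Fn N)
    simp only [zero_mul, ne_eq, OfNat.ofNat_ne_zero, not_false_eq_true, zero_pow] at this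
    exact this
  have hA1 : d ≤ An (γ 1) := by
    have hK := h1 1 i1
    by_contra hlt
    rw [not_le] at hlt
    rw [energy_eq hK.2.1] at h5
    have hD0 : 0 < Dv α p (γ 1) := by
      refine (Dv_nonneg hK.2.1).lt_of_ne fun h => h4 ?_
      have hz := int_zero (cont_wt P.hα (c := p) (by linarith) hK.1.1)
        (fun x => mul_nonneg (rpow_nonneg (norm_nonneg x) α) (rpow_nonneg (hK.2.1 x) p)) h.symm.le
      have hz2 : ∀ x : Euc N, x ≠ 0 → γ 1 x = 0 := fun x hx => by
        rcases lt_or_ge ‖x‖ 1 with h | h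
        · rcases mul_eq_zero.1 (hz x h) with h | h
          · exact absurd h (rpow_pos_of_pos (norm_pos_iff.2 hx) _).ne'
          · exact ((rpow_eq_zero (hK.2.1 x) (by linarith)).1 h)
        · exact hK.1.2.2.1 x (by simpa using h)
      have : NeZero N := ⟨by have := P.hN; omega⟩
      have hden : Dense ({0}ᶜ : Set (Euc N)) := by
        have : Nontrivial (Euc N) := by
          refine ⟨0, EuclideanSpace.single 0 1, fun h => ?_⟩
          have := congrArg norm h
          simp at this
        exact dense_compl_singleton 0
      exact hK.1.1.ext_on hden continuous_const fun x hx => hz2 x hx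
    have hk := P.K_data hd hR hdR hK
    have hq1 : Dv α p (γ 1) / d ≤ 1 := by
      by_contra h
      rw [not_le] at h
      have := one_lt_rpow h (show 0 < 2 / p by positivity)
      have := (div_lt_one hd).2 hlt
      linarith
    have hq2 := rpow_le_rpow_of_exponent_ge (show 0 < Dv α p (γ 1) / d by positivity) hq1 (show 2 / p ≤ 1 from (div_le_one (by linarith)).2 hp.le)
    rw [rpow_one] at hq2
    have hq3 := (div_le_div_iff_of_pos_right hd).1 (hq2.trans hk)
    have : 1 / p < 1 / 2 := one_div_lt_one_div_of_lt two_pos hp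
    nlinarith
  obtain ⟨t, ht, hAt⟩ := intermediate_value_Icc zero_le_one hcont ⟨by simp only [hA0]; exact hd.le, hA1⟩
  simp only at hAt
  refine le_trans ?_ (le_csSup hbdd ⟨t, ht, rfl⟩)
  simp only
  rw [energy_eq (h1 t ht).2.1, hAt]
  have hk := P.K_data hd hR hdR (h1 t ht)
  rw [hAt, div_self hd.ne'] at hk
  have hq1 : Dv α p (γ t) / d ≤ 1 := by
    by_contra h
    rw [not_le] at h
    have := one_lt_rpow h (show 0 < 2 / p by positivity)
    linarith
  rw [div_le_one hd] at hq1
  have := mul_le_mul_of_nonneg_left hq1 (show 0 ≤ 1 / p by positivity)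
  linarith

lemma Par.final {m : ℕ} {α p : ℝ} (P : Par N m α p) : ∃ u : Fn N,
      IsGroundState (BB N) (fun x => ‖x‖ ^ α) p (Kplus (m + 1) (BB N)) u ∧
      (∀ x ∈ BB N, 0 < u x) ∧ (∀ x ∈ BB N, ContDiffAt ℝ 2 u x) ∧
      (∀ x ∈ BB N, - lap u x = ‖x‖ ^ α * u x ^ (p - 1)) ∧ (∀ x ∉ BB N, u x = 0) := by
  have hp := P.hp
  obtain ⟨R, u, hR0, hu, hT, hd, hR, hJ, hdR⟩ := P.main
  obtain ⟨r1, r2, r3⟩ := P.reg hu hT hd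
  have hG : Gop m (fv α p u) = u := hT
  have hz : ∀ x : Euc N, 1 ≤ ‖x‖ → u x = 0 := fun x hx => by rw [← hG]; exact Gop_zero _ hx
  have c1 := P.cfv hu.cont
  have c2 := fv_nonneg (α := α) (p := p) hu.nn
  have hgi := (An_Gop_le P.hN P.hm c1 c2 (by rw [hG]; exact r2)).1
  have hAn := An_eq P.hN P.hm c1 c2 (by rw [hG]; exact r2)
  rw [hG] at hgi hAn
  replace hAn : An u = Dv α p u := hAn.trans hJ
  have hKc : ∀ c : ℝ, 0 ≤ c → (fun y => c * u y) ∈ Kplus (m + 1) (BB N) := fun c hc => by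
    refine Kplus_of (mem_of (hu.cont.const_mul c) (fun x hx => ((r2 x hx).differentiableAt (by norm_num)).const_mul c)
      (fun x hx => by rw [hz x hx, mul_zero]) ?_) (hu.smul hc).nn (hu.smul hc).cone
    simp only [funext (gp_smul c u)]
    exact hgi.const_mul _
  have hK : u ∈ Kplus (m + 1) (BB N) := by simpa using hKc 1 zero_le_one
  have hEc : ∀ c : ℝ, 0 ≤ c → energy (BB N) (fun x => ‖x‖ ^ α) p (fun y => c * u y) = (1 / 2 * c ^ 2 - 1 / p * c ^ p) * Dv α p u := fun c hc => by
    rw [energy_eq (hu.smul hc).nn, An_smul, Dv_smul hc hu.nn, hAn]; ring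
  have hE : energy (BB N) (fun x => ‖x‖ ^ α) p u = 1 / 2 * Dv α p u - 1 / p * Dv α p u := by
    rw [energy_eq hu.nn, hAn]
  have hip : 1 / p < 1 / 2 := one_div_lt_one_div_of_lt two_pos hp
  have hmem : ∀ x : Euc N, x ∈ BB N → ‖x‖ < 1 := fun x hx => by simpa using hx
  refine ⟨u, ⟨hK, by rw [hE]; nlinarith, ?_⟩, fun x hx => r1 x (hmem x hx), fun x hx => r2 x (hmem x hx), fun x hx => r3 x (hmem x hx),
    fun x hx => hz x (by simpa using hx)⟩
  unfold mountainPassLevel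
  refine (IsLeast.csInf_eq ⟨?_, ?_⟩).symm
  · let T : ℝ := (p / 2) ^ (1 / (p - 2))
    have hT1 : 1 ≤ T := Real.one_le_rpow (by linarith) (by have : 0 < p - 2 := by linarith
                                                           positivity)
    have hTp : T ^ p = T ^ 2 * (p / 2) := by
      have e1 : T ^ (p - 2) = p / 2 := by
        rw [← rpow_mul (by linarith), one_div_mul_cancel (by linarith), rpow_one]
      rw [← e1, ← rpow_natCast, ← rpow_add (by linarith)]
      congr 1; push_cast; ring
    have hc0 : ∀ t ∈ Icc (0 : ℝ) 1, 0 ≤ t * T := fun t ht => mul_nonneg ht.1 (by linarith)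
    refine ⟨fun t y => (t * T) * u y, fun t ht => hKc _ (hc0 t ht), fun t ht ε hε => ?_, ?_, ?_, ?_, ?_⟩
    · set V := vnorm (BB N) (fun x => ‖x‖ ^ α) p u with hV
      have hV0 : 0 ≤ V := (sqrt_nonneg _).trans (An_vnorm hK.1)
      refine ⟨ε / (T * V + 1), by positivity, fun s hs hst => ?_⟩
      have e : (fun y => (s * T) * u y) - (fun y => (t * T) * u y) = fun y => ((s - t) * T) * u y := by
        funext y; simp only [Pi.sub_apply]; ring
      rw [e, vnorm_smul hp, ← hV, abs_mul, abs_of_pos (show 0 < T by linarith)]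
      rw [lt_div_iff₀ (by positivity)] at hst
      nlinarith [abs_nonneg (s - t)]
    · funext y; simp
    · intro h
      have h0 := congrFun h 0
      have := r1 0 (by simp)
      have : 0 < (1 * T) * u 0 := by positivity
      exact this.ne' h0
    · simp only [one_mul]
      rw [hEc T (by linarith), hTp]
      refine le_of_eq ?_
      field_simp
      ring
    · symm
      apply IsGreatest.csSup_eq
      constructor
      · refine ⟨1 / T, ⟨by positivity, (div_le_one (by linarith)).2 hT1⟩, ?_⟩
        simp only [one_div_mul_cancel (show T ≠ 0 by linarith), one_mul]
      · rintro _ ⟨t, ht, rfl⟩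
        simp only
        have hs := hc0 t ht
        rw [hEc _ hs, hE, ← sub_mul]
        refine mul_le_mul_of_nonneg_right ?_ hd.le
        set s := t * T
        have hb := one_add_mul_self_le_rpow_one_add (s := s ^ 2 - 1) (p := p / 2) (by nlinarith [sq_nonneg s]) (by linarith)
        have e : (1 + (s ^ 2 - 1)) ^ (p / 2) = s ^ p := by
          rw [add_sub_cancel, ← rpow_natCast, ← rpow_mul hs]; congr 1; push_cast; ring
        rw [e] at hb
        have := mul_le_mul_of_nonneg_left hb (show 0 ≤ 1 / p by positivity)
        have e2 : 1 / p * (1 + p / 2 * (s ^ 2 - 1)) = 1 / p + (s ^ 2 - 1) / 2 := by field_simp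
        linarith
  · rintro c ⟨γ, h1, h2, h3, h4, h5, rfl⟩
    rw [hE]
    exact P.mp_lower hd hR hdR h1 h2 h3 h4 h5

end Henon

/-- Theorem 5.1, part 1: existence of a positive classical `K₊`
ground state solution of the Hénon equation `−Δu = |x|^α u^{p−1}` on the unit ball of
`ℝ^N`, `N = 2n ≥ 4` even, `α > 0`, for `2 < p < (2N+2α)/(N−2)`. -/
theorem statement8
    (n N : ℕ) (hn : 2 ≤ n) (hN : N = 2 * n)
    (B1 : Set (Euc N)) (hB1 : B1 = Metric.ball (0 : Euc N) 1)
    (α : ℝ) (hα : 0 < α)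
    (p : ℝ) (hp1 : 2 < p) (hp2 : p < (2 * N + 2 * α) / ((N : ℝ) - 2)) :
    ∃ u : Euc N → ℝ,
      IsGroundState B1 (fun x => ‖x‖ ^ α) p (Kplus n B1) u ∧
      (∀ x ∈ B1, 0 < u x) ∧
      (∀ x ∈ B1, ContDiffAt ℝ 2 u x) ∧
      (∀ x ∈ B1, - lap u x = ‖x‖ ^ α * u x ^ (p - 1)) ∧
      (∀ x ∉ B1, u x = 0) := by
  obtain ⟨m, rfl⟩ : ∃ m, n = m + 1 := ⟨n - 1, by omega⟩
  have hNr : (N : ℝ) = 2 * m + 2 := by rw [hN]; push_cast; ring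
  have hm : (1 : ℝ) ≤ m := by exact_mod_cast (show 1 ≤ m by omega)
  rw [lt_div_iff₀ (by linarith)] at hp2
  have P : Henon.Par N m α p := ⟨by omega, by omega, hα, hp1, by rw [hNr] at hp2 ⊢; nlinarith⟩
  subst hB1
  exact P.final

end
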